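/- Fix a nonempty ∂ ⊂ {0,1}. Let (f,g) ≠ (id,id) be a pair of commuting elements of Diff*_∂[0,1] such that f and g are the time-1 and time-α maps of the flow of a common vector field ξ on [0,1], C¹ on [0,1] and C^∞ on (0,1), where α is irrational. Then for every ε > 0 and every k ∈ ℕ there exist f̃, g̃ ∈ Diff*_∂[0,1] with ‖f − f̃‖_k ≤ ε and ‖g − g̃‖_k ≤ ε such that f̃ and g̃ are the time-1 and time-α maps of the flow of a C^∞ vector field on [0,1] which is nowhere infinitely flat on (0,1). -/

import Mathlib

set_option autoImplicit false

open Set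

/-- `f : ℝ → ℝ` represents (a smooth extension of) an orientation-preserving `C^∞`
diffeomorphism of the interval `[0,1]`. -/
def SmoothDiffeoI (f : ℝ → ℝ) : Prop :=
  ContDiff ℝ (⊤ : ℕ∞) f ∧ f 0 = 0 ∧ f 1 = 1 ∧ (∀ x ∈ Icc (0 : ℝ) 1, 0 < deriv f x) ∧
    MapsTo f (Icc (0 : ℝ) 1) (Icc (0 : ℝ) 1)

/-- `f` is infinitely tangent to the identity at `p`. -/
def ITIat (f : ℝ → ℝ) (p : ℝ) : Prop :=
  f p = p ∧ ∀ n : ℕ, 1 ≤ n → iteratedDeriv n (fun x => f x - x) p = 0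

/-- `Diff*_∂[0,1]`: the identity, together with the orientation-preserving `C^∞`
diffeomorphisms of `[0,1]` which are infinitely tangent to the identity exactly at the
points of `D` and nowhere else in `[0,1]`. -/
def DiffStar (D : Set ℝ) (f : ℝ → ℝ) : Prop :=
  SmoothDiffeoI f ∧
    ((∀ x ∈ Icc (0 : ℝ) 1, f x = x) ∨ ∀ p ∈ Icc (0 : ℝ) 1, (ITIat f p ↔ p ∈ D))

/-- `φ` is the (complete) flow of the vector field `ξ` on the interval `[a,b]`. -/
def IsFlowOn (ξ : ℝ → ℝ) (φ : ℝ → ℝ → ℝ) (a b : ℝ) : Prop :=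
  (∀ x ∈ Icc a b, φ 0 x = x) ∧
    ∀ x ∈ Icc a b, ∀ t : ℝ, φ t x ∈ Icc a b ∧ HasDerivAt (fun s => φ s x) (ξ (φ t x)) t

section
open Set Filter Topology
open scoped ContDiff
namespace Aux

lemma cd_iter {u : ℝ → ℝ} {s : Set ℝ} (hs : IsOpen s) (hu : ContDiffOn ℝ ∞ u s) (n : ℕ) :
    ContDiffOn ℝ ∞ (iteratedDeriv n u) s := by
  induction n with
  | zero => simpa using hu
  | succ n ih =>
    rw [iteratedDeriv_succ]
    exact ih.deriv_of_isOpen hs (by simp)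

lemma cd_at {u : ℝ → ℝ} {s : Set ℝ} (hs : IsOpen s) (hu : ContDiffOn ℝ ∞ u s) {x : ℝ}
    (hx : x ∈ s) : ContDiffAt ℝ ∞ u x := hu.contDiffAt (hs.mem_nhds hx)

lemma cd_at_nat {u : ℝ → ℝ} {s : Set ℝ} (hs : IsOpen s) (hu : ContDiffOn ℝ ∞ u s) {x : ℝ}
    (hx : x ∈ s) (n : ℕ) : ContDiffAt ℝ n u x := (cd_at hs hu hx).of_le (by exact_mod_cast le_top)

lemma cd_hasDeriv {u : ℝ → ℝ} {s : Set ℝ} (hs : IsOpen s) (hu : ContDiffOn ℝ ∞ u s) (n : ℕ)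
    {x : ℝ} (hx : x ∈ s) :
    HasDerivAt (iteratedDeriv n u) (iteratedDeriv (n + 1) u x) x := by
  rw [iteratedDeriv_succ]
  exact ((cd_at hs (cd_iter hs hu n) hx).differentiableAt (by simp)).hasDerivAt

lemma cd_cont {u : ℝ → ℝ} {s : Set ℝ} (hs : IsOpen s) (hu : ContDiffOn ℝ ∞ u s) (n : ℕ) :
    ContinuousOn (iteratedDeriv n u) s := (cd_iter hs hu n).continuousOn

lemma cd_of_diff {u : ℝ → ℝ} {s : Set ℝ} (hs : IsOpen s)
    (h : ∀ n : ℕ, ∀ x ∈ s, DifferentiableAt ℝ (iteratedDeriv n u) x) : ContDiffOn ℝ ∞ u s := by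
  refine contDiffOn_of_differentiableOn_deriv (n := ⊤) fun m _ => ?_
  intro x hx
  refine ((h m x hx).differentiableWithinAt (s := s)).congr (fun y hy => ?_) ?_
  · exact iteratedDerivWithin_of_isOpen hs hy
  · exact iteratedDerivWithin_of_isOpen hs hx

lemma norm_within {u : ℝ → ℝ} {s : Set ℝ} (hs : IsOpen s) (n : ℕ) {x : ℝ} (hx : x ∈ s) :
    ‖iteratedFDerivWithin ℝ n u s x‖ = |iteratedDeriv n u x| := by
  rw [norm_iteratedFDerivWithin_eq_norm_iteratedDerivWithin, iteratedDerivWithin_of_isOpen hs hx,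
    Real.norm_eq_abs]

/-- Composition bound. -/
lemma comp_bound {g f : ℝ → ℝ} {U S : Set ℝ} (hU : IsOpen U) (hS : IsOpen S)
    (hg : ContDiffOn ℝ ∞ g S) (hf : ContDiffOn ℝ ∞ f U) (hm : MapsTo f U S) {n : ℕ} {t C B : ℝ}
    (ht : t ∈ U) (hC : ∀ i ≤ n, |iteratedDeriv i g (f t)| ≤ C)
    (hB : ∀ i, 1 ≤ i → i ≤ n → |iteratedDeriv i f t| ≤ B ^ i) :
    |iteratedDeriv n (fun x => g (f x)) t| ≤ n.factorial * C * B ^ n := by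
  have := norm_iteratedFDerivWithin_comp_le (n := n) (N := ∞) hg hf (by exact_mod_cast le_top)
    hS.uniqueDiffOn hU.uniqueDiffOn hm ht (C := C) (D := B)
    (fun i hi => by rw [norm_within hS i (hm ht)]; exact hC i hi)
    (fun i h1 hi => by rw [norm_within hU i ht]; exact hB i h1 hi)
  rw [norm_within hU n ht] at this
  exact this

/-- Product bound. -/
lemma mul_bound {f g : ℝ → ℝ} {U : Set ℝ} (hU : IsOpen U)
    (hf : ContDiffOn ℝ ∞ f U) (hg : ContDiffOn ℝ ∞ g U) {n : ℕ} {t A A' B : ℝ}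
    (ht : t ∈ U) (hB0 : 0 ≤ B) (hA : ∀ i ≤ n, |iteratedDeriv i f t| ≤ A * B ^ i)
    (hA' : ∀ i ≤ n, |iteratedDeriv i g t| ≤ A' * B ^ i) :
    |iteratedDeriv n (fun x => f x * g x) t| ≤ 2 ^ n * (A * A') * B ^ n := by
  have := norm_iteratedFDerivWithin_mul_le (n := n) (N := ∞) hf hg
    hU.uniqueDiffOn ht (by exact_mod_cast le_top)
  rw [norm_within hU n ht] at this
  refine this.trans ?_
  have h0 : 0 ≤ A := by have := hA 0 (Nat.zero_le _); simp at this; exact (abs_nonneg _).trans this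
  calc _ ≤ ∑ i ∈ Finset.range (n + 1), (n.choose i : ℝ) * (A * A' * B ^ n) := by
        refine Finset.sum_le_sum fun i hi => ?_
        have hin : i ≤ n := by simpa [Nat.lt_succ_iff] using hi
        rw [norm_within hU i ht, norm_within hU (n - i) ht, mul_assoc]
        refine mul_le_mul_of_nonneg_left ?_ (by positivity)
        calc _ ≤ (A * B ^ i) * (A' * B ^ (n - i)) :=
              mul_le_mul (hA i hin) (hA' (n - i) (Nat.sub_le _ _)) (abs_nonneg _) (by positivity)
          _ = A * A' * (B ^ i * B ^ (n - i)) := by ring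
          _ = _ := by rw [← pow_add, Nat.add_sub_cancel' hin]
    _ = _ := by
        rw [← Finset.sum_mul]
        have : (∑ i ∈ Finset.range (n + 1), (n.choose i : ℝ)) = 2 ^ n := by
          exact_mod_cast Nat.sum_range_choose n
        rw [this]; ring

/-- Gluing with zero at `0`. -/
lemma glue_zero {G : ℝ → ℝ} {a : ℝ} (ha : 0 < a) (h0 : ∀ x ≤ 0, G x = 0)
    (hs : ContDiffOn ℝ ∞ G (Ioo 0 a))
    (hl : ∀ i : ℕ, Tendsto (iteratedDeriv i G) (𝓝[>] 0) (𝓝 0)) :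
    ContDiffOn ℝ ∞ G (Iio a) ∧ ∀ i : ℕ, ∀ x ≤ 0, iteratedDeriv i G x = 0 := by
  have key : ∀ i : ℕ, (∀ x ≤ 0, iteratedDeriv i G x = 0) ∧
      HasDerivAt (iteratedDeriv i G) 0 0 := by
    have step : ∀ i : ℕ, (∀ x ≤ 0, iteratedDeriv i G x = 0) →
        HasDerivAt (iteratedDeriv i G) 0 0 := by
      intro i hi
      have h1 : HasDerivWithinAt (iteratedDeriv i G) 0 (Ici 0) 0 := by
        refine hasDerivWithinAt_Ici_of_tendsto_deriv (s := Ioo 0 a) ?_ ?_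
          (Ioo_mem_nhdsGT ha) ?_
        · intro x hx
          exact (cd_hasDeriv isOpen_Ioo hs i hx).differentiableAt.differentiableWithinAt
        · have : Tendsto (iteratedDeriv i G) (𝓝[Ioo 0 a] 0) (𝓝 0) :=
            (hl i).mono_left (nhdsWithin_mono _ Ioo_subset_Ioi_self)
          unfold ContinuousWithinAt
          rwa [hi 0 le_rfl]
        · have := hl (i + 1)
          rwa [iteratedDeriv_succ] at this
      have h2 : HasDerivWithinAt (iteratedDeriv i G) 0 (Iic 0) 0 :=
        (hasDerivWithinAt_const (0 : ℝ) (Iic 0) (0 : ℝ)).congr (fun x hx => hi x hx)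
          (hi 0 le_rfl)
      have := h2.union h1
      rwa [Iic_union_Ici, hasDerivWithinAt_univ] at this
    intro i
    induction i with
    | zero =>
      have : ∀ x ≤ 0, iteratedDeriv 0 G x = 0 := by simpa using h0
      exact ⟨this, step 0 this⟩
    | succ i ih =>
      have : ∀ x ≤ 0, iteratedDeriv (i + 1) G x = 0 := by
        intro x hx
        rw [iteratedDeriv_succ]
        rcases hx.lt_or_eq with hx | rfl
        · have : iteratedDeriv i G =ᶠ[𝓝 x] fun _ => 0 := by
            filter_upwards [Iio_mem_nhds hx] with y hy using ih.1 y (le_of_lt hy)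
          rw [this.deriv_eq]; simp
        · exact ih.2.deriv
      exact ⟨this, step _ this⟩
  refine ⟨cd_of_diff isOpen_Iio fun n x hx => ?_, fun i => (key i).1⟩
  rcases lt_trichotomy x 0 with h | rfl | h
  · have : iteratedDeriv n G =ᶠ[𝓝 x] fun _ => 0 := by
      filter_upwards [Iio_mem_nhds h] with y hy using (key n).1 y (le_of_lt hy)
    exact (differentiableAt_const (0 : ℝ)).congr_of_eventuallyEq this
  · exact (key n).2.differentiableAt
  · exact (cd_hasDeriv isOpen_Ioo hs n ⟨h, hx⟩).differentiableAt

/-- cut off to zero on the left of a flat point -/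
lemma cut_zero {u : ℝ → ℝ} {b : ℝ} {s : Set ℝ} (hs : IsOpen s) (hsub : Ico 0 b ⊆ s) (hb : 0 < b)
    (hu : ContDiffOn ℝ ∞ u s)
    (hflat : ∀ i : ℕ, iteratedDeriv i u 0 = 0) :
    ContDiffOn ℝ ∞ (fun x => if x ≤ 0 then 0 else u x) (Iio b) ∧
    (∀ i : ℕ, ∀ x ≤ 0, iteratedDeriv i (fun x => if x ≤ 0 then 0 else u x) x = 0) ∧
    (∀ i : ℕ, ∀ x > 0, iteratedDeriv i (fun x => if x ≤ 0 then 0 else u x) x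
      = iteratedDeriv i u x) := by
  have he : ∀ i : ℕ, ∀ x > 0, iteratedDeriv i (fun x => if x ≤ 0 then 0 else u x) x
      = iteratedDeriv i u x := by
    intro i x hx
    refine Filter.EventuallyEq.iteratedDeriv_eq i ?_
    filter_upwards [Ioi_mem_nhds hx] with y hy
    simp [not_le.mpr (show (0:ℝ) < y from hy)]
  have := glue_zero (G := fun x => if x ≤ 0 then 0 else u x) hb (fun x hx => by simp [hx]) ?_ ?_
  · exact ⟨this.1, this.2, he⟩
  · refine (hu.mono (Ioo_subset_Ico_self.trans hsub)).congr fun x hx => ?_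
    simp [not_le.mpr hx.1]
  · intro i
    have h1 : Tendsto (iteratedDeriv i u) (𝓝[>] 0) (𝓝 0) := by
      have := (cd_cont hs hu i).continuousAt (hs.mem_nhds (hsub ⟨le_rfl, hb⟩))
      have h2 := this.tendsto
      rw [hflat i] at h2
      exact h2.mono_left nhdsWithin_le_nhds
    refine h1.congr' ?_
    filter_upwards [self_mem_nhdsWithin] with x hx using (he i x hx).symm

end Aux
end

section
open Set Filter Topology
open scoped ContDiff
namespace Aux

lemma landau {u : ℝ → ℝ} {b δ m0 m2 : ℝ} (hu : ContDiffOn ℝ ∞ u (Iio b)) (hδ : δ < b)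
    (h0 : ∀ x ≤ δ, |u x| ≤ m0) (h2 : ∀ x ≤ δ, |iteratedDeriv 2 u x| ≤ m2) :
    ∀ x ≤ δ, |iteratedDeriv 1 u x| ^ 2 ≤ 4 * m0 * m2 := by
  intro x hx
  have hm0 : 0 ≤ m0 := (abs_nonneg _).trans (h0 x hx)
  have hm2 : 0 ≤ m2 := (abs_nonneg _).trans (h2 x hx)
  have key : ∀ τ > 0, τ * |iteratedDeriv 1 u x| ≤ 2 * m0 + m2 / 2 * τ ^ 2 := by
    intro τ hτ
    -- g(s) = u(x-s) + s u'(x)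
    have hd : ∀ s ∈ Icc 0 τ, |iteratedDeriv 1 u x - iteratedDeriv 1 u (x - s)| ≤ m2 * s := by
      intro s hs
      have := Convex.norm_image_sub_le_of_norm_hasDerivWithin_le (f := iteratedDeriv 1 u)
        (f' := iteratedDeriv 2 u) (s := Iic δ) (x := x - s) (y := x) (C := m2)
        (fun y hy => (cd_hasDeriv isOpen_Iio hu 1 (lt_of_le_of_lt hy hδ)).hasDerivWithinAt)
        (fun y hy => h2 y hy) (convex_Iic δ) (by simp; linarith [hs.1]) hx
      simpa [abs_of_nonneg hs.1] using this
    have hq := image_norm_le_of_norm_deriv_right_le_deriv_boundary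
      (f := fun s => u (x - s) - u x + s * iteratedDeriv 1 u x)
      (f' := fun s => - iteratedDeriv 1 u (x - s) + iteratedDeriv 1 u x) (a := 0) (b := τ)
      (B := fun s => m2 / 2 * s ^ 2) (B' := fun s => m2 * s) ?_ ?_ ?_ ?_ ?_
    · have h := hq (x := τ) ⟨hτ.le, le_rfl⟩
      have e1 := h0 x hx
      have e2 := h0 (x - τ) (by linarith)
      simp only [Real.norm_eq_abs] at h
      rw [abs_le] at h e1 e2
      rcases abs_cases (iteratedDeriv 1 u x) with ⟨h', _⟩ | ⟨h', _⟩ <;> rw [h'] <;> nlinarith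
    · intro s hs
      have h1 : HasDerivAt (fun s => u (x - s)) (- iteratedDeriv 1 u (x - s)) s := by
        have := (cd_hasDeriv isOpen_Iio hu 0 (x := x - s)
          (by simp only [mem_Iio]; linarith [hs.1])).comp s ((hasDerivAt_id s).const_sub x)
        simpa [Function.comp_def, iteratedDeriv_zero] using this
      have := (h1.sub_const (u x)).add ((hasDerivAt_id s).mul_const (iteratedDeriv 1 u x))
      exact this.continuousAt.continuousWithinAt
    · intro s hs
      have h1 : HasDerivAt (fun s => u (x - s)) (- iteratedDeriv 1 u (x - s)) s := by
        have := (cd_hasDeriv isOpen_Iio hu 0 (x := x - s)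
          (by simp only [mem_Iio]; linarith [hs.1])).comp s ((hasDerivAt_id s).const_sub x)
        simpa [Function.comp_def, iteratedDeriv_zero] using this
      have := (h1.sub_const (u x)).add ((hasDerivAt_id s).mul_const (iteratedDeriv 1 u x))
      have h3 := this.hasDerivWithinAt (s := Ici s)
      rw [one_mul] at h3
      exact h3
    · simp
    · intro s
      have := ((hasDerivAt_pow 2 s).const_mul (m2 / 2))
      refine this.congr_deriv ?_
      push_cast; ring
    · intro s hs
      have := hd s ⟨hs.1, hs.2.le⟩
      rw [Real.norm_eq_abs]
      convert this using 2
      ring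
  have key2 : ∀ τ : ℝ, 0 ≤ m2 / 2 * (τ * τ) + (-|iteratedDeriv 1 u x|) * τ + 2 * m0 := by
    intro τ
    rcases le_or_gt τ 0 with h | h
    · have := mul_nonneg (abs_nonneg (iteratedDeriv 1 u x)) (neg_nonneg.2 h)
      nlinarith [mul_nonneg hm2 (mul_self_nonneg τ)]
    · nlinarith [key τ h]
  have := discrim_le_zero key2
  unfold discrim at this
  nlinarith

lemma exists_max {u : ℝ → ℝ} {b δ : ℝ} (hu : ContinuousOn u (Iio b)) (hδ : δ < b)
    (hz : ∀ x ≤ 0, u x = 0) : ∃ x1 ≤ δ, ∀ x ≤ δ, |u x| ≤ |u x1| := by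
  obtain ⟨x1, hx1, hmax⟩ := (isCompact_Icc (a := min δ 0) (b := δ)).exists_isMaxOn
    ⟨δ, by simp⟩ (f := fun x => |u x|)
    ((hu.mono fun x hx => lt_of_le_of_lt hx.2 hδ).abs)
  refine ⟨x1, hx1.2, fun x hx => ?_⟩
  rcases le_or_gt (min δ 0) x with h | h
  · exact hmax ⟨h, hx⟩
  · rw [hz x (h.le.trans (min_le_right _ _))]; simp

lemma kol {b b' : ℝ} (hb : b' < b) (n : ℕ) : ∀ u : ℝ → ℝ, ContDiffOn ℝ ∞ u (Iio b) →
    (∀ i : ℕ, ∀ x ≤ 0, iteratedDeriv i u x = 0) →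
    ∃ C ≥ 0, ∀ δ ≤ b', ∀ m0 ≥ 0, (∀ x ≤ δ, |u x| ≤ m0) →
      ∀ x ≤ δ, |iteratedDeriv 1 u x| ^ (n + 1) ≤ C * m0 ^ n := by
  induction n with
  | zero =>
    intro u hu hz
    obtain ⟨x1, _, h⟩ := exists_max (cd_cont isOpen_Iio hu 1) hb (hz 1)
    exact ⟨|iteratedDeriv 1 u x1|, abs_nonneg _, fun δ hδ m0 _ _ x hx => by
      simpa using h x (hx.trans hδ)⟩
  | succ n ih =>
    intro u hu hz
    have hu1 := cd_iter isOpen_Iio hu 1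
    have e : ∀ i : ℕ, iteratedDeriv i (iteratedDeriv 1 u) = iteratedDeriv (i + 1) u := by
      intro i
      rw [iteratedDeriv_one, ← iteratedDeriv_succ']
    obtain ⟨C, hC, h⟩ := ih (iteratedDeriv 1 u) hu1 (fun i => by rw [e]; exact hz (i + 1))
    refine ⟨4 ^ (n + 1) * C, by positivity, fun δ hδ m0 hm0 hb0 x hx => ?_⟩
    obtain ⟨x1, hx1, h1⟩ := exists_max (cd_cont isOpen_Iio hu 1) (hδ.trans_lt hb) (hz 1)
    obtain ⟨x2, hx2, h2⟩ := exists_max (cd_cont isOpen_Iio hu 2) (hδ.trans_lt hb) (hz 2)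
    have hl := landau hu (hδ.trans_lt hb) hb0 h2 x1 hx1
    have hi := h δ hδ _ (abs_nonneg _) h1 x2 hx2
    rw [e] at hi
    set M1 := |iteratedDeriv 1 u x1|
    set M2 := |iteratedDeriv 2 u x2|
    have hM1 : 0 ≤ M1 := abs_nonneg _
    have hM2 : 0 ≤ M2 := abs_nonneg _
    refine (pow_le_pow_left₀ (abs_nonneg _) (h1 x hx) _).trans ?_
    rcases hM1.eq_or_lt with h0 | h0
    · rw [← h0, zero_pow (by omega)]; positivity
    · have : M1 ^ n * M1 ^ (n + 1 + 1) ≤ M1 ^ n * (4 ^ (n + 1) * C * m0 ^ (n + 1)) := by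
        calc M1 ^ n * M1 ^ (n + 1 + 1) = (M1 ^ 2) ^ (n + 1) := by ring
          _ ≤ (4 * m0 * M2) ^ (n + 1) := pow_le_pow_left₀ (by positivity) hl _
          _ = (4 * m0) ^ (n + 1) * M2 ^ (n + 1) := by ring
          _ ≤ (4 * m0) ^ (n + 1) * (C * M1 ^ n) := by gcongr
          _ = _ := by ring
      exact le_of_mul_le_mul_left this (by positivity)

lemma kol_rpow1 {b b' : ℝ} (hb : b' < b) {u : ℝ → ℝ} (hu : ContDiffOn ℝ ∞ u (Iio b))
    (hz : ∀ i : ℕ, ∀ x ≤ 0, iteratedDeriv i u x = 0) {η : ℝ} (hη : 0 < η) (hη1 : η < 1)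
    {M : ℝ} (hM : 0 ≤ M) :
    ∃ C ≥ 0, ∀ δ ≤ b', ∀ m0 ≥ 0, m0 ≤ M → (∀ x ≤ δ, |u x| ≤ m0) →
      ∀ x ≤ δ, |iteratedDeriv 1 u x| ≤ C * m0 ^ (1 - η) := by
  obtain ⟨n, hn⟩ := exists_nat_one_div_lt hη
  obtain ⟨C, hC, h⟩ := kol hb n u hu hz
  refine ⟨C ^ (((n + 1 : ℕ) : ℝ)⁻¹) * M ^ (η - 1 / (n + 1)), by positivity,
    fun δ hδ m0 hm0 hm1 hb0 x hx => ?_⟩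
  have h1 := h δ hδ m0 hm0 hb0 x hx
  have hn0 : (0:ℝ) < n + 1 := by positivity
  have h2 : |iteratedDeriv 1 u x| ≤ (C * m0 ^ n) ^ (((n + 1 : ℕ) : ℝ)⁻¹) := by
    rw [Real.le_rpow_inv_iff_of_pos (abs_nonneg _) (by positivity) (by positivity),
      Real.rpow_natCast]
    exact h1
  refine h2.trans ?_
  rw [Real.mul_rpow hC (by positivity), ← Real.rpow_natCast m0, ← Real.rpow_mul hm0, mul_assoc]
  have : (n : ℝ) * ((n + 1 : ℕ) : ℝ)⁻¹ = (η - 1 / (n + 1)) + (1 - η) := by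
    push_cast; field_simp; ring
  rw [this, Real.rpow_add_of_nonneg hm0 (by linarith) (by linarith)]
  have : 0 ≤ η - 1 / ((n : ℝ) + 1) := by linarith
  gcongr

lemma iter_iter (u : ℝ → ℝ) (i j : ℕ) :
    iteratedDeriv i (iteratedDeriv j u) = iteratedDeriv (i + j) u := by
  rw [iteratedDeriv_eq_iterate, iteratedDeriv_eq_iterate, iteratedDeriv_eq_iterate,
    Function.iterate_add_apply]

lemma kol_rpow {b b' : ℝ} (hb : b' < b) {u : ℝ → ℝ} (hu : ContDiffOn ℝ ∞ u (Iio b))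
    (hz : ∀ i : ℕ, ∀ x ≤ 0, iteratedDeriv i u x = 0) (j : ℕ) : ∀ η : ℝ, 0 < η → η < 1 →
    ∃ C ≥ 0, ∀ δ ≤ b', ∀ m0 ≥ 0, m0 ≤ 1 → (∀ x ≤ δ, |u x| ≤ m0) →
      ∀ x ≤ δ, |iteratedDeriv j u x| ≤ C * m0 ^ (1 - η) := by
  induction j with
  | zero =>
    intro η hη hη1
    refine ⟨1, zero_le_one, fun δ hδ m0 hm0 hm1 hb0 x hx => ?_⟩
    rw [iteratedDeriv_zero, one_mul]
    refine (hb0 x hx).trans ?_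
    conv_lhs => rw [← Real.rpow_one m0]
    exact Real.rpow_le_rpow_of_exponent_ge' hm0 hm1 (by linarith) (by linarith)
  | succ j ih =>
    intro η hη hη1
    obtain ⟨C, hC, h⟩ := ih (η / 2) (by linarith) (by linarith)
    obtain ⟨C', hC', h'⟩ := kol_rpow1 hb (cd_iter isOpen_Iio hu j)
      (fun i => by rw [iter_iter]; exact hz _) (η := η / 2) (by linarith) (by linarith) hC
    refine ⟨C' * C ^ (1 - η / 2), by positivity, fun δ hδ m0 hm0 hm1 hb0 x hx => ?_⟩
    have h1 := h δ hδ m0 hm0 hm1 hb0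
    have hp : m0 ^ (1 - η / 2) ≤ 1 := Real.rpow_le_one hm0 hm1 (by linarith)
    have h2 := h' δ hδ (C * m0 ^ (1 - η / 2)) (by positivity) (by nlinarith) h1 x hx
    rw [iter_iter, add_comm] at h2
    refine h2.trans ?_
    rw [Real.mul_rpow hC (by positivity), ← Real.rpow_mul hm0, mul_assoc]
    have h3 : m0 ^ ((1 - η / 2) * (1 - η / 2)) ≤ m0 ^ (1 - η) :=
      Real.rpow_le_rpow_of_exponent_ge' hm0 hm1 (by linarith) (by nlinarith)
    gcongr

end Aux
end

section
open Set Filter Topology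
open scoped ContDiff
namespace Aux

structure Orb (x V : ℝ → ℝ) (K L a : ℝ) : Prop where
  hV : ContDiffOn ℝ ∞ V (Ioi a)
  hx : ∀ t > a, HasDerivAt x (-Real.exp (V t)) t
  hK : ∀ t > a, |iteratedDeriv 1 V t| ≤ K
  lim : Tendsto x atTop (𝓝 L)

namespace Orb
variable {x V : ℝ → ℝ} {K L a : ℝ}

lemma mono (h : Orb x V K L a) {a' : ℝ} (ha : a ≤ a') : Orb x V K L a' :=
  ⟨h.hV.mono (Ioi_subset_Ioi ha), fun t ht => h.hx t (ha.trans_lt ht),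
    fun t ht => h.hK t (ha.trans_lt ht), h.lim⟩

lemma Knn (h : Orb x V K L a) : 0 ≤ K := (abs_nonneg _).trans (h.hK (a + 1) (by linarith))

lemma anti (h : Orb x V K L a) : AntitoneOn x (Ioi a) := by
  refine antitoneOn_of_deriv_nonpos (convex_Ioi a)
    (fun t ht => (h.hx t ht).continuousAt.continuousWithinAt)
    (fun t ht => (h.hx t (interior_subset ht)).differentiableAt.differentiableWithinAt)
    (fun t ht => ?_)
  rw [(h.hx t (interior_subset ht)).deriv]
  exact neg_nonpos.2 (Real.exp_pos _).le

lemma L_le (h : Orb x V K L a) {t : ℝ} (ht : a < t) : L ≤ x t := by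
  refine le_of_tendsto h.lim ?_
  filter_upwards [eventually_ge_atTop t] with s hs
  exact h.anti ht (lt_of_lt_of_le ht hs) hs

lemma smooth (h : Orb x V K L a) : ContDiffOn ℝ ∞ x (Ioi a) := by
  rw [contDiffOn_infty_iff_deriv_of_isOpen isOpen_Ioi]
  refine ⟨fun t ht => (h.hx t ht).differentiableAt.differentiableWithinAt, ?_⟩
  refine (Real.contDiff_exp.comp_contDiffOn h.hV).neg.congr fun t ht => ?_
  rw [(h.hx t ht).deriv]; rfl

lemma iter_succ (h : Orb x V K L a) {t : ℝ} (ht : a < t) (n : ℕ) :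
    iteratedDeriv (n + 1) x t = - iteratedDeriv n (fun t => Real.exp (V t)) t := by
  rw [iteratedDeriv_succ', ← iteratedDeriv_fun_neg]
  refine Filter.EventuallyEq.iteratedDeriv_eq n ?_
  filter_upwards [isOpen_Ioi.mem_nhds ht] with s hs
  exact (h.hx s hs).deriv

lemma V_le (h : Orb x V K L a) {s t : ℝ} (ht : a < t) (hs : a < s) : |V s - V t| ≤ K * |s - t| := by
  exact Convex.norm_image_sub_le_of_norm_hasDerivWithin_le (f := V)
        (f' := iteratedDeriv 1 V) (s := Ioi a) (x := t) (y := s) (C := K)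
        (fun y hy => (by simpa using cd_hasDeriv isOpen_Ioi h.hV 0 hy :
          HasDerivAt V (iteratedDeriv 1 V y) y).hasDerivWithinAt)
        (fun y hy => h.hK y hy) (convex_Ioi a) ht hs

lemma exp_shift (h : Orb x V K L a) {s t : ℝ} (ht : a < t) (hs : t ≤ s) (hs1 : s ≤ t + 1) :
    Real.exp (V s) ≤ Real.exp K * Real.exp (V t) := by
  rw [← Real.exp_add]
  apply Real.exp_le_exp.2
  have := h.V_le ht (ht.trans_le hs)
  rw [abs_of_nonneg (by linarith : 0 ≤ s - t), abs_le] at this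
  nlinarith [h.Knn]

lemma exp_le_diff (h : Orb x V K L a) {t : ℝ} (ht : a < t) :
    Real.exp (V t) ≤ Real.exp K * (x t - x (t + 1)) := by
  obtain ⟨c, hc, he⟩ := exists_hasDerivAt_eq_slope x (fun t => - Real.exp (V t))
    (by linarith : t < t + 1)
    (fun s hs => (h.hx s (ht.trans_le hs.1)).continuousAt.continuousWithinAt)
    (fun s hs => h.hx s (ht.trans hs.1))
  have e : x t - x (t + 1) = Real.exp (V c) := by
    have : t + 1 - t = 1 := by ring
    rw [this] at he
    linarith [he, div_one (x (t + 1) - x t)]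
  rw [e, ← Real.exp_add]
  apply Real.exp_le_exp.2
  have := h.V_le ht (ht.trans hc.1)
  rw [abs_of_nonneg (by linarith [hc.1] : 0 ≤ c - t), abs_le] at this
  nlinarith [h.Knn, hc.1, hc.2]

lemma T0 (h : Orb x V K L a) {g : ℝ → ℝ} {A κ : ℝ}
    (hg : ∀ t > a, |g (t + 1) - g t| ≤ A * (x t - x (t + 1))) {t : ℝ} (ht : a < t)
    (hl : Tendsto (fun n : ℕ => g (t + n)) atTop (𝓝 κ)) : |g t - κ| ≤ A * (x t - L) := by
  have h1 : ∀ n : ℕ, |g t - g (t + n)| ≤ A * (x t - x (t + n)) := by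
    intro n
    induction n with
    | zero => simp
    | succ n ih =>
      have := hg (t + n) (by have := n.cast_nonneg (α := ℝ); linarith)
      have e : t + (n + 1 : ℕ) = t + n + 1 := by push_cast; ring
      rw [e]
      rw [abs_le] at *
      constructor <;> nlinarith [this.1, this.2, ih.1, ih.2]
  have htn : Tendsto (fun n : ℕ => t + (n : ℝ)) atTop atTop :=
    tendsto_atTop_add_const_left _ _ tendsto_natCast_atTop_atTop
  refine le_of_tendsto_of_tendsto (tendsto_const_nhds.sub hl).abs
    ((tendsto_const_nhds.sub (h.lim.comp htn)).const_mul A) (Eventually.of_forall h1)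

/-- one differentiation for functions with small increments. -/
lemma T1 (h : Orb x V K L a) {g : ℝ → ℝ} {A κ : ℝ} (hA : 0 ≤ A)
    (hg : DifferentiableOn ℝ g (Ioi a))
    (hR : ∀ t > a, |deriv g (t + 1) - deriv g t| ≤ A * Real.exp (V t))
    (hl : Tendsto g atTop (𝓝 κ)) :
    (∀ t > a, |deriv g t| ≤ A * Real.exp (2 * K) * (x t - L)) ∧
      Tendsto (deriv g) atTop (𝓝 0) := by
  have hd : ∀ t > a, HasDerivAt g (deriv g t) t := fun t ht =>
    ((hg t ht).differentiableAt (isOpen_Ioi.mem_nhds ht)).hasDerivAt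
  have main : ∀ t > a, |deriv g t| ≤ A * Real.exp (2 * K) * (x t - L) := by
    intro t ht
    have hq : ∀ τ : ℝ, 0 < τ → τ < 1 →
        |τ⁻¹ * (g (t + τ) - g t)| ≤ A * Real.exp (2 * K) * (x t - L) := by
      intro τ hτ hτ1
      have := h.T0 (g := fun s => τ⁻¹ * (g (s + τ) - g s)) (A := A * Real.exp (2 * K)) (κ := 0)
        ?_ ht ?_
      · simpa using this
      · intro s hs
        have hb : |(g (s + 1 + τ) - g (s + τ)) - (g (s + 1) - g s)|
            ≤ A * Real.exp K * Real.exp (V s) * τ := by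
          have := Convex.norm_image_sub_le_of_norm_hasDerivWithin_le
            (f := fun r => g (r + 1) - g r)
            (f' := fun r => deriv g (r + 1) - deriv g r) (s := Icc s (s + 1))
            (x := s) (y := s + τ) (C := A * Real.exp K * Real.exp (V s))
            (fun y hy => (((hd (y + 1) (by have := hy.1; have h2 : a < s := hs; linarith)).comp_add_const y 1).sub
              (hd y (lt_of_lt_of_le hs hy.1))).hasDerivWithinAt)
            (fun y hy => ?_) (convex_Icc _ _) ⟨le_rfl, by linarith⟩ ⟨by linarith, by linarith⟩
          · simp only [Real.norm_eq_abs] at this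
            rw [show s + τ - s = τ by ring, abs_of_pos hτ] at this
            convert this using 3
            ring_nf
          · rw [mul_assoc]
            exact (hR y (lt_of_lt_of_le hs hy.1)).trans
              (mul_le_mul_of_nonneg_left (h.exp_shift hs hy.1 hy.2) hA)
        have e : τ⁻¹ * (g (s + 1 + τ) - g (s + 1)) - τ⁻¹ * (g (s + τ) - g s) =
          τ⁻¹ * ((g (s + 1 + τ) - g (s + τ)) - (g (s + 1) - g s)) := by ring
        rw [e, abs_mul, abs_of_pos (inv_pos.2 hτ)]
        calc _ ≤ τ⁻¹ * (A * Real.exp K * Real.exp (V s) * τ) := by gcongr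
          _ = A * Real.exp K * Real.exp (V s) := by field_simp
          _ ≤ A * Real.exp K * (Real.exp K * (x s - x (s + 1))) := by
            gcongr; exact h.exp_le_diff hs
          _ = _ := by rw [two_mul, Real.exp_add]; ring
      · have htn : Tendsto (fun n : ℕ => t + (n : ℝ)) atTop atTop :=
          tendsto_atTop_add_const_left _ _ tendsto_natCast_atTop_atTop
        have h1 := hl.comp htn
        have h2 := hl.comp (tendsto_atTop_add_const_right _ τ htn)
        simpa [Function.comp_def] using (h2.sub h1).const_mul τ⁻¹
    have hs := (hd t ht).tendsto_slope_zero_right.abs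
    refine le_of_tendsto hs ?_
    filter_upwards [Ioo_mem_nhdsGT (zero_lt_one (α := ℝ))] with τ hτ
    simpa using hq τ hτ.1 hτ.2
  refine ⟨main, ?_⟩
  refine squeeze_zero_norm' (a := fun t => A * Real.exp (2 * K) * (x t - L)) ?_ ?_
  · filter_upwards [eventually_gt_atTop a] with t ht using main t ht
  · simpa using (h.lim.sub_const L).const_mul (A * Real.exp (2 * K))

lemma exp_bound (h : Orb x V K L a) {n : ℕ} {M t : ℝ} (ht : a < t)
    (hM : ∀ i, 1 ≤ i → i ≤ n → |iteratedDeriv i V t| ≤ M ^ i) :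
    |iteratedDeriv n (fun t => Real.exp (V t)) t| ≤ n.factorial * Real.exp (V t) * M ^ n := by
  refine comp_bound isOpen_Ioi isOpen_univ Real.contDiff_exp.contDiffOn h.hV
    (mapsTo_univ _ _) ht (fun i _ => ?_) hM
  rw [iteratedDeriv_eq_iterate, Real.iter_deriv_exp, abs_of_pos (Real.exp_pos _)]

lemma exp_neg_bound (h : Orb x V K L a) {n : ℕ} {M t : ℝ} (ht : a < t)
    (hM : ∀ i, 1 ≤ i → i ≤ n → |iteratedDeriv i V t| ≤ M ^ i) :
    |iteratedDeriv n (fun t => Real.exp (- V t)) t| ≤ n.factorial * Real.exp (- V t) * M ^ n := by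
  refine comp_bound (f := fun t => - V t) isOpen_Ioi isOpen_univ Real.contDiff_exp.contDiffOn h.hV.neg
    (mapsTo_univ _ _) ht (fun i _ => ?_) (fun i h1 h2 => ?_)
  · rw [iteratedDeriv_eq_iterate, Real.iter_deriv_exp, abs_of_pos (Real.exp_pos _)]
  · rw [iteratedDeriv_fun_neg, abs_neg]; exact hM i h1 h2

lemma comp_x_bound (h : Orb x V K L a) {E : ℝ → ℝ} {S : Set ℝ} (hS : IsOpen S)
    (hE : ContDiffOn ℝ ∞ E S) (hm : MapsTo x (Ioi a) S) {n : ℕ} {M A t : ℝ} (ht : a < t)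
    (hM0 : Real.exp (V t) ≤ M)
    (hM : ∀ i, 1 ≤ i → i ≤ n → |iteratedDeriv i V t| ≤ M ^ i)
    (hA : ∀ j ≤ n, |iteratedDeriv (j + 1) E (x t)| ≤ A) :
    |iteratedDeriv (n + 1) (fun t => E (x t)) t| ≤
      2 ^ n * (n.factorial * A * (n.factorial * Real.exp (V t))) * (n.factorial * M) ^ n := by
  have hA0 : 0 ≤ A := (abs_nonneg _).trans (hA 0 (Nat.zero_le _))
  have hMp : 0 < M := (Real.exp_pos _).trans_le hM0
  have hn1 : (1 : ℝ) ≤ n.factorial := by exact_mod_cast n.factorial_pos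
  have fac : ∀ {i : ℕ}, i ≤ n → (i.factorial : ℝ) ≤ n.factorial := fun hi => by
    exact_mod_cast Nat.factorial_le hi
  have hE1 := cd_iter hS hE 1
  have e : iteratedDeriv (n + 1) (fun t => E (x t)) t =
      - iteratedDeriv n (fun t => iteratedDeriv 1 E (x t) * Real.exp (V t)) t := by
    rw [iteratedDeriv_succ', ← iteratedDeriv_fun_neg]
    refine Filter.EventuallyEq.iteratedDeriv_eq n ?_
    filter_upwards [isOpen_Ioi.mem_nhds ht] with s hs
    have := (by simpa using cd_hasDeriv hS hE 0 (hm hs) :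
      HasDerivAt E (deriv E (x s)) (x s)).comp s (h.hx s hs)
    rw [iteratedDeriv_one]
    have := this.deriv
    simp only [Function.comp_def] at this
    rw [this]; ring
  have hxi : ∀ i, 1 ≤ i → i ≤ n → |iteratedDeriv i x t| ≤ (n.factorial * M) ^ i := by
    intro i h1 h2
    obtain ⟨i, rfl⟩ : ∃ i', i = i' + 1 := ⟨i - 1, by omega⟩
    rw [h.iter_succ ht, abs_neg]
    refine (h.exp_bound ht (fun j h3 h4 => hM j h3 (by omega))).trans ?_
    calc (i.factorial : ℝ) * Real.exp (V t) * M ^ i ≤ n.factorial * M * M ^ i := by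
          gcongr; omega
      _ = n.factorial * M ^ (i + 1) := by ring
      _ ≤ n.factorial ^ (i + 1) * M ^ (i + 1) := by gcongr; exact le_self_pow₀ hn1 (by omega)
      _ = _ := by ring
  rw [e, abs_neg]
  refine mul_bound isOpen_Ioi (hE1.comp h.smooth hm) (Real.contDiff_exp.comp_contDiffOn h.hV) ht
    (by positivity) (fun i hi => ?_) (fun i hi => ?_)
  · refine (comp_bound (C := A) isOpen_Ioi hS hE1 h.smooth hm ht (fun j hj => ?_)
      (fun j h1 h2 => hxi j h1 (h2.trans hi))).trans ?_
    · rw [iter_iter]; exact hA j (hj.trans hi)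
    · gcongr
  · refine (h.exp_bound ht (fun j h3 h4 => hM j h3 (by omega))).trans ?_
    have : M ^ i ≤ (n.factorial * M) ^ i := by
      gcongr; nlinarith
    gcongr

lemma incr_deriv (h : Orb x V K L a) {E W : ℝ → ℝ} {S : Set ℝ} (hS : IsOpen S)
    (hE : ContDiffOn ℝ ∞ E S) (hm : MapsTo x (Ioi a) S) (hW : ContDiffOn ℝ ∞ W (Ioi a))
    {c : ℝ} (hc0 : 0 ≤ c) (hinc : ∀ t > a, W (t + 1) - W t = E (x (t + c))) (n : ℕ) {t : ℝ}
    (ht : a < t) : iteratedDeriv n W (t + 1) - iteratedDeriv n W t =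
      iteratedDeriv n (fun t => E (x t)) (t + c) := by
  have h1 : iteratedDeriv n (fun t => W (t + 1)) t = iteratedDeriv n W (t + 1) := by
    rw [iteratedDeriv_comp_add_const]
  have h2 : iteratedDeriv n (fun t => E (x (t + c))) t =
      iteratedDeriv n (fun t => E (x t)) (t + c) := by
    rw [iteratedDeriv_comp_add_const n (fun t => E (x t))]
  rw [← h1, ← h2, ← iteratedDeriv_fun_sub]
  · refine Filter.EventuallyEq.iteratedDeriv_eq n ?_
    filter_upwards [isOpen_Ioi.mem_nhds ht] with s hs
    exact hinc s hs
  · have := cd_at_nat isOpen_Ioi hW (x := t + 1) (by simp; linarith) n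
    exact this.comp t (by fun_prop : ContDiffAt ℝ n (fun t : ℝ => t + 1) t)
  · exact cd_at_nat isOpen_Ioi hW ht n

def Cst (n : ℕ) : ℝ := 2 ^ n * (n.factorial * n.factorial) * n.factorial ^ n

lemma Cst_pos (n : ℕ) : 0 < Cst n := by unfold Cst; positivity

lemma incr_bound (h : Orb x V K L a) {E W : ℝ → ℝ} {S : Set ℝ} (hS : IsOpen S)
    (hE : ContDiffOn ℝ ∞ E S) (hm : MapsTo x (Ioi a) S) (hW : ContDiffOn ℝ ∞ W (Ioi a))
    {c : ℝ} (hc0 : 0 ≤ c) (hc1 : c ≤ 1) (hinc : ∀ t > a, W (t + 1) - W t = E (x (t + c)))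
    {n : ℕ} {M A : ℝ} (hM0 : ∀ t > a, Real.exp (V t) ≤ M)
    (hM : ∀ i, 1 ≤ i → i ≤ n → ∀ t > a, |iteratedDeriv i V t| ≤ M ^ i)
    (hA : ∀ j ≤ n, ∀ t > a, |iteratedDeriv (j + 1) E (x t)| ≤ A) {t : ℝ} (ht : a < t) :
    |iteratedDeriv (n + 1) W (t + 1) - iteratedDeriv (n + 1) W t| ≤
      Cst n * A * M ^ n * Real.exp K * Real.exp (V t) := by
  have hA0 : 0 ≤ A := (abs_nonneg _).trans (hA 0 (Nat.zero_le _) _ ht)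
  have hMp : 0 < M := (Real.exp_pos _).trans_le (hM0 _ ht)
  have htc : a < t + c := by linarith
  rw [h.incr_deriv hS hE hm hW hc0 hinc _ ht]
  refine (h.comp_x_bound hS hE hm htc (hM0 _ htc) (fun i h1 h2 => hM i h1 h2 _ htc)
    (fun j hj => hA j hj _ htc)).trans ?_
  calc _ = Cst n * A * M ^ n * Real.exp (V (t + c)) := by unfold Cst; ring
    _ ≤ Cst n * A * M ^ n * (Real.exp K * Real.exp (V t)) := by
      have := Cst_pos n
      gcongr
      exact h.exp_shift ht (by linarith) (by linarith)
    _ = _ := by ring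

lemma step0 (h : Orb x V K L a) {E W : ℝ → ℝ} {S : Set ℝ} (hS : IsOpen S)
    (hE : ContDiffOn ℝ ∞ E S) (hm : MapsTo x (Ioi a) S) (hW : ContDiffOn ℝ ∞ W (Ioi a))
    {c : ℝ} (hc0 : 0 ≤ c) (hc1 : c ≤ 1) (hinc : ∀ t > a, W (t + 1) - W t = E (x (t + c)))
    {M A κ : ℝ} (hM0 : ∀ t > a, Real.exp (V t) ≤ M)
    (hA : ∀ t > a, |iteratedDeriv 1 E (x t)| ≤ A)
    (hl : Tendsto (iteratedDeriv 1 W) atTop (𝓝 κ)) {t : ℝ} (ht : a < t) :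
    |iteratedDeriv 1 W t - κ| ≤ Cst 0 * A * Real.exp (2 * K) * (x t - L) := by
  refine h.T0 (fun s hs => ?_) ht ?_
  · refine (h.incr_bound (n := 0) hS hE hm hW hc0 hc1 hinc hM0 (by omega)
      (fun j hj => by simpa [Nat.le_zero.1 hj] using hA) hs).trans ?_
    have hA0 : 0 ≤ A := (abs_nonneg _).trans (hA _ ht)
    have := Cst_pos 0
    calc _ ≤ Cst 0 * A * M ^ 0 * Real.exp K * (Real.exp K * (x s - x (s + 1))) := by
          gcongr; exact h.exp_le_diff hs
      _ = _ := by rw [two_mul, Real.exp_add]; ring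
  · exact hl.comp (tendsto_atTop_add_const_left _ _ tendsto_natCast_atTop_atTop)

lemma step1 (h : Orb x V K L a) {E W : ℝ → ℝ} {S : Set ℝ} (hS : IsOpen S)
    (hE : ContDiffOn ℝ ∞ E S) (hm : MapsTo x (Ioi a) S) (hW : ContDiffOn ℝ ∞ W (Ioi a))
    {c : ℝ} (hc0 : 0 ≤ c) (hc1 : c ≤ 1) (hinc : ∀ t > a, W (t + 1) - W t = E (x (t + c)))
    {n : ℕ} {M A κ : ℝ} (hM0 : ∀ t > a, Real.exp (V t) ≤ M)
    (hM : ∀ i, 1 ≤ i → i ≤ n → ∀ t > a, |iteratedDeriv i V t| ≤ M ^ i)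
    (hA : ∀ j ≤ n, ∀ t > a, |iteratedDeriv (j + 1) E (x t)| ≤ A)
    (hl : Tendsto (iteratedDeriv n W) atTop (𝓝 κ)) :
    (∀ t > a, |iteratedDeriv (n + 1) W t| ≤
      Cst n * A * M ^ n * Real.exp (3 * K) * (x t - L)) ∧
      Tendsto (iteratedDeriv (n + 1) W) atTop (𝓝 0) := by
  have ha1 : a < a + 1 := by linarith
  have hA0 : 0 ≤ A := (abs_nonneg _).trans (hA 0 (Nat.zero_le _) _ ha1)
  have hMp : 0 < M := (Real.exp_pos _).trans_le (hM0 _ ha1)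
  have hC := Cst_pos n
  have := h.T1 (g := iteratedDeriv n W) (A := Cst n * A * M ^ n * Real.exp K) (by positivity)
    (fun t ht => (cd_hasDeriv isOpen_Ioi hW n ht).differentiableAt.differentiableWithinAt)
    (fun t ht => by
      rw [← iteratedDeriv_succ]
      exact h.incr_bound hS hE hm hW hc0 hc1 hinc hM0 hM hA ht) hl
  rw [← iteratedDeriv_succ] at this
  refine ⟨fun t ht => (this.1 t ht).trans (le_of_eq ?_), this.2⟩
  rw [show (3 : ℝ) * K = K + 2 * K by ring, Real.exp_add]; ring

/-- Core estimate. -/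
lemma core (K : ℝ) (n : ℕ) : ∃ C ≥ 1, ∀ {x V : ℝ → ℝ} {L a : ℝ}, Orb x V K L a →
    ∀ {Λ : ℝ → ℝ} {S : Set ℝ}, IsOpen S → ContDiffOn ℝ ∞ Λ S → MapsTo x (Ioi a) S →
    ∀ {c B κ : ℝ}, 0 ≤ c → c ≤ 1 → (∀ t > a, V (t + 1) - V t = Λ (x (t + c))) →
    (∀ t > a, Real.exp (V t) ≤ B) → (∀ t > a, x t - L ≤ 1) →
    (∀ j ≤ n, ∀ t > a, |iteratedDeriv j Λ (x t)| ≤ B) →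
    Tendsto (iteratedDeriv 1 V) atTop (𝓝 κ) →
    (∀ i, 1 ≤ i → i ≤ n → ∀ t > a, |iteratedDeriv i V t| ≤ (C * B) ^ i) ∧
    (∀ i, 2 ≤ i → i ≤ n → Tendsto (iteratedDeriv i V) atTop (𝓝 0)) := by
  induction n with
  | zero => exact ⟨1, le_rfl, by intros; constructor <;> intros <;> omega⟩
  | succ n ih =>
    obtain ⟨C, hC, hi⟩ := ih
    rcases Nat.eq_zero_or_pos n with rfl | hn
    · refine ⟨1 + Cst 0 * Real.exp (2 * K), by have := Cst_pos 0; simp; positivity, ?_⟩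
      intro x V L a h Λ S hS hΛ hm c B κ hc0 hc1 hinc hB hx1 hj hl
      refine ⟨?_, by omega⟩
      intro i h1 h2 t ht
      obtain rfl : i = 1 := by omega
      have hB0 : 0 < B := (Real.exp_pos _).trans_le (hB _ ht)
      have s0 := h.step0 hS hΛ hm h.hV hc0 hc1 hinc hB (hj 1 le_rfl) hl ht
      have hk : |κ| ≤ B := by
        by_contra! hlt
        obtain ⟨N, hN⟩ := eventually_atTop.1 (hl.abs.eventually_const_lt hlt)
        have hs : a < max t N := ht.trans_le (le_max_left _ _)
        have hdV : ∀ s > a, HasDerivAt V (iteratedDeriv 1 V s) s := fun s hs => by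
          simpa using cd_hasDeriv isOpen_Ioi h.hV 0 hs
        obtain ⟨d, hd, he⟩ := exists_hasDerivAt_eq_slope V (iteratedDeriv 1 V)
          (by linarith : max t N < max t N + 1)
          (fun s hs' => (hdV s (hs.trans_le hs'.1)).continuousAt.continuousWithinAt)
          (fun s hs' => hdV s (hs.trans hs'.1))
        have e1 : max t N + 1 - max t N = 1 := by ring
        rw [e1, div_one, hinc _ hs] at he
        have h6 := hN d ((le_max_right _ _).trans hd.1.le)
        rw [he] at h6
        have h7 := hj 0 (by omega) (max t N + c) (by linarith)
        rw [iteratedDeriv_zero] at h7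
        linarith
      have : Cst 0 * B * Real.exp (2 * K) * (x t - L) ≤ Cst 0 * B * Real.exp (2 * K) * 1 := by
        have := Cst_pos 0
        gcongr; exact hx1 t ht
      rw [pow_one]
      have h5 := abs_sub_abs_le_abs_sub (iteratedDeriv 1 V t) κ
      linarith
    · refine ⟨max C (Cst n * C ^ n * Real.exp (3 * K)), le_max_of_le_left hC, ?_⟩
      intro x V L a h Λ S hS hΛ hm c B κ hc0 hc1 hinc hB hx1 hj hl
      obtain ⟨hi1, hi2⟩ := hi h hS hΛ hm hc0 hc1 hinc hB hx1
        (fun j hj' => hj j (by omega)) hl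
      have hB0 : 0 < B := (Real.exp_pos _).trans_le (hB (a + 1) (by linarith))
      obtain ⟨κ', hκ'⟩ : ∃ κ', Tendsto (iteratedDeriv n V) atTop (𝓝 κ') := by
        rcases Nat.lt_or_ge n 2 with h2 | h2
        · obtain rfl : n = 1 := by omega
          exact ⟨_, hl⟩
        · exact ⟨0, hi2 n h2 le_rfl⟩
      have st := h.step1 (M := C * B) (A := B) hS hΛ hm h.hV hc0 hc1 hinc (n := n)
        (fun t ht => (hB t ht).trans (by nlinarith)) hi1
        (fun j hj' => hj (j + 1) (by omega)) hκ'
      set C' := max C (Cst n * C ^ n * Real.exp (3 * K))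
      constructor
      · intro i h1 h2 t ht
        rcases Nat.lt_or_ge n i with h3 | h3
        · obtain rfl : i = n + 1 := by omega
          have hcp := Cst_pos n
          have hC'1 : 1 ≤ C' := le_max_of_le_left hC
          calc _ ≤ Cst n * B * (C * B) ^ n * Real.exp (3 * K) * (x t - L) := st.1 t ht
            _ ≤ Cst n * B * (C * B) ^ n * Real.exp (3 * K) * 1 := by
              gcongr; exact hx1 t ht
            _ = (Cst n * C ^ n * Real.exp (3 * K)) * B ^ (n + 1) := by ring
            _ ≤ C' * B ^ (n + 1) := by gcongr; exact le_max_right _ _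
            _ ≤ C' ^ (n + 1) * B ^ (n + 1) := by
              gcongr; exact le_self_pow₀ hC'1 (by omega)
            _ = _ := by ring
        · refine (hi1 i h1 h3 t ht).trans ?_
          gcongr
          exact le_max_left _ _
      · intro i h1 h2
        rcases Nat.lt_or_ge n i with h3 | h3
        · obtain rfl : i = n + 1 := by omega
          exact st.2
        · exact hi2 i h1 h3

/-- From time derivatives to space derivatives. -/
lemma space (h : Orb x V K L a) {G : ℝ → ℝ} {S : Set ℝ} (hS : IsOpen S)
    (hG : ContDiffOn ℝ ∞ G S) (hm : MapsTo x (Ioi a) S) {n : ℕ} {M A t : ℝ} (ht : a < t)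
    (hM0 : 0 ≤ M)
    (hM : ∀ i, 1 ≤ i → i ≤ n → |iteratedDeriv i V t| ≤ M ^ i)
    (hA : ∀ i ≤ n, |iteratedDeriv i (fun t => G (x t)) t| ≤ A * M ^ i) (j : ℕ) :
    ∀ i, i + j ≤ n → |iteratedDeriv i (fun t => iteratedDeriv j G (x t)) t| ≤
      (2 ^ n * n.factorial) ^ j * A * (M * Real.exp (- V t)) ^ j * M ^ i := by
  have hA0 : 0 ≤ A := by simpa using (abs_nonneg _).trans (hA 0 (Nat.zero_le _))
  induction j with
  | zero => intro i hi; simpa using hA i hi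
  | succ j ih =>
    intro i hi
    have e : iteratedDeriv i (fun t => iteratedDeriv (j + 1) G (x t)) t =
      - iteratedDeriv i (fun t => Real.exp (- V t) *
        iteratedDeriv 1 (fun t => iteratedDeriv j G (x t)) t) t := by
      rw [← iteratedDeriv_fun_neg]
      refine Filter.EventuallyEq.iteratedDeriv_eq i ?_
      filter_upwards [isOpen_Ioi.mem_nhds ht] with s hs
      have := (cd_hasDeriv hS hG j (hm hs)).comp s (h.hx s hs)
      have := this.deriv
      simp only [Function.comp_def] at this
      rw [iteratedDeriv_one, this, Real.exp_neg]
      field_simp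
    have hs : ContDiffOn ℝ ∞ (fun t => iteratedDeriv j G (x t)) (Ioi a) :=
      (cd_iter hS hG j).comp h.smooth hm
    rw [e, abs_neg]
    refine (mul_bound (A := n.factorial * Real.exp (- V t))
      (A' := (2 ^ n * n.factorial) ^ j * A * (M * Real.exp (- V t)) ^ j * M)
      isOpen_Ioi (Real.contDiff_exp.comp_contDiffOn h.hV.neg)
      (cd_iter isOpen_Ioi hs 1) ht hM0 (fun l hl => ?_) (fun l hl => ?_)).trans ?_
    · refine (h.exp_neg_bound ht (fun j h3 h4 => hM j h3 (by omega))).trans ?_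
      have : (l.factorial : ℝ) ≤ n.factorial := by
        exact_mod_cast Nat.factorial_le (by omega)
      gcongr
    · rw [iter_iter]
      refine (ih (l + 1) (by omega)).trans (le_of_eq ?_)
      ring
    · have : (2 : ℝ) ^ i ≤ 2 ^ n := pow_le_pow_right₀ (by norm_num) (by omega)
      calc _ ≤ (2 : ℝ) ^ n * (n.factorial * Real.exp (- V t) *
          ((2 ^ n * n.factorial) ^ j * A * (M * Real.exp (- V t)) ^ j * M)) * M ^ i := by
            gcongr
        _ = _ := by ring

end Orb
end Aux
end

section
open Set Filter Topology
open scoped ContDiff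
namespace Aux

structure Fl (ξ : ℝ → ℝ) (φ : ℝ → ℝ → ℝ) (K : ℝ) : Prop where
  c1 : ContDiffOn ℝ 1 ξ (Icc (0 : ℝ) 1)
  sm : ContDiffOn ℝ ∞ ξ (Ioo (0 : ℝ) 1)
  fl : IsFlowOn ξ φ 0 1
  K0 : 0 ≤ K
  lip : LipschitzOnWith (Real.toNNReal K) ξ (Icc (0 : ℝ) 1)

lemma Fl.of {ξ : ℝ → ℝ} {φ : ℝ → ℝ → ℝ} (c1 : ContDiffOn ℝ 1 ξ (Icc (0 : ℝ) 1))
    (sm : ContDiffOn ℝ ∞ ξ (Ioo (0 : ℝ) 1)) (fl : IsFlowOn ξ φ 0 1) : ∃ K, Fl ξ φ K := by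
  obtain ⟨K, hK⟩ := c1.exists_lipschitzOnWith (by simp) (convex_Icc 0 1) isCompact_Icc
  exact ⟨K, c1, sm, fl, K.2, by simpa using hK⟩

namespace Fl
variable {ξ : ℝ → ℝ} {φ : ℝ → ℝ → ℝ} {K : ℝ}

lemma uniq (h : Fl ξ φ K) {y z : ℝ → ℝ} (hy : ∀ t, HasDerivAt y (ξ (y t)) t)
    (hz : ∀ t, HasDerivAt z (ξ (z t)) t) (hy1 : ∀ t, y t ∈ Icc (0:ℝ) 1)
    (hz1 : ∀ t, z t ∈ Icc (0:ℝ) 1) {t0 : ℝ} (h0 : y t0 = z t0) : y = z :=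
  ODE_solution_unique_univ (v := fun _ => ξ) (s := fun _ => Icc 0 1) (fun _ => h.lip)
    (fun t => ⟨hy t, hy1 t⟩) (fun t => ⟨hz t, hz1 t⟩) h0

lemma zero (h : Fl ξ φ K) {x : ℝ} (hx : x ∈ Icc (0:ℝ) 1) : φ 0 x = x := h.fl.1 x hx
lemma mem (h : Fl ξ φ K) {x : ℝ} (hx : x ∈ Icc (0:ℝ) 1) (t : ℝ) : φ t x ∈ Icc (0:ℝ) 1 :=
  (h.fl.2 x hx t).1
lemma der (h : Fl ξ φ K) {x : ℝ} (hx : x ∈ Icc (0:ℝ) 1) (t : ℝ) :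
    HasDerivAt (fun s => φ s x) (ξ (φ t x)) t := (h.fl.2 x hx t).2
lemma cont (h : Fl ξ φ K) {x : ℝ} (hx : x ∈ Icc (0:ℝ) 1) : Continuous (fun s => φ s x) :=
  continuous_iff_continuousAt.2 fun t => (h.der hx t).continuousAt

lemma add (h : Fl ξ φ K) {x : ℝ} (hx : x ∈ Icc (0:ℝ) 1) (s t : ℝ) :
    φ (s + t) x = φ s (φ t x) := by
  have := h.uniq (y := fun s => φ (s + t) x) (z := fun s => φ s (φ t x)) (t0 := 0)
    (fun r => (h.der hx (r + t)).comp_add_const r t) (fun r => h.der (h.mem hx t) r)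
    (fun r => h.mem hx _) (fun r => h.mem (h.mem hx t) _)
    (by simp [h.zero (h.mem hx t)])
  exact congrFun this s

lemma neg_cancel (h : Fl ξ φ K) {x : ℝ} (hx : x ∈ Icc (0:ℝ) 1) (t : ℝ) :
    φ (-t) (φ t x) = x := by
  rw [← h.add hx]; simp [h.zero hx]

lemma cancel_neg (h : Fl ξ φ K) {x : ℝ} (hx : x ∈ Icc (0:ℝ) 1) (t : ℝ) :
    φ t (φ (-t) x) = x := by
  rw [← h.add hx]; simp [h.zero hx]

lemma inj (h : Fl ξ φ K) {x y : ℝ} (hx : x ∈ Icc (0:ℝ) 1) (hy : y ∈ Icc (0:ℝ) 1) {t : ℝ}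
    (e : φ t x = φ t y) : x = y := by
  rw [← h.neg_cancel hx t, e, h.neg_cancel hy]

lemma smono (h : Fl ξ φ K) {x y : ℝ} (hx : x ∈ Icc (0:ℝ) 1) (hy : y ∈ Icc (0:ℝ) 1)
    (hxy : x < y) (t : ℝ) : φ t x < φ t y := by
  by_contra! hle
  have hc : Continuous (fun s => φ s y - φ s x) := (h.cont hy).sub (h.cont hx)
  have := mem_range_of_exists_le_of_exists_ge hc (c := 0) ⟨t, by linarith⟩
    ⟨0, by rw [h.zero hx, h.zero hy]; linarith⟩
  obtain ⟨s, hs⟩ := this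
  have : x = y := h.inj hx hy (t := s) (by simp only at hs; linarith)
  linarith

lemma mono (h : Fl ξ φ K) {x y : ℝ} (hx : x ∈ Icc (0:ℝ) 1) (hy : y ∈ Icc (0:ℝ) 1)
    (hxy : x ≤ y) (t : ℝ) : φ t x ≤ φ t y := by
  rcases hxy.eq_or_lt with rfl | h1
  · exact le_rfl
  · exact (h.smono hx hy h1 t).le

lemma xi0 (h : Fl ξ φ K) : ξ 0 = 0 := by
  have hx : (0:ℝ) ∈ Icc (0:ℝ) 1 := by simp
  have h1 := h.der hx 0
  rw [h.zero hx] at h1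
  refine IsLocalMin.hasDerivAt_eq_zero (Eventually.of_forall fun t => ?_) h1
  simp only [h.zero hx]; exact (h.mem hx t).1

lemma xi1 (h : Fl ξ φ K) : ξ 1 = 0 := by
  have hx : (1:ℝ) ∈ Icc (0:ℝ) 1 := by simp
  have h1 := h.der hx 0
  rw [h.zero hx] at h1
  refine IsLocalMax.hasDerivAt_eq_zero (Eventually.of_forall fun t => ?_) h1
  simp only [h.zero hx]; exact (h.mem hx t).2

lemma fixed (h : Fl ξ φ K) {x : ℝ} (hx : x ∈ Icc (0:ℝ) 1) (h0 : ξ x = 0) (t : ℝ) :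
    φ t x = x := by
  have := h.uniq (y := fun s => φ s x) (z := fun _ => x) (t0 := 0) (h.der hx)
    (fun r => by simpa [h0] using hasDerivAt_const r x) (h.mem hx) (fun _ => hx)
    (by simp [h.zero hx])
  exact congrFun this t

lemma at0 (h : Fl ξ φ K) (t : ℝ) : φ t 0 = 0 := h.fixed (by simp) h.xi0 t
lemma at1 (h : Fl ξ φ K) (t : ℝ) : φ t 1 = 1 := h.fixed (by simp) h.xi1 t

lemma mem' (h : Fl ξ φ K) {x : ℝ} (hx : x ∈ Ioo (0:ℝ) 1) (t : ℝ) : φ t x ∈ Ioo (0:ℝ) 1 := by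
  constructor
  · have := h.smono (by simp) (Ioo_subset_Icc_self hx) hx.1 t
    rwa [h.at0] at this
  · have := h.smono (Ioo_subset_Icc_self hx) (by simp) hx.2 t
    rwa [h.at1] at this

lemma ne (h : Fl ξ φ K) {x : ℝ} (hx : x ∈ Icc (0:ℝ) 1) (h0 : ξ x ≠ 0) (t : ℝ) :
    ξ (φ t x) ≠ 0 := by
  intro e
  have := h.fixed (h.mem hx t) e (-t)
  rw [h.neg_cancel hx] at this
  rw [← this] at e; exact h0 e

lemma interior_of_ne (h : Fl ξ φ K) {x : ℝ} (hx : x ∈ Icc (0:ℝ) 1) (h0 : ξ x ≠ 0) :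
    x ∈ Ioo (0:ℝ) 1 := by
  refine ⟨lt_of_le_of_ne hx.1 ?_, lt_of_le_of_ne hx.2 ?_⟩
  · rintro rfl; exact h0 h.xi0
  · rintro rfl; exact h0 h.xi1

lemma xi_cont (h : Fl ξ φ K) : ContinuousOn ξ (Icc 0 1) := h.c1.continuousOn

lemma pos (h : Fl ξ φ K) {x σ : ℝ} (hx : x ∈ Icc (0:ℝ) 1) (h0 : 0 < σ * ξ x) (t : ℝ) :
    0 < σ * ξ (φ t x) := by
  by_contra! hle
  have hσ : σ ≠ 0 := by rintro rfl; simp at h0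
  have hx0 : ξ x ≠ 0 := by intro e; simp [e] at h0
  have hc : Continuous (fun s => σ * ξ (φ s x)) := by
    have := h.xi_cont.comp_continuous (h.cont hx) (h.mem hx)
    exact continuous_const.mul this
  obtain ⟨s, hs⟩ := mem_range_of_exists_le_of_exists_ge hc (c := 0) ⟨t, hle⟩
    ⟨0, by rw [h.zero hx]; exact h0.le⟩
  exact (mul_ne_zero hσ (h.ne hx hx0 s)) hs

lemma derK (h : Fl ξ φ K) {x : ℝ} (hx : x ∈ Ioo (0:ℝ) 1) : |deriv ξ x| ≤ K := by
  have h1 := (by simpa using cd_hasDeriv isOpen_Ioo h.sm 0 hx : HasDerivAt ξ (deriv ξ x) x)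
  have := h1.le_of_lipschitzOn (Icc_mem_nhds hx.1 hx.2) h.lip
  simpa [h.K0] using this

lemma xi_deriv (h : Fl ξ φ K) {x : ℝ} (hx : x ∈ Ioo (0:ℝ) 1) : HasDerivAt ξ (deriv ξ x) x := by
  simpa using cd_hasDeriv isOpen_Ioo h.sm 0 hx

/-- the time curve is smooth in the interior -/
lemma curve_smooth (h : Fl ξ φ K) {x : ℝ} (hx : x ∈ Ioo (0:ℝ) 1) :
    ContDiff ℝ ∞ (fun t => φ t x) := by
  have hxI := Ioo_subset_Icc_self hx
  have hd : deriv (fun t => φ t x) = fun t => ξ (φ t x) := funext fun t => (h.der hxI t).deriv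
  have hdiff : Differentiable ℝ (fun t => φ t x) := fun t => (h.der hxI t).differentiableAt
  have : ∀ n : ℕ, ContDiff ℝ n (fun t => φ t x) := by
    intro n
    induction n with
    | zero => exact contDiff_zero.2 (h.cont hxI)
    | succ n ih =>
      have : ((n + 1 : ℕ) : WithTop ℕ∞) = (n : WithTop ℕ∞) + 1 := by push_cast; rfl
      rw [this, contDiff_succ_iff_deriv]
      refine ⟨hdiff, by simp, ?_⟩
      rw [hd]
      rw [← contDiffOn_univ] at ih ⊢
      exact (h.sm.of_le (by exact_mod_cast le_top)).comp ih fun t _ => h.mem' hx t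
  exact contDiff_infty.2 this

lemma neg' (h : Fl ξ φ K) : Fl (fun x => - ξ x) (fun t => φ (-t)) K where
  c1 := h.c1.neg
  sm := h.sm.neg
  K0 := h.K0
  lip := h.lip.neg
  fl := by
    refine ⟨fun x hx => by simp [h.zero hx], fun x hx t => ⟨h.mem hx _, ?_⟩⟩
    have := (h.der hx (-t)).comp t (hasDerivAt_neg t)
    simpa [Function.comp_def] using this

lemma lim_exists (h : Fl ξ φ K) {x : ℝ} (hx : x ∈ Ioo (0:ℝ) 1) {τ : ℝ}
    (hτ : ∀ t, τ * ξ (φ t x) ≤ 0) :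
    ∃ L ∈ Ico (0:ℝ) 1, Tendsto (fun t => φ (τ * t) x) atTop (𝓝 L) := by
  have hxI := Ioo_subset_Icc_self hx
  have hd : ∀ t, HasDerivAt (fun t => φ (τ * t) x) (τ * ξ (φ (τ * t) x)) t := by
    intro t
    have := (h.der hxI (τ * t)).comp t ((hasDerivAt_id t).const_mul τ)
    simpa [Function.comp_def, mul_comm] using this
  have hanti : Antitone (fun t => φ (τ * t) x) := by
    refine antitone_of_deriv_nonpos (fun t => (hd t).differentiableAt) fun t => ?_
    rw [(hd t).deriv]; exact hτ _
  have hb : BddBelow (range (fun t => φ (τ * t) x)) :=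
    ⟨0, by rintro _ ⟨t, rfl⟩; exact (h.mem hxI _).1⟩
  refine ⟨_, ⟨?_, ?_⟩, tendsto_atTop_ciInf hanti hb⟩
  · exact le_ciInf fun t => (h.mem hxI _).1
  · refine lt_of_le_of_lt (ciInf_le hb 0) ?_
    simpa [h.zero hxI] using hx.2

/-- Package an orbit. -/
lemma orb (h : Fl ξ φ K) {y σ : ℝ} (hy : y ∈ Ioo (0:ℝ) 1) (hσ : σ = 1 ∨ σ = -1)
    (h0 : 0 < σ * ξ y) : ∃ L ∈ Ico (0:ℝ) 1, ∃ κ, ∀ a,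
      Orb (fun t => φ (-σ * t) y) (fun t => Real.log (σ * ξ (φ (-σ * t) y))) K L a ∧
      Tendsto (iteratedDeriv 1 (fun t => Real.log (σ * ξ (φ (-σ * t) y)))) atTop (𝓝 κ) := by
  have hyI := Ioo_subset_Icc_self hy
  have hp : ∀ t, 0 < σ * ξ (φ t y) := h.pos hyI h0
  have hσ2 : σ * σ = 1 := by rcases hσ with rfl | rfl <;> norm_num
  obtain ⟨L, hL, hlim⟩ := h.lim_exists hy (τ := -σ) (fun t => by have := hp t; linarith)
  have hd : ∀ t, HasDerivAt (fun t => φ (-σ * t) y) (-(σ * ξ (φ (-σ * t) y))) t := by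
    intro t
    have := (h.der hyI (-σ * t)).comp t ((hasDerivAt_id t).const_mul (-σ))
    simpa [Function.comp_def, mul_comm] using this
  have hV1 : iteratedDeriv 1 (fun t => Real.log (σ * ξ (φ (-σ * t) y))) =
      fun t => -σ * deriv ξ (φ (-σ * t) y) := by
    rw [iteratedDeriv_one]
    funext t
    have h1 := ((h.xi_deriv (h.mem' hy (-σ * t))).comp t (hd t)).const_mul σ
    have h2 := (h1.log (hp _).ne').deriv
    simp only [Function.comp_def] at h2
    rw [h2]
    have hne := (hp (-σ * t)).ne'
    rw [div_eq_iff hne]; ring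
  refine ⟨L, hL, -σ * derivWithin ξ (Icc 0 1) L, fun a => ⟨⟨?_, ?_, ?_, hlim⟩, ?_⟩⟩
  · refine ContDiff.contDiffOn ?_
    have hx : ContDiff ℝ ∞ (fun t => φ (-σ * t) y) := by
      have := (h.curve_smooth hy).comp (contDiff_const.mul contDiff_id : ContDiff ℝ ∞ fun t : ℝ => -σ * t)
      exact this
    have : ContDiff ℝ ∞ (fun t => σ * ξ (φ (-σ * t) y)) := by
      refine contDiff_const.mul ?_
      rw [← contDiffOn_univ] at hx ⊢
      exact h.sm.comp hx fun t _ => h.mem' hy _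
    exact this.log fun t => (hp _).ne'
  · intro t _
    rw [Real.exp_log (hp _)]
    exact hd t
  · intro t _
    rw [hV1]
    simp only [abs_mul, abs_neg]
    have : |σ| = 1 := by rcases hσ with rfl | rfl <;> norm_num
    rw [this, one_mul]
    exact h.derK (h.mem' hy _)
  · rw [hV1]
    refine Tendsto.const_mul _ ?_
    have hc := (h.c1.continuousOn_derivWithin (uniqueDiffOn_Icc zero_lt_one) le_rfl) L
      ⟨hL.1, hL.2.le⟩
    have : Tendsto (fun t => φ (-σ * t) y) atTop (𝓝[Icc 0 1] L) :=
      tendsto_nhdsWithin_iff.2 ⟨hlim, Eventually.of_forall fun t => h.mem hyI _⟩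
    refine (hc.tendsto.comp this).congr fun t => ?_
    have hm := h.mem' hy (-σ * t)
    exact derivWithin_of_mem_nhds (Icc_mem_nhds hm.1 hm.2)

end Fl
end Aux
end

section
open Set Filter Topology
open scoped ContDiff
namespace Aux

lemma exists_global {v : ℝ → ℝ} {K M : NNReal} (hv : LipschitzWith K v) (hM : ∀ x, |v x| ≤ M)
    (x : ℝ) : ∃ α : ℝ → ℝ, α 0 = x ∧ ∀ t, HasDerivAt α (v (α t)) t := by
  have hex : ∀ n : ℕ, ∃ α : ℝ → ℝ, α 0 = x ∧ ∀ t ∈ Ioo (-((n:ℝ) + 1)) (n + 1),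
      HasDerivAt α (v (α t)) t := by
    intro n
    have hn : (0:ℝ) ≤ n + 1 := by positivity
    have hpl : IsPicardLindelof (fun _ => v) (tmin := -((n:ℝ) + 1)) (tmax := n + 1)
        ⟨0, by constructor <;> linarith⟩ x (M * (n + 1)) 0 M K :=
      { lipschitzOnWith := fun t _ => hv.lipschitzOnWith
        continuousOn := fun y _ => continuousOn_const
        norm_le := fun t _ y _ => hM y
        mul_max_le := by simp }
    obtain ⟨α, h0, h⟩ := hpl.exists_eq_forall_mem_Icc_hasDerivWithinAt (x := x) (by simp)
    exact ⟨α, h0, fun t ht => (h t (Ioo_subset_Icc_self ht)).hasDerivAt (Icc_mem_nhds ht.1 ht.2)⟩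
  choose α h0 hd using hex
  have key : ∀ n m : ℕ, n ≤ m → EqOn (α n) (α m) (Ioo (-((n:ℝ) + 1)) (n + 1)) := by
    intro n m hnm
    have hnm' : (n:ℝ) ≤ m := by exact_mod_cast hnm
    refine ODE_solution_unique_of_mem_Ioo (v := fun _ => v) (s := fun _ => univ) (K := K)
      (t₀ := 0) (fun t _ => hv.lipschitzOnWith) ⟨by linarith [n.cast_nonneg (α := ℝ)], by positivity⟩
      (fun t ht => ⟨hd n t ht, trivial⟩)
      (fun t ht => ⟨hd m t ⟨by linarith [ht.1], by linarith [ht.2]⟩, trivial⟩) (by rw [h0, h0])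
  refine ⟨fun t => α ⌈|t|⌉₊ t, by simp [h0], fun t => ?_⟩
  have hloc : ∀ n : ℕ, ∀ s : ℝ, |s| < n + 1 → α ⌈|s|⌉₊ s = α n s := by
    intro n s hs
    rcases le_total ⌈|s|⌉₊ n with h | h
    · refine key _ _ h ?_
      have := Nat.le_ceil |s|
      rw [mem_Ioo, ← abs_lt]; linarith
    · refine (key _ _ h ?_).symm
      rw [mem_Ioo, ← abs_lt]; exact hs
  obtain ⟨n, hn⟩ := exists_nat_gt |t|
  have hn' : |t| < n + 1 := by linarith
  have h1 := hd n t (by rw [mem_Ioo, ← abs_lt]; exact hn')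
  rw [← hloc n t hn'] at h1
  refine h1.congr_of_eventuallyEq ?_
  have : {s : ℝ | |s| < n + 1} ∈ 𝓝 t := (isOpen_lt continuous_abs continuous_const).mem_nhds hn'
  filter_upwards [this] with s hs using hloc n s hs

lemma exists_flow {v : ℝ → ℝ} {K : NNReal} (hv : LipschitzOnWith K v (Icc (0:ℝ) 1))
    (h0 : v 0 = 0) (h1 : v 1 = 0) : ∃ φ, IsFlowOn v φ 0 1 := by
  set w : ℝ → ℝ := fun x => v (projIcc (0:ℝ) 1 zero_le_one x) with hw
  have hwl : LipschitzWith K w := by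
    have := (lipschitzOnWith_iff_restrict.1 hv).comp (LipschitzWith.projIcc (zero_le_one (α := ℝ)))
    simpa [Function.comp_def, hw] using this
  have hwv : ∀ x ∈ Icc (0:ℝ) 1, w x = v x := fun x hx => by simp [hw, projIcc_of_mem _ hx]
  have hM : ∀ x, |w x| ≤ K := by
    intro x
    have hp := (projIcc (0:ℝ) 1 zero_le_one x).2
    have := hv.dist_le_mul _ hp 0 (by simp)
    rw [h0, Real.dist_eq, Real.dist_eq, sub_zero, sub_zero, abs_of_nonneg hp.1] at this
    refine this.trans ?_
    have := K.2
    nlinarith [hp.2]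
  choose φ hφ0 hφ using fun x => exists_global hwl hM x
  have huniq : ∀ y z : ℝ → ℝ, (∀ t, HasDerivAt y (w (y t)) t) → (∀ t, HasDerivAt z (w (z t)) t) →
      ∀ t0, y t0 = z t0 → y = z := fun y z hy hz t0 he =>
    ODE_solution_unique_univ (v := fun _ => w) (s := fun _ => univ)
      (fun _ => hwl.lipschitzOnWith) (fun t => ⟨hy t, trivial⟩) (fun t => ⟨hz t, trivial⟩) he
  have hc : ∀ x, Continuous (φ x) := fun x =>
    continuous_iff_continuousAt.2 fun t => (hφ x t).continuousAt
  have hmem : ∀ x ∈ Icc (0:ℝ) 1, ∀ t, φ x t ∈ Icc (0:ℝ) 1 := by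
    intro x hx t
    constructor
    · by_contra! hlt
      obtain ⟨s, hs⟩ := mem_range_of_exists_le_of_exists_ge (hc x) (c := 0) ⟨t, hlt.le⟩
        ⟨0, by rw [hφ0]; exact hx.1⟩
      have := huniq (φ x) (fun _ => 0) (hφ x)
        (fun t => by simpa [hwv 0 (by simp), h0] using hasDerivAt_const t (0:ℝ)) s hs
      rw [this] at hlt; exact lt_irrefl _ hlt
    · by_contra! hlt
      obtain ⟨s, hs⟩ := mem_range_of_exists_le_of_exists_ge (hc x) (c := 1)
        ⟨0, by rw [hφ0]; exact hx.2⟩ ⟨t, hlt.le⟩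
      have := huniq (φ x) (fun _ => 1) (hφ x)
        (fun t => by simpa [hwv 1 (by simp), h1] using hasDerivAt_const t (1:ℝ)) s hs
      rw [this] at hlt; exact lt_irrefl _ hlt
  refine ⟨fun t x => φ x t, fun x _ => hφ0 x, fun x hx t => ⟨hmem x hx t, ?_⟩⟩
  have := hφ x t
  rwa [hwv _ (hmem x hx t)] at this

namespace Fl
variable {ξ : ℝ → ℝ} {φ : ℝ → ℝ → ℝ} {K : ℝ}

lemma exists_sigma {a : ℝ} (h : a ≠ 0) : ∃ σ : ℝ, (σ = 1 ∨ σ = -1) ∧ 0 < σ * a ∧ σ * a = |a| := by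
  rcases lt_or_gt_of_ne h with h | h
  · exact ⟨-1, Or.inr rfl, by linarith, by rw [abs_of_neg h]; ring⟩
  · exact ⟨1, Or.inl rfl, by linarith, by rw [abs_of_pos h]; ring⟩

lemma xi_le (h : Fl ξ φ K) {y : ℝ} (hy : y ∈ Icc (0:ℝ) 1) (s : ℝ) :
    |ξ (φ s y)| ≤ Real.exp (K * |s|) * |ξ y| := by
  rcases eq_or_ne (ξ y) 0 with h0 | h0
  · rw [h.fixed hy h0, h0]; simp
  · obtain ⟨σ, hσ, hpos, habs⟩ := exists_sigma h0
    have hyI := h.interior_of_ne hy h0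
    obtain ⟨L, _, κ, ho⟩ := h.orb hyI hσ hpos
    have hσ2 : σ * σ = 1 := by rcases hσ with rfl | rfl <;> norm_num
    have hσ1 : |σ| = 1 := by rcases hσ with rfl | rfl <;> norm_num
    have := (ho (-|s| - 1)).1.V_le (t := 0) (s := -σ * s)
      (by linarith [abs_nonneg s]) (by
        have := neg_abs_le (-σ * s)
        rw [abs_mul, abs_neg, hσ1, one_mul] at this; linarith)
    simp only [sub_zero, mul_zero] at this
    rw [show -σ * (-σ * s) = σ * σ * s by ring, hσ2, one_mul, h.zero hy, abs_mul, abs_neg, hσ1,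
      one_mul] at this
    have h2 := (abs_le.1 this).2
    have e : |ξ (φ s y)| = σ * ξ (φ s y) := by
      have := h.pos hy hpos s
      rw [← abs_of_pos this, abs_mul, hσ1, one_mul]
    rw [e, ← habs, ← Real.exp_log (h.pos hy hpos s)]
    conv_rhs => rw [← Real.exp_log hpos]
    rw [← Real.exp_add]
    exact Real.exp_le_exp.2 (by linarith)

lemma xi_ge (h : Fl ξ φ K) {y : ℝ} (hy : y ∈ Icc (0:ℝ) 1) (s : ℝ) :
    |ξ y| ≤ Real.exp (K * |s|) * |ξ (φ s y)| := by
  have := h.xi_le (h.mem hy s) (-s)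
  rwa [h.neg_cancel hy, abs_neg] at this

lemma disp_le (h : Fl ξ φ K) {y : ℝ} (hy : y ∈ Icc (0:ℝ) 1) (t : ℝ) :
    |φ t y - y| ≤ Real.exp (K * |t|) * |ξ y| * |t| := by
  have := Convex.norm_image_sub_le_of_norm_hasDerivWithin_le (f := fun s => φ s y)
    (f' := fun s => ξ (φ s y)) (s := Icc (-|t|) |t|) (x := 0) (y := t)
    (C := Real.exp (K * |t|) * |ξ y|) (fun s _ => (h.der hy s).hasDerivWithinAt)
    (fun s hs => ?_) (convex_Icc _ _) (by simp) ⟨neg_abs_le t, le_abs_self t⟩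
  · simpa [h.zero hy] using this
  · refine (h.xi_le hy s).trans ?_
    have : |s| ≤ |t| := abs_le.2 ⟨hs.1, hs.2⟩
    have := h.K0
    gcongr

lemma conj (h : Fl ξ φ K) {F : ℝ → ℝ} {T x : ℝ} (hF : ∀ x ∈ Icc (0:ℝ) 1, F x = φ T x)
    (hx : x ∈ Icc (0:ℝ) 1) (hd : DifferentiableAt ℝ F x) : ξ (F x) = deriv F x * ξ x := by
  have h1 : HasDerivAt (fun s => F (φ s x)) (deriv F x * ξ x) 0 := by
    have h2 := h.der hx 0
    have hd' := hd.hasDerivAt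
    rw [h.zero hx] at h2
    exact HasDerivAt.comp_of_eq (h₂ := F) 0 hd' h2 (h.zero hx).symm
  have h3 : HasDerivAt (fun s => F (φ s x)) (ξ (F x)) 0 := by
    have := h.der (h.mem hx T) 0
    rw [h.zero (h.mem hx T), ← hF x hx] at this
    refine this.congr_of_eventuallyEq (Eventually.of_forall fun s => ?_)
    show F (φ s x) = φ s (F x)
    rw [hF _ (h.mem hx s), hF x hx, ← h.add hx, ← h.add hx, add_comm]
  exact h3.unique h1

/-- local structure of the flow. -/
lemma local_chart (h : Fl ξ φ K) {y : ℝ} (hy : y ∈ Ioo (0:ℝ) 1) (h0 : ξ y ≠ 0) :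
    ∃ σ : ℝ → ℝ, ContDiffAt ℝ ∞ σ y ∧ ∀ᶠ x in 𝓝 y, ∀ t, φ t x = φ (t + σ x) y := by
  have hyI := Ioo_subset_Icc_self hy
  have hc := (h.curve_smooth hy).contDiffAt (x := 0)
  have hd : HasStrictDerivAt (fun s => φ s y) (ξ y) 0 := by
    have := hc.hasStrictDerivAt (by simp)
    rwa [(h.der hyI 0).deriv, h.zero hyI] at this
  have hfd : HasFDerivAt (fun s => φ s y)
      (ContinuousLinearEquiv.unitsEquivAut ℝ (Units.mk0 (ξ y) h0) : ℝ →L[ℝ] ℝ) 0 := by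
    exact hd.hasDerivAt.hasFDerivAt_equiv h0
  refine ⟨hc.localInverse hfd (by simp), ?_, ?_⟩
  · have := hc.to_localInverse hfd (by simp)
    simpa only [h.zero hyI] using this
  · have hst : HasStrictFDerivAt (fun s => φ s y)
      (ContinuousLinearEquiv.unitsEquivAut ℝ (Units.mk0 (ξ y) h0) : ℝ →L[ℝ] ℝ) 0 :=
      hc.hasStrictFDerivAt' hfd (by simp)
    have := hst.eventually_right_inverse
    simp only [h.zero hyI] at this
    filter_upwards [this] with x hx t
    conv_lhs => rw [← hx]
    rw [← h.add hyI]
    rfl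

lemma smoothAt (h : Fl ξ φ K) {y : ℝ} (hy : y ∈ Ioo (0:ℝ) 1) (h0 : ξ y ≠ 0) (t : ℝ) :
    ContDiffAt ℝ ∞ (φ t) y := by
  obtain ⟨σ, hσ, he⟩ := h.local_chart hy h0
  have : ContDiffAt ℝ ∞ (fun x => φ (t + σ x) y) y :=
    (h.curve_smooth hy).contDiffAt.comp y (contDiffAt_const.add hσ)
  refine this.congr_of_eventuallyEq ?_
  filter_upwards [he] with x hx using hx t

end Fl

lemma cdat_deriv {u : ℝ → ℝ} {y : ℝ} (hu : ContDiffAt ℝ ∞ u y) : ContDiffAt ℝ ∞ (deriv u) y := by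
  have h1 := (hu.fderiv_right (m := ∞) (by simp)).clm_apply (contDiffAt_const (c := (1:ℝ)))
  exact h1

lemma comm_aux {σ : ℝ → ℝ} {y : ℝ} (hσ : ContDiffAt ℝ ∞ σ y) (j : ℕ) :
    ∀ (c τ : ℝ → ℝ), ContDiff ℝ ∞ c → ContDiffAt ℝ ∞ τ y → ∀ t,
      HasDerivAt (fun t => iteratedDeriv j (fun x => c (t + σ x) * τ x) y)
        (iteratedDeriv j (fun x => deriv c (t + σ x) * τ x) y) t := by
  induction j with
  | zero =>
    intro c τ hc hτ t
    simp only [iteratedDeriv_zero]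
    have := ((hc.differentiable (by simp)) (t + σ y)).hasDerivAt.comp_add_const t (σ y)
    exact this.mul_const _
  | succ j ih =>
    intro c τ hc hτ t
    have hc' : ContDiff ℝ ∞ (deriv c) := by
      exact (contDiff_infty_iff_deriv.1 hc).2
    have hσ' : ContDiffAt ℝ ∞ (deriv σ) y := by
      exact cdat_deriv hσ
    have hτ' : ContDiffAt ℝ ∞ (deriv τ) y := by
      exact cdat_deriv hτ
    have hev : ∀ {u : ℝ → ℝ}, ContDiffAt ℝ ∞ u y → ∀ᶠ x in 𝓝 y, DifferentiableAt ℝ u x := by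
      intro u hu
      filter_upwards [(hu.of_le (by exact_mod_cast le_top : ((1:ℕ) : WithTop ℕ∞) ≤ ∞)).eventually (by simp)] with x hx
      exact hx.differentiableAt (by simp)
    have exp : ∀ c : ℝ → ℝ, ContDiff ℝ ∞ c → ∀ t,
        iteratedDeriv (j + 1) (fun x => c (t + σ x) * τ x) y =
        iteratedDeriv j (fun x => deriv c (t + σ x) * (deriv σ x * τ x)) y +
        iteratedDeriv j (fun x => c (t + σ x) * deriv τ x) y := by
      intro c hc t
      have hc' : ContDiff ℝ ∞ (deriv c) := (contDiff_infty_iff_deriv.1 hc).2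
      have hcs : ContDiffAt ℝ ∞ (fun x => c (t + σ x)) y :=
        hc.contDiffAt.comp y (contDiffAt_const.add hσ)
      have hcs' : ContDiffAt ℝ ∞ (fun x => deriv c (t + σ x)) y :=
        hc'.contDiffAt.comp y (contDiffAt_const.add hσ)
      rw [iteratedDeriv_succ', ← iteratedDeriv_fun_add]
      · refine Filter.EventuallyEq.iteratedDeriv_eq j ?_
        filter_upwards [hev hσ, hev hτ] with x h1 h2
        have h3 := ((hc.differentiable (by simp)) (t + σ x)).hasDerivAt.comp x
          (h1.hasDerivAt.const_add t)
        have h4 := (h3.mul h2.hasDerivAt).deriv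
        have e : (fun x => c (t + σ x) * τ x) = (c ∘ fun x => t + σ x) * τ := rfl
        rw [e, h4]
        simp only [Function.comp_def]; ring
      · exact (hcs'.mul (hσ'.mul hτ)).of_le (by exact_mod_cast le_top)
      · exact (hcs.mul hτ').of_le (by exact_mod_cast le_top)
    rw [exp _ hc']
    have h1 := ih (deriv c) (fun x => deriv σ x * τ x) hc' (hσ'.mul hτ) t
    have h2 := ih c (deriv τ) hc hτ' t
    exact (h1.add h2).congr_of_eventuallyEq (Eventually.of_forall fun t => exp c hc t)

namespace Fl
variable {ξ : ℝ → ℝ} {φ : ℝ → ℝ → ℝ} {K : ℝ}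

lemma dt_iter (h : Fl ξ φ K) {y : ℝ} (hy : y ∈ Ioo (0:ℝ) 1) (h0 : ξ y ≠ 0) (j : ℕ) (t : ℝ) :
    HasDerivAt (fun t => iteratedDeriv j (φ t) y) (iteratedDeriv j (fun x => ξ (φ t x)) y) t := by
  obtain ⟨σ, hσ, he⟩ := h.local_chart hy h0
  have hyI := Ioo_subset_Icc_self hy
  have := comm_aux hσ j (fun s => φ s y) (fun _ => 1) (h.curve_smooth hy) contDiffAt_const t
  have hd : deriv (fun s => φ s y) = fun s => ξ (φ s y) := funext fun s => (h.der hyI s).deriv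
  rw [hd] at this
  simp only [mul_one] at this
  have e1 : ∀ t, iteratedDeriv j (φ t) y = iteratedDeriv j (fun x => φ (t + σ x) y) y := fun t =>
    Filter.EventuallyEq.iteratedDeriv_eq j (by filter_upwards [he] with x hx using hx t)
  have e2 : iteratedDeriv j (fun x => ξ (φ t x)) y =
      iteratedDeriv j (fun x => ξ (φ (t + σ x) y)) y :=
    Filter.EventuallyEq.iteratedDeriv_eq j (by filter_upwards [he] with x hx; rw [hx t])
  rw [e2]
  exact this.congr_of_eventuallyEq (Eventually.of_forall e1)

end Fl
end Aux
end

section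
open Set Filter Topology
open scoped ContDiff
namespace Aux
namespace Fl
variable {ξ : ℝ → ℝ} {φ : ℝ → ℝ → ℝ} {K : ℝ}

lemma nz_open (h : Fl ξ φ K) : IsOpen {x | x ∈ Ioo (0:ℝ) 1 ∧ ξ x ≠ 0} := by
  have := h.sm.continuousOn.isOpen_inter_preimage isOpen_Ioo (isOpen_ne (x := (0:ℝ)))
  exact this

lemma smoothOn (h : Fl ξ φ K) (t : ℝ) : ContDiffOn ℝ ∞ (φ t) {x | x ∈ Ioo (0:ℝ) 1 ∧ ξ x ≠ 0} :=
  fun x hx => (h.smoothAt hx.1 hx.2 t).contDiffWithinAt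

lemma iter_sub (h : Fl ξ φ K) {y : ℝ} (hy : y ∈ Ioo (0:ℝ) 1) (h0 : ξ y ≠ 0) (j : ℕ) (t : ℝ) :
    iteratedDeriv j (fun x => φ t x - x) y = iteratedDeriv j (φ t) y - iteratedDeriv j (fun x => x) y :=
  iteratedDeriv_fun_sub ((h.smoothAt hy h0 t).of_le (by exact_mod_cast le_top)) contDiffAt_id

lemma dt_iter' (h : Fl ξ φ K) {y : ℝ} (hy : y ∈ Ioo (0:ℝ) 1) (h0 : ξ y ≠ 0) (j : ℕ) (t : ℝ) :
    HasDerivAt (fun t => iteratedDeriv j (fun x => φ t x - x) y)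
      (iteratedDeriv j (fun x => ξ (φ t x)) y) t := by
  have : (fun t => iteratedDeriv j (fun x => φ t x - x) y) =
      fun t => iteratedDeriv j (φ t) y - iteratedDeriv j (fun x => x) y :=
    funext fun t => h.iter_sub hy h0 j t
  rw [this]
  exact (h.dt_iter hy h0 j t).sub_const _

lemma flowCk_pos (k : ℕ) (T : ℝ) (hT : 0 ≤ T) : ∃ C ≥ 0, ∃ η0 > 0, ∀ ξ φ K, Fl ξ φ K →
    ∀ y ∈ Ioo (0:ℝ) 1, ξ y ≠ 0 → ∀ η, 0 < η → η ≤ η0 →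
    (∀ j ≤ k, ∀ t, 0 ≤ t → t ≤ T → |iteratedDeriv j ξ (φ t y)| ≤ η) →
    ∀ j ≤ k, ∀ t, 0 ≤ t → t ≤ T → |iteratedDeriv j (fun x => φ t x - x) y| ≤ C * η := by
  set A : ℝ := k.factorial * 2 ^ k + 1 with hA
  have hA1 : 1 ≤ A := by rw [hA]; have : (0:ℝ) ≤ k.factorial * 2 ^ k := by positivity
                         linarith
  refine ⟨A * T, by positivity, 1 / (A * (T + 1)), by positivity, ?_⟩
  intro ξ φ K h y hy h0 η hη hη0 hb
  have hyI := Ioo_subset_Icc_self hy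
  have hAT : A * η * T ≤ 1 := by
    rw [le_div_iff₀ (by positivity)] at hη0
    nlinarith [mul_pos hη (by linarith : 0 < A)]
  set U : ℝ → Fin k → ℝ := fun t i => iteratedDeriv (i + 1) (fun x => φ t x - x) y with hU
  set U' : ℝ → Fin k → ℝ := fun t i => iteratedDeriv (i + 1) (fun x => ξ (φ t x)) y with hU'
  have hd : ∀ t, HasDerivAt U (U' t) t := fun t => hasDerivAt_pi.2 fun i => h.dt_iter' hy h0 _ t
  have hz : U 0 = 0 := by
    funext i
    have : (fun x => φ 0 x - x) =ᶠ[𝓝 y] fun _ => 0 := by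
      filter_upwards [Ioo_mem_nhds hy.1 hy.2] with x hx
      rw [h.zero (Ioo_subset_Icc_self hx), sub_self]
    show iteratedDeriv (i + 1) (fun x => φ 0 x - x) y = 0
    rw [this.iteratedDeriv_eq]
    simp [iteratedDeriv_fun_const_zero]
  have main := image_norm_le_of_norm_deriv_right_lt_deriv_boundary (f := U) (f' := U') (a := 0)
    (b := T) (B := fun t => A * η * t) (B' := fun _ => A * η)
    (fun t _ => (hd t).continuousAt.continuousWithinAt)
    (fun t _ => (hd t).hasDerivWithinAt) (by simp [hz])
    (fun t => by simpa using (hasDerivAt_id t).const_mul (A * η)) ?_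
  · intro j hj t ht0 ht
    rcases j with _ | j
    · have := Convex.norm_image_sub_le_of_norm_hasDerivWithin_le (f := fun s => φ s y)
        (f' := fun s => ξ (φ s y)) (s := Icc 0 T) (x := 0) (y := t)
        (C := η) (fun s _ => (h.der hyI s).hasDerivWithinAt)
        (fun s hs => by simpa using hb 0 (by simp) s hs.1 hs.2) (convex_Icc _ _) (by simp [hT])
        ⟨ht0, ht⟩
      simp only [h.zero hyI, sub_zero, Real.norm_eq_abs, abs_of_nonneg ht0] at this
      simp only [iteratedDeriv_zero]
      refine this.trans ?_
      have : η * t ≤ η * T := by gcongr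
      have : η * T ≤ A * (η * T) := le_mul_of_one_le_left (by positivity) hA1
      linarith
    · have h1 := main (x := t) ⟨ht0, ht⟩
      have h2 := (norm_le_pi_norm (U t) ⟨j, hj⟩).trans h1
      refine (show |iteratedDeriv (j+1) (fun x => φ t x - x) y| ≤ A * η * t from h2).trans ?_
      have : A * η * t ≤ A * η * T := by gcongr
      linarith
  · intro t ht hEq
    have hn : ‖U t‖ ≤ 1 := by
      rw [hEq]; refine le_trans ?_ hAT
      have := ht.2.le
      gcongr
    have hle : ‖U' t‖ ≤ k.factorial * 2 ^ k * η := by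
      rw [pi_norm_le_iff_of_nonneg (by positivity)]
      intro i
      have hi : (i:ℕ) + 1 ≤ k := i.2
      have hB : ∀ m, 1 ≤ m → m ≤ (i:ℕ) + 1 → |iteratedDeriv m (φ t) y| ≤ 2 ^ m := by
        intro m hm hmi
        obtain ⟨m, rfl⟩ : ∃ m', m = m' + 1 := ⟨m - 1, by omega⟩
        have h2 := (norm_le_pi_norm (U t) ⟨m, by omega⟩).trans hn
        have h3 : |iteratedDeriv (m+1) (fun x => φ t x - x) y| ≤ 1 := h2
        rw [h.iter_sub hy h0] at h3
        have h4 : |iteratedDeriv (m+1) (fun x : ℝ => x) y| ≤ 1 := by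
          rw [iteratedDeriv_succ']
          simp only [deriv_id'']
          rw [iteratedDeriv_const]; split_ifs <;> simp
        have h5 : (2:ℝ) ≤ 2 ^ (m + 1) := by
          calc (2:ℝ) = 2 ^ 1 := by norm_num
            _ ≤ _ := pow_le_pow_right₀ (by norm_num) (by omega)
        have := abs_sub_abs_le_abs_sub (iteratedDeriv (m+1) (φ t) y) (iteratedDeriv (m+1) (fun x : ℝ => x) y)
        linarith
      have := comp_bound (n := (i:ℕ) + 1) (t := y) (C := η) (B := 2) h.nz_open isOpen_Ioo h.sm (h.smoothOn t)
        (fun x hx => h.mem' hx.1 t) ⟨hy, h0⟩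
        (fun j hj => hb j (by omega) t ht.1 ht.2.le) hB
      refine (show |iteratedDeriv (i+1) (fun x => ξ (φ t x)) y| ≤ _ from this).trans ?_
      have e1 : (((i:ℕ)+1).factorial : ℝ) ≤ k.factorial := by exact_mod_cast Nat.factorial_le hi
      have e2 : (2:ℝ) ^ ((i:ℕ)+1) ≤ 2 ^ k := pow_le_pow_right₀ (by norm_num) hi
      calc (((i:ℕ)+1).factorial : ℝ) * η * 2 ^ ((i:ℕ)+1) ≤ k.factorial * η * 2 ^ k := by gcongr
        _ = _ := by ring
    refine hle.trans_lt ?_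
    rw [hA]; linarith

lemma flowCk (k : ℕ) (T : ℝ) (hT : 0 ≤ T) : ∃ C ≥ 0, ∃ η0 > 0, ∀ ξ φ K, Fl ξ φ K →
    ∀ y ∈ Ioo (0:ℝ) 1, ξ y ≠ 0 → ∀ η, 0 < η → η ≤ η0 →
    (∀ j ≤ k, ∀ t, |t| ≤ T → |iteratedDeriv j ξ (φ t y)| ≤ η) →
    ∀ j ≤ k, ∀ t, |t| ≤ T → |iteratedDeriv j (fun x => φ t x - x) y| ≤ C * η := by
  obtain ⟨C, hC, η0, hη0, H⟩ := flowCk_pos k T hT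
  refine ⟨C, hC, η0, hη0, fun ξ φ K h y hy h0 η hη hle hb j hj t ht => ?_⟩
  rcases le_total 0 t with h1 | h1
  · exact H ξ φ K h y hy h0 η hη hle
      (fun j hj s hs hsT => hb j hj s (by rwa [abs_of_nonneg hs])) j hj t h1 (by rwa [abs_of_nonneg h1] at ht)
  · have := H _ _ K h.neg' y hy (by simpa using h0) η hη hle
      (fun j hj s hs hsT => by
        rw [iteratedDeriv_fun_neg, abs_neg]
        exact hb j hj (-s) (by rwa [abs_neg, abs_of_nonneg hs])) j hj (-t) (by linarith)
        (by rwa [abs_of_nonpos h1] at ht)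
    simpa using this

end Fl
end Aux
end

section
open Set Filter Topology
open scoped ContDiff
namespace Aux
namespace Fl
variable {ξ : ℝ → ℝ} {φ : ℝ → ℝ → ℝ} {K : ℝ}

lemma orb_limit (h : Fl ξ φ K) {y σ L : ℝ} (hy : y ∈ Ioo (0:ℝ) 1) (hσ : σ = 1 ∨ σ = -1)
    (h0 : 0 < σ * ξ y) (hL : L ∈ Ico (0:ℝ) 1)
    (ho : ∀ a, Orb (fun t => φ (-σ * t) y) (fun t => Real.log (σ * ξ (φ (-σ * t) y))) K L a) :
    ξ L = 0 ∧ L < y ∧ ∀ x ∈ Ioc L y, ∃ t ≥ 0, x = φ (-σ * t) y ∧ (x < y → 0 < t) := by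
  have hyI := Ioo_subset_Icc_self hy
  have hxi : ξ L = 0 := by
    have hc : Tendsto (fun t => σ * ξ (φ (-σ * t) y)) atTop (𝓝 (σ * ξ L)) := by
      refine Tendsto.const_mul _ ?_
      exact (h.xi_cont L ⟨hL.1, hL.2.le⟩).tendsto.comp (tendsto_nhdsWithin_iff.2
        ⟨(ho 0).lim, Eventually.of_forall fun t => h.mem hyI _⟩)
    have hz : Tendsto (fun t => Real.exp K * (φ (-σ * t) y - φ (-σ * (t + 1)) y)) atTop (𝓝 0) := by
      have h2 : Tendsto (fun t : ℝ => φ (-σ * (t + 1)) y) atTop (𝓝 L) :=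
        (ho 0).lim.comp (tendsto_atTop_add_const_right _ 1 tendsto_id)
      have := ((ho 0).lim.sub h2).const_mul (Real.exp K)
      simpa using this
    have := squeeze_zero' (f := fun t => σ * ξ (φ (-σ * t) y))
      (Eventually.of_forall fun t => (h.pos hyI h0 _).le) (by
        filter_upwards [eventually_gt_atTop 0] with t ht
        have := (ho 0).exp_le_diff ht
        rwa [Real.exp_log (h.pos hyI h0 _)] at this) hz
    have e := tendsto_nhds_unique hc this
    rcases hσ with rfl | rfl <;> simpa using e
  have hLy : L < y := by
    have h1 := (ho (-1)).L_le (t := 0) (by norm_num)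
    simp only [mul_zero, h.zero hyI] at h1
    refine lt_of_le_of_ne h1 ?_
    rintro rfl
    simp [hxi] at h0
  refine ⟨hxi, hLy, fun x hx => ?_⟩
  have hev : ∀ᶠ t in atTop, φ (-σ * t) y < x := (ho 0).lim.eventually_lt_const hx.1
  obtain ⟨t1, ht1, ht10⟩ := (hev.and (eventually_ge_atTop 0)).exists
  have hcont : ContinuousOn (fun t => φ (-σ * t) y) (Icc 0 t1) :=
    ((h.cont hyI).comp (continuous_const.mul continuous_id)).continuousOn
  have := intermediate_value_Icc' ht10 hcont
  obtain ⟨t, ht, he⟩ := this (show x ∈ Icc _ _ from ⟨ht1.le, by simpa [h.zero hyI] using hx.2⟩)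
  refine ⟨t, ht.1, he.symm, fun hlt => lt_of_le_of_ne ht.1 ?_⟩
  rintro rfl
  simp [h.zero hyI] at he
  exact hlt.ne he.symm

lemma cocycle (h : Fl ξ φ K) {f : ℝ → ℝ} (hf : ∀ x ∈ Icc (0:ℝ) 1, f x = φ 1 x)
    (hd : Differentiable ℝ f) (hpos : ∀ x ∈ Icc (0:ℝ) 1, 0 < deriv f x)
    {y σ : ℝ} (hy : y ∈ Ioo (0:ℝ) 1) (hσ : σ = 1 ∨ σ = -1) (h0 : 0 < σ * ξ y) (t : ℝ) :
    Real.log (σ * ξ (φ (-σ * (t + 1)) y)) - Real.log (σ * ξ (φ (-σ * t) y)) =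
      -σ * Real.log (deriv f (φ (-σ * (t + (1 + σ) / 2)) y)) := by
  have hyI := Ioo_subset_Icc_self hy
  have hp := h.pos hyI h0
  have key : ∀ s, Real.log (σ * ξ (φ (1 + s) y)) =
      Real.log (deriv f (φ s y)) + Real.log (σ * ξ (φ s y)) := by
    intro s
    have := h.conj hf (h.mem hyI s) hd.differentiableAt
    rw [hf _ (h.mem hyI s), ← h.add hyI] at this
    rw [this, ← Real.log_mul (hpos _ (h.mem hyI s)).ne' (hp s).ne']
    congr 1; ring
  rcases hσ with rfl | rfl
  · have := key (-(t + 1))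
    ring_nf at this ⊢
    linarith
  · have := key t
    ring_nf at this ⊢
    linarith

end Fl

lemma log_abs_le {z c : ℝ} (hc : 0 < c) (hc1 : c ≤ 1) (hz : c ≤ z) : |Real.log z| ≤ |z - 1| / c := by
  have hz0 : 0 < z := hc.trans_le hz
  have h1 := Real.log_le_sub_one_of_pos hz0
  have h2 := Real.one_sub_inv_le_log_of_pos hz0
  have h3 : |z - 1| ≤ |z - 1| / c := by
    rw [le_div_iff₀ hc]; nlinarith [abs_nonneg (z - 1)]
  have h4 : -(1 - z⁻¹) ≤ |z - 1| / c := by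
    have e : -(1 - z⁻¹) = (1 - z) / z := by field_simp; ring
    rw [e]
    calc (1 - z) / z ≤ |z - 1| / z := by
          gcongr; rw [abs_sub_comm]; exact le_abs_self _
      _ ≤ |z - 1| / c := by gcongr
  rw [abs_le]; constructor <;> linarith [le_abs_self (z - 1)]

lemma iti_iter {f : ℝ → ℝ} {p : ℝ} (h : ITIat f p) (n : ℕ) : iteratedDeriv n (fun x => f x - x) p = 0 := by
  rcases n with _ | n
  · simp [h.1]
  · exact h.2 _ (by omega)

/-- estimate on the logarithmic derivative near a flat end. -/
lemma logderiv_est {f : ℝ → ℝ} (hf : SmoothDiffeoI f) (hi : ITIat f 0) (n : ℕ) (η : ℝ) (hη : 0 < η)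
    (hη1 : η < 1) : ∃ C ≥ 1, ∃ s0 > 0, ∀ y0 ≤ (1/2 : ℝ), ∀ s > 0, s ≤ s0 →
      (∀ x ∈ Ioc 0 y0, |f x - x| ≤ s) → ∀ x ∈ Ioc 0 y0, ∀ j ≤ n,
      |iteratedDeriv j (fun x => Real.log (deriv f x)) x| ≤ C * s ^ (1 - η) := by
  obtain ⟨hsm, hf0, hf1, hpos, -⟩ := hf
  have hsm' : ContDiff ℝ ∞ f := hsm
  have hdf : ContDiff ℝ ∞ (deriv f) := (contDiff_infty_iff_deriv.1 hsm').2
  have hh : ContDiff ℝ ∞ (fun x => f x - x) := hsm'.sub contDiff_id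
  set S := {x | 0 < deriv f x} with hS
  have hSo : IsOpen S := isOpen_lt continuous_const hdf.continuous
  have hl : ContDiffOn ℝ ∞ (fun x => Real.log (deriv f x)) S :=
    hdf.contDiffOn.log fun x hx => (ne_of_gt hx)
  have hsub : Ico (0:ℝ) 1 ⊆ S := fun x hx => hpos x ⟨hx.1, hx.2.le⟩
  have hdiff : ∀ x, HasDerivAt (fun x => f x - x) (deriv f x - 1) x := fun x =>
    ((hsm'.differentiable (by simp)) x).hasDerivAt.sub (hasDerivAt_id x)
  -- flatness of log derivative
  obtain ⟨A1, A2, A3⟩ := cut_zero (b := 1) isOpen_univ (subset_univ _) zero_lt_one hh.contDiffOn (iti_iter hi)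
  have hd1 : ∀ i, iteratedDeriv i (fun x => deriv f x - 1) 0 = 0 := by
    intro i
    have := iti_iter hi (i + 1)
    rw [iteratedDeriv_succ'] at this
    have e : deriv (fun x => f x - x) = fun x => deriv f x - 1 := funext fun x => (hdiff x).deriv
    rwa [e] at this
  have hflat : ∀ i, iteratedDeriv i (fun x => Real.log (deriv f x)) 0 = 0 := by
    intro i
    rcases i with _ | i
    · have := hd1 0
      simp only [iteratedDeriv_zero] at this ⊢
      rw [show deriv f 0 = 1 by linarith, Real.log_one]
    · have h0S : (0:ℝ) ∈ S := hsub ⟨le_rfl, zero_lt_one⟩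
      have hx : ∃ C, ∀ j ≤ i + 1, |iteratedDeriv j Real.log (deriv f 0)| ≤ C := by
        refine ⟨∑ j ∈ Finset.range (i + 2), |iteratedDeriv j Real.log (deriv f 0)|, fun j hj => ?_⟩
        exact Finset.single_le_sum (f := fun j => |iteratedDeriv j Real.log (deriv f 0)|)
          (fun _ _ => abs_nonneg _) (Finset.mem_range.2 (by omega))
      obtain ⟨C, hC⟩ := hx
      have := comp_bound (n := i + 1) (t := 0) (B := 0) hSo isOpen_Ioi
        (g := Real.log) (S := Ioi 0) (contDiffOn_id.log fun x hx => ne_of_gt hx) hdf.contDiffOn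
        (fun x hx => hx) h0S hC (fun m hm _ => by
          have := hd1 m
          rw [iteratedDeriv_fun_sub (hdf.contDiffAt.of_le (by exact_mod_cast le_top)) contDiffAt_const,
            iteratedDeriv_const, if_neg (by omega), sub_zero] at this
          rw [this, abs_zero]; positivity)
      rw [zero_pow (by omega), mul_zero] at this
      exact abs_nonpos_iff.1 this
  obtain ⟨B1, B2, B3⟩ := cut_zero (b := 1) hSo hsub zero_lt_one hl hflat
  -- lower bound of the derivative
  obtain ⟨c, hc, hcle⟩ : ∃ c > 0, ∀ x ∈ Icc (0:ℝ) 1, c ≤ deriv f x := by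
    obtain ⟨x, hx, hm⟩ := isCompact_Icc.exists_isMinOn (nonempty_Icc.2 zero_le_one)
      hdf.continuous.continuousOn
    exact ⟨_, hpos x hx, fun z hz => hm hz⟩
  obtain ⟨C1, hC1, H1⟩ := kol_rpow (b := 1) (b' := 1/2) (by norm_num) A1 A2 1 (η/2) (by linarith) (by linarith)
  have H2 : ∀ j, ∃ C ≥ 0, ∀ δ ≤ (1/2:ℝ), ∀ m0 ≥ (0:ℝ), m0 ≤ 1 →
      (∀ x ≤ δ, |(fun x => if x ≤ 0 then 0 else Real.log (deriv f x)) x| ≤ m0) →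
      ∀ x ≤ δ, |iteratedDeriv j (fun x => if x ≤ 0 then 0 else Real.log (deriv f x)) x| ≤ C * m0 ^ (1 - η/2) :=
    fun j => kol_rpow (b := 1) (b' := 1/2) (by norm_num) B1 B2 j (η/2) (by linarith) (by linarith)
  choose C2 hC2 H2 using H2
  set c' := min c 1 with hc'
  have hc'0 : 0 < c' := lt_min hc one_pos
  set Q := (C1 + 1) / c' with hQ
  have hQ0 : 0 < Q := by positivity
  -- the constants
  set Cf := 1 + ∑ j ∈ Finset.range (n + 1), C2 j * Q ^ (1 - η/2) with hCf
  have hnn : ∀ j, 0 ≤ C2 j * Q ^ (1 - η/2) := fun j => mul_nonneg (hC2 j) (by positivity)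
  have hs0 : ∃ s0 > 0, s0 ≤ 1 ∧ ∀ s > 0, s ≤ s0 → Q * s ^ (1 - η/2) ≤ 1 := by
    have : Tendsto (fun s : ℝ => Q * s ^ (1 - η/2)) (𝓝 0) (𝓝 0) := by
      have := ((Real.continuousAt_rpow_const 0 (1 - η/2) (Or.inr (by linarith))).tendsto).const_mul Q
      rwa [Real.zero_rpow (by linarith), mul_zero] at this
    have := this.eventually_le_const (show (0:ℝ) < 1 by norm_num)
    obtain ⟨e, he, h⟩ := Metric.eventually_nhds_iff.1 this
    refine ⟨min (e/2) 1, by positivity, min_le_right _ _, fun s hs hle => h ?_⟩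
    rw [Real.dist_eq, sub_zero, abs_of_pos hs]
    linarith [min_le_left (e/2) 1]
  obtain ⟨s0, hs0, hs01, hs0Q⟩ := hs0
  refine ⟨Cf, ?_, s0, hs0, ?_⟩
  · rw [hCf]; have := Finset.sum_nonneg (s := Finset.range (n + 1)) fun j _ => hnn j
    linarith
  intro y0 hy0 s hs hss0 hb x hx j hj
  have hs1 : s ≤ 1 := hss0.trans hs01
  have hL1 : ∀ x ≤ y0, |iteratedDeriv 1 (fun x => if x ≤ 0 then 0 else f x - x) x| ≤ C1 * s ^ (1 - η/2) := by
    refine H1 y0 hy0 s hs.le hs1 fun x hx => ?_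
    split_ifs with h
    · simp [hs.le]
    · exact hb x ⟨not_le.1 h, hx⟩
  have hL2 : ∀ x ≤ y0, |(fun x => if x ≤ 0 then 0 else Real.log (deriv f x)) x| ≤ Q * s ^ (1 - η/2) := by
    intro x hx
    dsimp only
    split_ifs with h
    · rw [abs_zero]; positivity
    · have h' := not_le.1 h
      have h1 := hL1 x hx
      rw [A3 1 x h', iteratedDeriv_one, (hdiff x).deriv] at h1
      have h2 := log_abs_le hc'0 (min_le_right _ _)
        ((min_le_left _ _).trans (hcle x ⟨h'.le, by linarith⟩) : c' ≤ deriv f x)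
      refine h2.trans ?_
      rw [hQ, div_mul_eq_mul_div]
      have : 0 < s ^ (1 - η/2) := by positivity
      gcongr
      nlinarith
  have := H2 j y0 hy0 (Q * s ^ (1 - η/2)) (by positivity) (hs0Q s hs hss0) hL2 x hx.2
  rw [B3 j x hx.1] at this
  refine this.trans ?_
  rw [Real.mul_rpow hQ0.le (by positivity), ← Real.rpow_mul hs.le, ← mul_assoc]
  have e1 : s ^ ((1 - η/2) * (1 - η/2)) ≤ s ^ (1 - η) :=
    Real.rpow_le_rpow_of_exponent_ge hs hs1 (by nlinarith)
  have e2 : C2 j * Q ^ (1 - η/2) ≤ Cf := by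
    rw [hCf]
    have := Finset.single_le_sum (f := fun j => C2 j * Q ^ (1 - η/2)) (fun i _ => hnn i)
      (Finset.mem_range.2 (by omega : j < n + 1))
    linarith
  exact mul_le_mul e2 e1 (by positivity) (by linarith [hnn j])

namespace Fl
variable {ξ : ℝ → ℝ} {φ : ℝ → ℝ → ℝ} {K : ℝ}

lemma flat_est (h : Fl ξ φ K) {f : ℝ → ℝ} (hf : SmoothDiffeoI f) (hi : ITIat f 0)
    (hf1 : ∀ x ∈ Icc (0:ℝ) 1, f x = φ 1 x) (n : ℕ) (η : ℝ) (hη : 0 < η) (hη1 : η < 1) :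
    ∃ C ≥ 1, ∃ s0 > 0, ∀ y0 ∈ Ioc (0:ℝ) (1/2), ∀ s > 0, s ≤ s0 → |ξ y0| = s →
      (∀ x ∈ Icc 0 y0, |ξ x| ≤ s) → ∃ L ∈ Ico 0 y0, ξ L = 0 ∧
      (∀ x ∈ Ioc L y0, 0 < ξ x * ξ y0) ∧ ∀ x ∈ Ioo L y0, ∀ j ≤ n,
        |iteratedDeriv j ξ x| ≤ C * |ξ x| * (C * s ^ (1 - η) / |ξ x|) ^ j := by
  obtain ⟨C1, hC1, s1, hs1, H1⟩ := logderiv_est hf hi n η hη hη1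
  obtain ⟨C2, hC2, H2⟩ := Orb.core K n
  have heK : 1 ≤ Real.exp K := Real.one_le_exp h.K0
  set B0 := C1 * Real.exp K with hB0
  have hB01 : 1 ≤ B0 := one_le_mul_of_one_le_of_one_le hC1 heK
  set Cs : ℝ := (2 ^ n * n.factorial) with hCs
  have hnf : (1:ℝ) ≤ n.factorial := by exact_mod_cast Nat.one_le_iff_ne_zero.2 (Nat.factorial_ne_zero n)
  have hCs1 : 1 ≤ Cs := one_le_mul_of_one_le_of_one_le (one_le_pow₀ (by norm_num)) hnf
  set C := n.factorial * (Cs * (C2 * B0)) with hC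
  have hC2B : 1 ≤ C2 * B0 := one_le_mul_of_one_le_of_one_le hC2 hB01
  have hCle1 : Cs * (C2 * B0) ≤ C := le_mul_of_one_le_left (by positivity) hnf
  have hCle2 : (n.factorial : ℝ) ≤ C :=
    le_mul_of_one_le_right (by positivity) (one_le_mul_of_one_le_of_one_le hCs1 hC2B)
  refine ⟨C, hnf.trans hCle2, min (s1 / Real.exp K) 1, by positivity, ?_⟩
  intro y0 hy0 s hs hss hys hmax
  have hs_1 : s ≤ 1 := hss.trans (min_le_right _ _)
  have hs_2 : Real.exp K * s ≤ s1 := by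
    have := hss.trans (min_le_left _ _)
    rw [le_div_iff₀ (by positivity)] at this; linarith
  have hy : y0 ∈ Ioo (0:ℝ) 1 := ⟨hy0.1, by linarith [hy0.2]⟩
  have hyI := Ioo_subset_Icc_self hy
  have hne : ξ y0 ≠ 0 := by rw [← abs_pos, hys]; exact hs
  obtain ⟨σ, hσ, hσpos, hσabs⟩ := exists_sigma hne
  obtain ⟨L, hL, κ, ho⟩ := h.orb hy hσ hσpos
  obtain ⟨hxiL, hLy, hcov⟩ := h.orb_limit hy hσ hσpos hL (fun a => (ho a).1)
  have hσ2 : σ * σ = 1 := by rcases hσ with rfl | rfl <;> norm_num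
  have hσ1 : |σ| = 1 := by rcases hσ with rfl | rfl <;> norm_num
  have hp := h.pos hyI hσpos
  have hpa : ∀ t, σ * ξ (φ t y0) = |ξ (φ t y0)| := fun t => by
    rw [← abs_of_pos (hp t), abs_mul, hσ1, one_mul]
  refine ⟨L, ⟨hL.1, hLy⟩, hxiL, ?_, ?_⟩
  · intro x hx
    obtain ⟨t, _, rfl, _⟩ := hcov x hx
    have := mul_pos (hp (-σ * t)) hσpos
    nlinarith [this, hσ2]
  have hest := H1 y0 hy0.2 (Real.exp K * s) (by positivity) hs_2 (fun x hx => by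
    have hxI : x ∈ Icc (0:ℝ) 1 := ⟨hx.1.le, by linarith [hx.2, hy0.2]⟩
    have := h.disp_le hxI 1
    rw [← hf1 x hxI] at this
    simp only [abs_one, mul_one] at this
    refine this.trans ?_
    have := hmax x ⟨hx.1.le, hx.2⟩
    gcongr)
  have hB : C1 * (Real.exp K * s) ^ (1 - η) ≤ B0 * s ^ (1 - η) := by
    rw [Real.mul_rpow (by positivity) hs.le, ← mul_assoc, hB0]
    have : Real.exp K ^ (1 - η) ≤ Real.exp K := by
      calc Real.exp K ^ (1 - η) ≤ Real.exp K ^ (1:ℝ) :=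
            Real.rpow_le_rpow_of_exponent_le heK (by linarith)
        _ = _ := Real.rpow_one _
    gcongr
  have hss' : s ≤ s ^ (1 - η) := by
    calc s = s ^ (1:ℝ) := (Real.rpow_one _).symm
      _ ≤ _ := Real.rpow_le_rpow_of_exponent_ge hs hs_1 (by linarith)
  have hsp : 0 < s ^ (1 - η) := by positivity
  have hxle : ∀ t, 0 < t → φ (-σ * t) y0 ∈ Ioc 0 y0 := fun t ht => by
    refine ⟨(h.mem' hy _).1, ?_⟩
    have h1 : (0:ℝ) ∈ Ioi (-1:ℝ) := by norm_num
    have h2 : t ∈ Ioi (-1:ℝ) := by simp only [mem_Ioi]; linarith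
    have := (ho (-1)).1.anti h1 h2 ht.le
    simpa [h.zero hyI] using this
  obtain ⟨hsm, hf0, hf1', hpos, hmaps⟩ := hf
  have hsm' : ContDiff ℝ ∞ f := hsm
  have hdf : ContDiff ℝ ∞ (deriv f) := (contDiff_infty_iff_deriv.1 hsm').2
  have hSo : IsOpen {x | 0 < deriv f x} := isOpen_lt continuous_const hdf.continuous
  have hl : ContDiffOn ℝ ∞ (fun x => Real.log (deriv f x)) {x | 0 < deriv f x} :=
    hdf.contDiffOn.log fun x hx => (ne_of_gt hx)
  have hcore := (H2 (ho 0).1 (Λ := fun x => -σ * Real.log (deriv f x)) (c := (1 + σ)/2)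
    (B := B0 * s ^ (1 - η)) hSo (contDiffOn_const.mul hl) (fun t _ => hpos _ (h.mem hyI _))
    (by rcases hσ with rfl | rfl <;> norm_num) (by rcases hσ with rfl | rfl <;> norm_num)
    (fun t _ => h.cocycle hf1 (hsm'.differentiable (by simp)) hpos hy hσ hσpos t)
    (fun t ht => by
      rw [Real.exp_log (hp _), hpa]
      refine (hmax _ (Ioc_subset_Icc_self (hxle t ht))).trans ?_
      exact hss'.trans (le_mul_of_one_le_left hsp.le hB01))
    (fun t _ => by have := (h.mem hyI (-σ * t)).2; linarith [hL.1])
    (fun j hj t ht => by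
      rw [iteratedDeriv_const_mul_field, abs_mul, abs_neg, hσ1, one_mul]
      exact (hest _ (hxle t ht) j hj).trans hB) (ho 0).2).1
  intro x hx j hj
  obtain ⟨t, _, rfl, ht0⟩ := hcov x ⟨hx.1, hx.2.le⟩
  have ht := ht0 hx.2
  set M := C2 * (B0 * s ^ (1 - η)) with hM
  have hMp : 0 ≤ M := by positivity
  have hsp2 := (ho 0).1.space (G := ξ) (n := n) (M := M) (A := n.factorial * |ξ (φ (-σ * t) y0)|)
    isOpen_Ioo h.sm (fun t _ => h.mem' hy _) ht hMp
    (fun i h1 h2 => hcore i h1 h2 t ht) (fun i hin => by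
      have e : (fun t => ξ (φ (-σ * t) y0)) =
          fun t => σ * Real.exp (Real.log (σ * ξ (φ (-σ * t) y0))) := by
        funext t
        rw [Real.exp_log (hp _), ← mul_assoc, hσ2, one_mul]
      rw [e, iteratedDeriv_const_mul_field, abs_mul, hσ1, one_mul]
      have := (ho 0).1.exp_bound (n := i) (M := M) ht (fun a h1 h2 => hcore a h1 (h2.trans hin) t ht)
      refine this.trans ?_
      rw [Real.exp_log (hp _), hpa]
      have : (i.factorial : ℝ) ≤ n.factorial := by exact_mod_cast Nat.factorial_le hin
      gcongr) j 0 (by omega)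
  simp only [iteratedDeriv_zero, pow_zero, mul_one, Real.exp_neg, Real.exp_log (hp _)] at hsp2
  rw [hpa] at hsp2
  refine hsp2.trans ?_
  have hxp : 0 < |ξ (φ (-σ * t) y0)| := by rw [← hpa]; exact hp _
  set q := |ξ (φ (-σ * t) y0)| with hq
  calc Cs ^ j * (n.factorial * q) * (M * q⁻¹) ^ j = n.factorial * q * (Cs * (C2 * B0) * s ^ (1 - η) / q) ^ j := by
        rw [hM, div_eq_mul_inv, mul_pow, mul_pow, mul_pow, mul_pow, mul_pow, mul_pow, mul_pow, mul_pow]; ring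
    _ ≤ C * q * (C * s ^ (1 - η) / q) ^ j := by gcongr

end Fl
end Aux
end

section
open Set Filter Topology
open scoped ContDiff
namespace Aux

lemma bound_on_compact {u : ℝ → ℝ} (hu : ContDiff ℝ ∞ u) (k : ℕ) (a b : ℝ) :
    ∃ M ≥ 1, ∀ j ≤ k, ∀ x ∈ Icc a b, |iteratedDeriv j u x| ≤ M := by
  have : ∀ j : ℕ, ∃ M ≥ 0, ∀ x ∈ Icc a b, |iteratedDeriv j u x| ≤ M := by
    intro j
    have hc : Continuous (iteratedDeriv j u) := by
      have := hu.continuous_iteratedDeriv j (by exact_mod_cast le_top)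
      exact this
    obtain ⟨M, hM⟩ := isCompact_Icc.exists_bound_of_continuousOn (s := Icc a b) hc.continuousOn
    exact ⟨max M 0, le_max_right _ _, fun x hx => (hM x hx).trans (le_max_left _ _)⟩
  choose M hM0 hM using this
  refine ⟨1 + ∑ j ∈ Finset.range (k + 1), M j, ?_, fun j hj x hx => ?_⟩
  · have := Finset.sum_nonneg (s := Finset.range (k + 1)) fun j _ => hM0 j
    linarith
  · have := Finset.single_le_sum (f := M) (fun i _ => hM0 i) (Finset.mem_range.2 (by omega : j < k + 1))
    linarith [hM j x hx]

lemma chi_bound (k : ℕ) : ∃ M ≥ 1, ∀ j ≤ k, ∀ x, |iteratedDeriv j Real.smoothTransition x| ≤ M := by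
  obtain ⟨M, hM1, hM⟩ := bound_on_compact (Real.smoothTransition.contDiff (n := ⊤)) k 0 1
  refine ⟨M, hM1, fun j hj x => ?_⟩
  by_cases hx : x ∈ Icc (0:ℝ) 1
  · exact hM j hj x hx
  · have key : ∀ c : ℝ, |c| ≤ 1 → Real.smoothTransition =ᶠ[𝓝 x] (fun _ => c) →
        |iteratedDeriv j Real.smoothTransition x| ≤ M := by
      intro c hc he
      rw [he.iteratedDeriv_eq, iteratedDeriv_const]
      split_ifs
      · exact hc.trans hM1
      · simp; linarith
    rcases lt_or_ge x 0 with h | h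
    · refine key 0 (by simp) ?_
      filter_upwards [Iio_mem_nhds h] with z hz
      exact Real.smoothTransition.zero_of_nonpos (le_of_lt hz)
    · have h1 : 1 < x := by by_contra! h1; exact hx ⟨h, h1⟩
      refine key 1 (by simp) ?_
      filter_upwards [Ioi_mem_nhds h1] with z hz
      exact Real.smoothTransition.one_of_one_le (le_of_lt hz)

lemma theta_bound {k : ℕ} {M : ℝ} (hM : ∀ j ≤ k, ∀ x, |iteratedDeriv j Real.smoothTransition x| ≤ M)
    {w p : ℝ} (hw : 0 < w) (x : ℝ) :
    ∀ j ≤ k, |iteratedDeriv j (fun x => Real.smoothTransition ((x - p) / w)) x| ≤ M * (1/w) ^ j := by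
  intro j hj
  have e : (fun x => Real.smoothTransition ((x - p) / w)) =
      fun x => (fun z => Real.smoothTransition ((1/w) * z)) (x - p) := by
    funext x; simp only; congr 1; field_simp
  rw [e, show (fun x => (fun z => Real.smoothTransition ((1/w) * z)) (x - p)) =
    fun x => (fun z => Real.smoothTransition ((1/w) * z)) (x + -p) from rfl,
    congrFun (iteratedDeriv_comp_add_const j (fun z => Real.smoothTransition ((1/w) * z)) (-p)) x,
    iteratedDeriv_comp_const_mul]
  · simp only [abs_mul, abs_pow, abs_of_pos (one_div_pos.2 hw)]
    rw [mul_comm]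
    gcongr
    exact hM j hj _
  · exact Real.smoothTransition.contDiff

lemma one_sub_iter {u : ℝ → ℝ} (hu : ContDiff ℝ ∞ u) (j : ℕ) (x : ℝ) :
    |iteratedDeriv j (fun x => 1 - u x) x| ≤ 1 + |iteratedDeriv j u x| ∧
    (1 ≤ j → |iteratedDeriv j (fun x => 1 - u x) x| ≤ |iteratedDeriv j u x|) := by
  rw [iteratedDeriv_fun_sub contDiffAt_const (hu.contDiffAt.of_le (by exact_mod_cast le_top)),
    iteratedDeriv_const]
  refine ⟨?_, fun h => ?_⟩
  · split_ifs
    · refine (abs_sub _ _).trans ?_; simp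
    · simp
  · rw [if_neg (by omega)]; simp

namespace Fl
variable {ξ : ℝ → ℝ} {φ : ℝ → ℝ → ℝ} {K : ℝ}

lemma xi_lip (h : Fl ξ φ K) {x : ℝ} (hx : x ∈ Icc (0:ℝ) 1) : |ξ x| ≤ K * x := by
  have := h.lip.dist_le_mul x hx 0 (by simp)
  simpa [Real.dist_eq, h.xi0, h.K0, abs_of_nonneg hx.1] using this

set_option maxHeartbeats 4000000 in
/-- the modified vector field. -/
lemma modify (h : Fl ξ φ K) {f : ℝ → ℝ} (hf : SmoothDiffeoI f) (hi : ITIat f 0)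
    (hf1 : ∀ x ∈ Icc (0:ℝ) 1, f x = φ 1 x) (hnz : ∀ r > 0, ∃ x ∈ Ioo 0 r, ξ x ≠ 0)
    (k : ℕ) {ε T r : ℝ} (hε : 0 < ε) (hT : 0 ≤ T) (hr : 0 < r) :
    ∃ ξ' φ' K' δ y1 y0, 0 < δ ∧ δ < y1 ∧ y1 < y0 ∧ y0 ≤ r ∧ y0 ≤ 1/2 ∧ Fl ξ' φ' K' ∧
      (∀ x ≥ δ, ξ' x = ξ x) ∧ (∀ x ≤ 0, ξ' x = 0) ∧ ContDiffOn ℝ ∞ ξ' (Iio 1) ∧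
      (∀ x ∈ Ioc 0 y0, ξ' x ≠ 0) ∧ (∀ j ≤ k, ∀ x ∈ Ioo 0 y0, |iteratedDeriv j ξ' x| ≤ ε) ∧
      (∀ x ∈ Icc y1 1, ∀ t, |t| ≤ T → δ ≤ φ t x) ∧ (∀ t, |t| ≤ T → φ t y1 < y0) := by
  set η : ℝ := 1 / (2 * (k + 1)) with hη
  have hη0 : 0 < η := by positivity
  have hη1 : η < 1 := by
    rw [hη, div_lt_one (by positivity)]; linarith [k.cast_nonneg (α := ℝ)]
  have hηk : η * k ≤ 1/2 := by
    rw [hη, div_mul_eq_mul_div, div_le_div_iff₀ (by positivity) (by norm_num)]; linarith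
  obtain ⟨C, hC1, s0, hs0, H⟩ := h.flat_est hf hi hf1 (k + 1) η hη0 hη1
  obtain ⟨M, hM1, hM⟩ := chi_bound k
  obtain ⟨M', hM'1, hM'⟩ := bound_on_compact (expNegInvGlue.contDiff (n := ⊤)) k 0 1
  set T' := T + 1 with hT'
  set c1 : ℝ := Real.exp (-(K * (2 * T'))) with hc1
  have hc10 : 0 < c1 := Real.exp_pos _
  have hc11 : c1 ≤ 1 := Real.exp_le_one_iff.2 (by have := h.K0; have : 0 ≤ T' := by linarith
                                                  have := mul_nonneg h.K0 this; linarith)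
  set C4 := 2 * C ^ 2 / c1 with hC4
  have hC41 : 1 ≤ C4 := by
    rw [hC4, le_div_iff₀ hc10]; nlinarith
  set C5 : ℝ := 2 ^ k * (M * C + 2 * M * M') * C4 ^ k with hC5
  have hC50 : 0 < C5 := by positivity
  -- choose the scale
  set e1 := min (min s0 1) ((ε / C5) ^ 2) with he1
  have he10 : 0 < e1 := by positivity
  set r1 := min (min r (1/2)) (e1 / (K + 1)) with hr1
  have hK1 : 0 < K + 1 := by linarith [h.K0]
  have hr10 : 0 < r1 := by positivity
  have hr1r : r1 ≤ r := (min_le_left _ _).trans (min_le_left _ _)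
  have hr12 : r1 ≤ 1/2 := (min_le_left _ _).trans (min_le_right _ _)
  have hIcc : Icc 0 r1 ⊆ Icc (0:ℝ) 1 := Icc_subset_Icc_right (by linarith)
  obtain ⟨y0, hy0r, hmax⟩ := isCompact_Icc.exists_isMaxOn (nonempty_Icc.2 hr10.le)
    (h.xi_cont.mono hIcc).abs
  have hmax' : ∀ x ∈ Icc 0 r1, |ξ x| ≤ |ξ y0| := fun x hx => hmax hx
  obtain ⟨z, hz, hzne⟩ := hnz r1 hr10
  set s := |ξ y0| with hs
  have hs_pos : 0 < s := (abs_pos.2 hzne).trans_le (hmax' z ⟨hz.1.le, hz.2.le⟩)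
  have hξy0 : ξ y0 ≠ 0 := abs_pos.1 hs_pos
  have hy0pos : 0 < y0 := (h.interior_of_ne (hIcc hy0r) hξy0).1
  have hse1 : s ≤ e1 := by
    have h1 := h.xi_lip (hIcc hy0r)
    have h2 : y0 ≤ e1 / (K + 1) := hy0r.2.trans (min_le_right _ _)
    rw [le_div_iff₀ hK1] at h2
    nlinarith [h.K0]
  have hs1 : s ≤ 1 := hse1.trans ((min_le_left _ _).trans (min_le_right _ _))
  have hss0 : s ≤ s0 := hse1.trans ((min_le_left _ _).trans (min_le_left _ _))
  have hsε : s ≤ (ε / C5) ^ 2 := hse1.trans (min_le_right _ _)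
  have hy012 : y0 ≤ 1/2 := hy0r.2.trans hr12
  obtain ⟨L, hL, hξL, hsgn, hest⟩ := H y0 ⟨hy0pos, hy012⟩ s hs_pos hss0 rfl
    (fun x hx => hmax' x ⟨hx.1, hx.2.trans hy0r.2⟩)
  have hyO : y0 ∈ Ioo (0:ℝ) 1 := ⟨hy0pos, by linarith⟩
  have hyI := Ioo_subset_Icc_self hyO
  obtain ⟨σ, hσ, hσpos, hσabs⟩ := exists_sigma hξy0
  have hσ2 : σ * σ = 1 := by rcases hσ with rfl | rfl <;> norm_num
  have hσ1 : |σ| = 1 := by rcases hσ with rfl | rfl <;> norm_num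
  obtain ⟨L', hL', κ, ho⟩ := h.orb hyO hσ hσpos
  -- monotonicity of the orbit
  have hanti : StrictAnti (fun t => φ (-σ * t) y0) := by
    refine strictAnti_of_deriv_neg fun t => ?_
    rw [((ho (t - 1)).1.hx t (by simp)).deriv]
    exact neg_neg_of_pos (Real.exp_pos _)
  set δ := φ (-σ * (2 * T')) y0 with hδ
  set y1 := φ (-σ * T') y0 with hy1
  have hT'0 : 0 < T' := by linarith
  have hφ0 : φ (-σ * 0) y0 = y0 := by rw [mul_zero, h.zero hyI]
  have hδy1 : δ < y1 := hanti (by linarith : T' < 2 * T')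
  have hy1y0 : y1 < y0 := by
    have := hanti hT'0
    simp only [hφ0] at this; exact this
  have hδO : δ ∈ Ioo (0:ℝ) 1 := h.mem' hyO _
  have hy1O : y1 ∈ Ioo (0:ℝ) 1 := h.mem' hyO _
  have hφy1 : ∀ t, φ t y1 = φ (-σ * (T' - σ * t)) y0 := by
    intro t
    rw [hy1, ← h.add hyI]
    congr 1
    have : -σ * (T' - σ * t) = -σ * T' + (σ * σ) * t := by ring
    rw [this, hσ2]; ring
  have hst : ∀ t, |t| ≤ T → |σ * t| ≤ T := fun t ht => by rwa [abs_mul, hσ1, one_mul]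
  have hup : ∀ t, |t| ≤ T → φ t y1 < y0 := by
    intro t ht
    rw [hφy1]
    have := (abs_le.1 (hst t ht)).2
    have := hanti (by linarith : 0 < T' - σ * t)
    simp only [hφ0] at this; exact this
  have hlow : ∀ t, |t| ≤ T → δ ≤ φ t y1 := by
    intro t ht
    rw [hφy1]
    have := (abs_le.1 (hst t ht)).1
    exact (hanti (by linarith : T' - σ * t < 2 * T')).le
  have hδL : L < δ := by
    -- every point of the orbit is right of L
    by_contra! hle
    have hLI : L ∈ Icc (0:ℝ) 1 := ⟨hL.1, by linarith [hL.2]⟩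
    have h1 := h.smono hLI hyI hL.2 (-σ * (2 * T'))
    rw [h.fixed hLI hξL] at h1
    exact absurd h1 (not_lt.2 hle)
  have hbig : ∀ x ∈ Icc δ y0, c1 * s ≤ |ξ x| := by
    intro x hx
    have hcont : ContinuousOn (fun t => φ (-σ * t) y0) (Icc 0 (2 * T')) :=
      ((h.cont hyI).comp (continuous_const.mul continuous_id)).continuousOn
    obtain ⟨t, ht, he⟩ := intermediate_value_Icc' (by linarith : 0 ≤ 2 * T') hcont
      (show x ∈ Icc _ _ from ⟨hx.1, by simpa [h.zero hyI] using hx.2⟩)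
    have h1 := h.xi_ge hyI (-σ * t)
    simp only at he
    rw [he, abs_mul, abs_neg, hσ1, one_mul, abs_of_nonneg ht.1] at h1
    have h2 : Real.exp (K * t) ≤ Real.exp (K * (2 * T')) :=
      Real.exp_le_exp.2 (mul_le_mul_of_nonneg_left ht.2 h.K0)
    have h3 : s ≤ Real.exp (K * (2 * T')) * |ξ x| := h1.trans (by gcongr)
    rw [hc1, Real.exp_neg, inv_mul_le_iff₀ (Real.exp_pos _)]
    exact h3
  -- the width
  set w := c1 * s ^ η / (2 * C ^ 2) with hw
  have hsη : 0 < s ^ η := by positivity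
  have hw0 : 0 < w := by positivity
  have hs1η : s ^ (1 - η) * s ^ η = s := by
    rw [← Real.rpow_add hs_pos]; simp
  have hCw : C * (C * s ^ (1 - η)) * w = c1 * s / 2 := by
    rw [hw]
    calc C * (C * s ^ (1 - η)) * (c1 * s ^ η / (2 * C ^ 2)) = c1 * (s ^ (1 - η) * s ^ η) / 2 := by
          field_simp
      _ = _ := by rw [hs1η]
  have hder : ∀ x ∈ Ioo L y0, |deriv ξ x| ≤ C * (C * s ^ (1 - η)) := by
    intro x hx
    have h1 := hest x hx 1 (by omega)
    have hxne : |ξ x| ≠ 0 := by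
      have := hsgn x ⟨hx.1, hx.2.le⟩
      intro e; rw [abs_eq_zero.1 e, zero_mul] at this; exact lt_irrefl _ this
    rw [iteratedDeriv_one, pow_one] at h1
    refine h1.trans (le_of_eq ?_)
    field_simp
  have hmvt : ∀ x ∈ Icc L δ, |ξ δ - ξ x| ≤ C * (C * s ^ (1 - η)) * (δ - x) := by
    intro x hx
    rcases hx.2.eq_or_lt with rfl | hlt
    · simp
    obtain ⟨c, hc, he⟩ := exists_deriv_eq_slope ξ hlt
      (h.xi_cont.mono (Icc_subset_Icc (hL.1.trans hx.1) hδO.2.le))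
      (fun z hz => (h.xi_deriv ⟨hL.1.trans_lt (hx.1.trans_lt hz.1), hz.2.trans hδO.2⟩).differentiableAt.differentiableWithinAt)
    have h1 := hder c ⟨hx.1.trans_lt hc.1, hc.2.trans (hδy1.trans hy1y0)⟩
    rw [he, abs_div, abs_of_pos (sub_pos.2 hlt), div_le_iff₀ (sub_pos.2 hlt)] at h1
    exact h1
  have hLw : L < δ - w := by
    have h1 := hmvt L ⟨le_rfl, hδL.le⟩
    rw [hξL, sub_zero] at h1
    have h2 := hbig δ ⟨le_rfl, (hδy1.trans hy1y0).le⟩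
    have h3 : 0 < C * (C * s ^ (1 - η)) := by positivity
    have h4 : c1 * s = 2 * (C * (C * s ^ (1 - η)) * w) := by rw [hCw]; ring
    rw [h4] at h2
    nlinarith [mul_pos h3 hw0]
  set p := δ - w with hp
  have hp0 : 0 < p := hL.1.trans_lt hLw
  have hbig2 : ∀ x ∈ Icc p y0, c1 * s / 2 ≤ |ξ x| := by
    intro x hx
    rcases le_total x δ with hxd | hxd
    · have h1 := hmvt x ⟨hLw.le.trans hx.1, hxd⟩
      have h2 := hbig δ ⟨le_rfl, (hδy1.trans hy1y0).le⟩
      have h3 : C * (C * s ^ (1 - η)) * (δ - x) ≤ C * (C * s ^ (1 - η)) * w := by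
        gcongr; rw [hp] at hx; linarith [hx.1]
      rw [hCw] at h3
      have := abs_sub_abs_le_abs_sub (ξ δ) (ξ x)
      linarith
    · have := hbig x ⟨hxd, hx.2⟩
      have : 0 < c1 * s := by positivity
      linarith
  set B := C4 * s ^ (-η) with hB
  have hsη1 : 1 ≤ s ^ (-η) := Real.one_le_rpow_of_pos_of_le_one_of_nonpos hs_pos hs1 (by linarith)
  have hB1 : 1 ≤ B := one_le_mul_of_one_le_of_one_le hC41 hsη1
  have hwB : 1 / w = B := by
    rw [hw, hB, hC4, Real.rpow_neg hs_pos.le]; field_simp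
  have hξb : ∀ x ∈ Ico p y0, ∀ j ≤ k, |iteratedDeriv j ξ x| ≤ C * s * B ^ j := by
    intro x hx j hj
    have h1 := hest x ⟨hLw.trans_le hx.1, hx.2⟩ j (by omega)
    have h2 := hbig2 x ⟨hx.1, hx.2.le⟩
    have h3 := hmax' x ⟨hp0.le.trans hx.1, hx.2.le.trans hy0r.2⟩
    have h5 : 0 < c1 * s / 2 := by positivity
    refine h1.trans ?_
    have h4 : C * s ^ (1 - η) / |ξ x| ≤ B := by
      calc C * s ^ (1 - η) / |ξ x| ≤ C * s ^ (1 - η) / (c1 * s / 2) := by gcongr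
        _ = 2 * C / c1 * s ^ (-η) := by
            rw [show (1 - η) = 1 + (-η) by ring, Real.rpow_add hs_pos, Real.rpow_one]; field_simp
        _ ≤ B := by
            rw [hB, hC4]; gcongr; nlinarith
    gcongr
  -- the cutoff and the new field
  set θ : ℝ → ℝ := fun x => Real.smoothTransition ((x - p) / w) with hθ
  have hθsm : ContDiff ℝ ∞ θ :=
    Real.smoothTransition.contDiff.comp ((contDiff_id.sub contDiff_const).div_const w)
  have hθ1 : ∀ x ≥ δ, θ x = 1 := fun x hx => by
    refine Real.smoothTransition.one_of_one_le ?_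
    rw [le_div_iff₀ hw0, hp]; linarith
  have hθ0 : ∀ x ≤ p, θ x = 0 := fun x hx => by
    refine Real.smoothTransition.zero_of_nonpos ?_
    exact div_nonpos_of_nonpos_of_nonneg (by linarith) hw0.le
  have hθnn : ∀ x, 0 ≤ θ x := fun x => Real.smoothTransition.nonneg _
  have hθle : ∀ x, θ x ≤ 1 := fun x => Real.smoothTransition.le_one _
  have hθb : ∀ x, ∀ j ≤ k, |iteratedDeriv j θ x| ≤ M * B ^ j := fun x j hj => by
    rw [← hwB]; exact theta_bound hM hw0 x j hj
  have hθb' : ∀ x, ∀ j ≤ k, |iteratedDeriv j (fun x => 1 - θ x) x| ≤ 2 * M * B ^ j := fun x j hj => by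
    have h1 := (one_sub_iter hθsm j x).1
    have h2 := hθb x j hj
    have h3 : 1 ≤ M * B ^ j := one_le_mul_of_one_le_of_one_le hM1 (one_le_pow₀ hB1)
    linarith
  set E : ℝ → ℝ := fun x => σ * s * expNegInvGlue x with hE
  have hEsm : ContDiff ℝ ∞ E := contDiff_const.mul expNegInvGlue.contDiff
  have hEb : ∀ x ∈ Icc (0:ℝ) 1, ∀ j ≤ k, |iteratedDeriv j E x| ≤ M' * s * B ^ j := by
    intro x hx j hj
    rw [hE, iteratedDeriv_const_mul_field, abs_mul, abs_mul, hσ1, one_mul, abs_of_pos hs_pos]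
    have h1 := hM' j hj x hx
    have h2 : 1 ≤ B ^ j := one_le_pow₀ hB1
    calc s * |iteratedDeriv j expNegInvGlue x| ≤ s * M' := by gcongr
      _ ≤ s * M' * B ^ j := le_mul_of_one_le_right (by positivity) h2
      _ = _ := by ring
  set ξ' : ℝ → ℝ := fun x => θ x * ξ x + (1 - θ x) * E x with hξ'
  have hsub1 : Ioo (0:ℝ) 1 ⊆ Iio 1 := fun x hx => hx.2
  have hloc : ∀ x < p, ξ' =ᶠ[𝓝 x] E := fun x hx => by
    filter_upwards [Iio_mem_nhds hx] with z hz
    simp only [hξ', hθ0 z (le_of_lt hz)]; ring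
  have hpl : p < 1 := by rw [hp]; linarith [hδO.2]
  have hsm' : ContDiffOn ℝ ∞ ξ' (Iio 1) := by
    intro x hx
    refine ContDiffAt.contDiffWithinAt ?_
    rcases lt_or_ge x p with hxp | hxp
    · exact hEsm.contDiffAt.congr_of_eventuallyEq (hloc x hxp)
    · have h1 : ContDiffAt ℝ ∞ ξ x := cd_at isOpen_Ioo h.sm ⟨hp0.trans_le hxp, hx⟩
      exact (hθsm.contDiffAt.mul h1).add ((contDiffAt_const.sub hθsm.contDiffAt).mul hEsm.contDiffAt)
  have heq : ∀ x ≥ δ, ξ' x = ξ x := fun x hx => by simp [hξ', hθ1 x hx]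
  have hz' : ∀ x ≤ 0, ξ' x = 0 := fun x hx => by
    simp [hξ', hθ0 x (hx.trans hp0.le), hE, expNegInvGlue.zero_of_nonpos hx]
  have hc1' : ContDiffOn ℝ 1 ξ' (Icc 0 1) := by
    intro x hx
    rcases lt_or_ge x 1 with hx1 | hx1
    · exact ((cd_at isOpen_Iio hsm' hx1).of_le (by exact_mod_cast le_top)).contDiffWithinAt
    · refine (h.c1 x hx).congr_of_eventuallyEq ?_ (heq x (hδO.2.le.trans hx1))
      refine mem_nhdsWithin_of_mem_nhds ?_
      filter_upwards [Ioi_mem_nhds (hδO.2.trans_le hx1)] with z hz using heq z (le_of_lt hz)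
  obtain ⟨Kn, hKn⟩ := hc1'.exists_lipschitzOnWith (by simp) (convex_Icc 0 1) isCompact_Icc
  obtain ⟨φ', hφ'⟩ := exists_flow hKn (hz' 0 le_rfl) (by rw [heq 1 hδO.2.le, h.xi1])
  obtain ⟨K', hK'⟩ := Fl.of hc1' (hsm'.mono hsub1) hφ'
  refine ⟨ξ', φ', K', δ, y1, y0, hδO.1, hδy1, hy1y0, hy0r.2.trans hr1r, hy012, hK', heq, hz', hsm', ?_, ?_, ?_, hup⟩
  · intro x hx
    have hEpos : 0 < σ * E x := by
      have : σ * E x = (σ * σ) * (s * expNegInvGlue x) := by simp only [hE]; ring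
      rw [this, hσ2, one_mul]
      exact mul_pos hs_pos (expNegInvGlue.pos_of_pos hx.1)
    have : 0 < σ * ξ' x := by
      rcases le_or_gt x p with hxp | hxp
      · simp only [hξ', hθ0 x hxp]; linarith
      · have h1 := hsgn x ⟨hLw.trans hxp, hx.2⟩
        have h2 : 0 < σ * ξ x := by
          have e : (σ * ξ x) * (σ * ξ y0) = (σ * σ) * (ξ x * ξ y0) := by ring
          rw [hσ2, one_mul] at e
          rw [← e] at h1
          exact (pos_iff_pos_of_mul_pos h1).2 hσpos
        have e : σ * ξ' x = θ x * (σ * ξ x) + (1 - θ x) * (σ * E x) := by simp only [hξ']; ring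
        rw [e]
        rcases (hθnn x).eq_or_lt with h0 | h0
        · rw [← h0]; linarith
        · have := mul_pos h0 h2
          have := mul_nonneg (sub_nonneg.2 (hθle x)) hEpos.le
          linarith
    intro e; rw [e, mul_zero] at this; exact lt_irrefl _ this
  · intro j hj x hx
    have hxI : x ∈ Icc (0:ℝ) 1 := ⟨hx.1.le, by linarith [hx.2]⟩
    have hmain : |iteratedDeriv j ξ' x| ≤ 2 ^ j * (M * (C * s) + 2 * M * (M' * s)) * B ^ j := by
      rcases lt_or_ge x p with hxp | hxp
      · rw [(hloc x hxp).iteratedDeriv_eq]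
        refine (hEb x hxI j hj).trans (mul_le_mul_of_nonneg_right ?_ (by positivity))
        have h1 : M' * s ≤ 2 * M * (M' * s) := le_mul_of_one_le_left (by positivity) (by linarith)
        have h2 : 0 ≤ M * (C * s) := by positivity
        have h3 : (1:ℝ) ≤ 2 ^ j := one_le_pow₀ (by norm_num)
        calc M' * s ≤ M * (C * s) + 2 * M * (M' * s) := by linarith
          _ ≤ _ := le_mul_of_one_le_left (by positivity) h3
      · have hxO : x ∈ Ioo (0:ℝ) 1 := ⟨hx.1, by linarith [hx.2]⟩
        have m1 := mul_bound (n := j) isOpen_Ioo hθsm.contDiffOn h.sm hxO (by linarith : 0 ≤ B)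
          (fun i hi => hθb x i (hi.trans hj)) (fun i hi => hξb x ⟨hxp, hx.2⟩ i (hi.trans hj))
        have m2 := mul_bound (n := j) (f := fun x => 1 - θ x) isOpen_Ioo (contDiff_const.sub hθsm).contDiffOn hEsm.contDiffOn hxO (by linarith : 0 ≤ B)
          (fun i hi => hθb' x i (hi.trans hj)) (fun i hi => hEb x hxI i (hi.trans hj))
        have h1 : ContDiffAt ℝ ∞ ξ x := cd_at isOpen_Ioo h.sm hxO
        rw [hξ', iteratedDeriv_fun_add
          ((hθsm.contDiffAt.mul h1).of_le (by exact_mod_cast le_top))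
          (((contDiffAt_const.sub hθsm.contDiffAt).mul hEsm.contDiffAt).of_le (by exact_mod_cast le_top))]
        refine (abs_add_le _ _).trans ?_
        refine (add_le_add m1 m2).trans (le_of_eq ?_)
        ring
    refine hmain.trans ?_
    have hB0 : 0 ≤ B := by linarith
    calc 2 ^ j * (M * (C * s) + 2 * M * (M' * s)) * B ^ j
        ≤ 2 ^ k * (M * (C * s) + 2 * M * (M' * s)) * B ^ k := by
          gcongr
          · norm_num
      _ = C5 * (s * (s ^ (-η)) ^ k) := by rw [hC5, hB, mul_pow]; ring
      _ ≤ C5 * s ^ (1/2:ℝ) := by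
          gcongr
          rw [← Real.rpow_natCast, ← Real.rpow_mul hs_pos.le]
          nth_rewrite 1 [← Real.rpow_one s]
          rw [← Real.rpow_add hs_pos]
          exact Real.rpow_le_rpow_of_exponent_ge hs_pos hs1 (by nlinarith)
      _ ≤ C5 * ((ε / C5) ^ 2) ^ (1/2:ℝ) := by gcongr
      _ = ε := by
          rw [← Real.sqrt_eq_rpow, Real.sqrt_sq (by positivity)]; field_simp
  · intro x hx t ht
    exact (hlow t ht).trans (h.mono (Ioo_subset_Icc_self hy1O) ⟨hy1O.1.le.trans hx.1, hx.2⟩ hx.1 t)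

end Fl
end Aux
end

section
open Set Filter Topology
open scoped ContDiff
namespace Aux
namespace Fl
variable {ξ : ℝ → ℝ} {φ : ℝ → ℝ → ℝ} {K : ℝ}

lemma agree {ξ' : ℝ → ℝ} {φ' : ℝ → ℝ → ℝ} {K' : ℝ} (h : Fl ξ φ K) (h' : Fl ξ' φ' K') {δ T x : ℝ}
    (hT : 0 < T) (he : ∀ x ≥ δ, ξ' x = ξ x) (hx : x ∈ Icc (0:ℝ) 1)
    (hδ : ∀ t, |t| ≤ T → δ ≤ φ t x) : ∀ t, |t| ≤ T → φ' t x = φ t x := by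
  have := ODE_solution_unique_of_mem_Icc (v := fun _ => ξ') (s := fun _ => Icc 0 1) (a := -T) (b := T)
    (t₀ := 0) (f := fun s => φ' s x) (g := fun s => φ s x) (fun _ _ => h'.lip) ⟨by linarith, by linarith⟩
    (h'.cont hx).continuousOn (fun t _ => h'.der hx t) (fun t _ => h'.mem hx t)
    (h.cont hx).continuousOn (fun t ht => by
      rw [he _ (hδ t (abs_le.2 ⟨ht.1.le, ht.2.le⟩))]; exact h.der hx t) (fun t _ => h.mem hx t)
    (by simp [h.zero hx, h'.zero hx])
  intro t ht
  exact this (abs_le.1 ht)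

lemma flow_ne (h : Fl ξ φ K) {y t : ℝ} (hy : y ∈ Icc (0:ℝ) 1) (h0 : ξ y ≠ 0) (ht : t ≠ 0) :
    φ t y ≠ y := by
  intro he
  obtain ⟨σ, hσ, hpos, -⟩ := exists_sigma h0
  have hm : StrictMono (fun s => σ * φ s y) := strictMono_of_hasDerivAt_pos
      (f' := fun s => σ * ξ (φ s y)) (fun s => (h.der hy s).const_mul σ) (fun s => h.pos hy hpos s)
  have := hm.injective (a₁ := t) (a₂ := 0) (by simp [he, h.zero hy])
  exact ht this

lemma deriv_pos (h : Fl ξ φ K) {y : ℝ} (hy : y ∈ Ioo (0:ℝ) 1) (h0 : ξ y ≠ 0) (t : ℝ) :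
    0 < deriv (φ t) y := by
  have hd := ((h.smoothAt hy h0 t).differentiableAt (by simp)).hasDerivAt
  have hy' := h.mem' hy t
  have hd' := ((h.smoothAt hy' (h.ne ⟨hy.1.le, hy.2.le⟩ h0 t) (-t)).differentiableAt (by simp)).hasDerivAt
  have hc := hd'.comp y hd
  have he : (φ (-t) ∘ φ t) =ᶠ[𝓝 y] id := by
    filter_upwards [Ioo_mem_nhds hy.1 hy.2] with z hz
    exact h.neg_cancel ⟨hz.1.le, hz.2.le⟩ t
  have h1 := hc.unique ((hasDerivAt_id y).congr_of_eventuallyEq he)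
  have hn : 0 ≤ deriv (φ t) y := by
    have hm : MonotoneOn (φ t) (Ioo 0 1) := fun a ha b hb hab =>
      h.mono ⟨ha.1.le, ha.2.le⟩ ⟨hb.1.le, hb.2.le⟩ hab t
    rw [← derivWithin_of_isOpen isOpen_Ioo hy]
    exact hm.derivWithin_nonneg
  refine lt_of_le_of_ne hn (fun hz => ?_)
  rw [← hz] at h1; simp at h1

lemma disp_lin (h : Fl ξ φ K) {y T t : ℝ} (hy : y ∈ Icc (0:ℝ) 1) (ht : |t| ≤ T) :
    φ t y ≤ (1 + Real.exp (K * T) * K * T) * y := by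
  have h1 := h.disp_le hy t
  have h2 := h.xi_lip hy
  have h3 : Real.exp (K * |t|) * |ξ y| * |t| ≤ Real.exp (K * T) * (K * y) * T := by
    have := h.K0; have := hy.1
    gcongr
  have := le_abs_self (φ t y - y)
  nlinarith

/-- flatness of the flow at the end. -/
lemma flat_flow (h : Fl ξ φ K) (h0 : ∀ x ≤ 0, ξ x = 0) (hs : ContDiffOn ℝ ∞ ξ (Iio 1)) {y0 : ℝ}
    (hy0 : 0 < y0) (hy1 : y0 < 1) (hnz : ∀ x ∈ Ioc 0 y0, ξ x ≠ 0) (t : ℝ) (i : ℕ) :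
    Tendsto (iteratedDeriv i (fun x => φ t x - x)) (𝓝[>] 0) (𝓝 0) := by
  obtain ⟨C, hC, η0, hη0, H⟩ := flowCk i |t| (abs_nonneg t)
  have hz : ∀ j, iteratedDeriv j ξ 0 = 0 := by
    intro j
    have hc : ContinuousAt (iteratedDeriv j ξ) 0 := (cd_cont isOpen_Iio hs j).continuousAt (Iio_mem_nhds (by norm_num))
    have h1 : Tendsto (iteratedDeriv j ξ) (𝓝[<] 0) (𝓝 0) := by
      refine tendsto_const_nhds.congr' ?_
      filter_upwards [self_mem_nhdsWithin] with x (hx : x < 0)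
      have : ξ =ᶠ[𝓝 x] fun _ => 0 := by
        filter_upwards [Iio_mem_nhds hx] with z hz using h0 z (le_of_lt hz)
      rw [this.iteratedDeriv_eq j]
      simp
    exact tendsto_nhds_unique (hc.tendsto.mono_left nhdsWithin_le_nhds) h1
  rw [Metric.tendsto_nhds]
  intro ε hε
  obtain ⟨η, hη, hη1, hη2⟩ : ∃ η, 0 < η ∧ η ≤ η0 ∧ C * η < ε := by
    refine ⟨min η0 (ε / (2 * (C + 1))), by positivity, min_le_left _ _, ?_⟩
    calc C * min η0 (ε / (2 * (C + 1))) ≤ C * (ε / (2 * (C + 1))) := by gcongr; exact min_le_right _ _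
      _ = (C / (C + 1)) * (ε / 2) := by field_simp
      _ ≤ 1 * (ε / 2) := by gcongr; rw [div_le_one (by positivity)]; linarith
      _ < ε := by linarith
  have hev : ∀ᶠ x in 𝓝 (0:ℝ), ∀ j ∈ Finset.range (i+1), |iteratedDeriv j ξ x| < η := by
    rw [Filter.eventually_all_finset]
    intro j _
    have hc : ContinuousAt (iteratedDeriv j ξ) 0 := (cd_cont isOpen_Iio hs j).continuousAt (Iio_mem_nhds (by norm_num))
    have := hc.tendsto
    rw [hz j] at this
    have := (Metric.tendsto_nhds.1 this) η hη
    simpa [Real.dist_eq] using this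
  obtain ⟨ρ, hρ, hb⟩ := Metric.eventually_nhds_iff.1 hev
  set A := 1 + Real.exp (K * |t|) * K * |t| with hA
  have hA1 : 1 ≤ A := by
    have : 0 ≤ Real.exp (K * |t|) * K * |t| := by have := h.K0; positivity
    linarith
  have hmem : Ioo 0 (min y0 (ρ / A)) ∈ 𝓝[>] (0:ℝ) := Ioo_mem_nhdsGT (by positivity)
  filter_upwards [hmem] with y hy
  have hyy : y < y0 := hy.2.trans_le (min_le_left _ _)
  have hyr : y < ρ / A := hy.2.trans_le (min_le_right _ _)
  have hy1' : y ∈ Ioo (0:ℝ) 1 := ⟨hy.1, by linarith⟩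
  have := H ξ φ K h y hy1' (hnz y ⟨hy.1, hyy.le⟩) η hη hη1 (fun j hj s hs => by
    refine (hb (y := φ s y) ?_ j (by simpa using Nat.lt_succ_of_le hj)).le
    rw [Real.dist_eq, sub_zero, abs_of_pos (h.mem' hy1' s).1]
    have h1 := h.disp_lin (T := |t|) ⟨hy.1.le, by linarith [hy1'.2]⟩ hs
    rw [lt_div_iff₀ (by linarith)] at hyr
    linarith) i le_rfl t le_rfl
  rw [Real.dist_eq, sub_zero]
  linarith

end Fl

/-- the data. -/
structure Dat (D : Set ℝ) (α : ℝ) (f g ξ : ℝ → ℝ) (φ : ℝ → ℝ → ℝ) (K : ℝ) : Prop where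
  hD : D ⊆ ({0, 1} : Set ℝ)
  hα : α ≠ 0
  fl : Fl ξ φ K
  f1 : ∀ x ∈ Icc (0:ℝ) 1, f x = φ 1 x
  gα : ∀ x ∈ Icc (0:ℝ) 1, g x = φ α x
  fd : SmoothDiffeoI f
  gd : SmoothDiffeoI g
  fI : ∀ p ∈ Icc (0:ℝ) 1, (ITIat f p ↔ p ∈ D)
  gI : ∀ p ∈ Icc (0:ℝ) 1, (ITIat g p ↔ p ∈ D)

lemma ITIat_congr {f g : ℝ → ℝ} {p : ℝ} (h : f =ᶠ[𝓝 p] g) : ITIat f p ↔ ITIat g p := by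
  have h1 : (fun x => f x - x) =ᶠ[𝓝 p] (fun x => g x - x) := h.mono fun x hx => by simp [hx]
  unfold ITIat
  rw [h.eq_of_nhds]
  simp only [h1.iteratedDeriv_eq]

lemma patch {ξ' : ℝ → ℝ} {φ φ' : ℝ → ℝ → ℝ} {K' : ℝ} (h' : Fl ξ' φ' K')
    {D : Set ℝ} (h0D : (0:ℝ) ∈ D) (hD : D ⊆ ({0, 1} : Set ℝ)) {t : ℝ} (ht : t ≠ 0) {y0 y1 : ℝ}
    (hy1 : 0 < y1) (hy10 : y1 < y0) (hy0 : y0 ≤ 1/2)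
    (h0 : ∀ x ≤ 0, ξ' x = 0) (hs : ContDiffOn ℝ ∞ ξ' (Iio 1)) (hnz : ∀ x ∈ Ioc 0 y0, ξ' x ≠ 0)
    {F : ℝ → ℝ} (hF : SmoothDiffeoI F) (hFφ : ∀ x ∈ Icc (0:ℝ) 1, F x = φ t x)
    (hFI : ∀ p ∈ Icc (0:ℝ) 1, (ITIat F p ↔ p ∈ D))
    (hag : ∀ x ∈ Icc y1 1, φ' t x = φ t x) {k : ℕ} {ε : ℝ} (hε : 0 < ε)
    (h1 : ∀ j ≤ k, ∀ x ∈ Icc 0 y0, |iteratedDeriv j (fun x => F x - x) x| ≤ ε / 2)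
    (h2 : ∀ j ≤ k, ∀ x ∈ Ioc 0 y1, |iteratedDeriv j (fun x => φ' t x - x) x| ≤ ε / 2) :
    ∃ F', SmoothDiffeoI F' ∧ (∀ x ∈ Icc (0:ℝ) 1, F' x = φ' t x) ∧
      (∀ p ∈ Icc (0:ℝ) 1, (ITIat F' p ↔ p ∈ D)) ∧
      ∀ j ≤ k, ∀ x ∈ Icc (0:ℝ) 1, |iteratedDeriv j (fun y => F y - F' y) x| ≤ ε := by
  set G : ℝ → ℝ := fun x => if x ≤ 0 then 0 else if x ≤ y1 then φ' t x - x else F x - x with hG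
  have hGF : ∀ x ≥ y1, G x = F x - x := by
    intro x hx
    simp only [hG, if_neg (show ¬ x ≤ 0 by linarith)]
    split_ifs with hx1
    · have : x = y1 := le_antisymm hx1 hx
      subst this
      rw [hag x ⟨le_rfl, by linarith⟩, hFφ x ⟨by linarith, by linarith⟩]
    · rfl
  have hGφ : ∀ x ∈ Icc (0:ℝ) 1, G x = φ' t x - x := by
    intro x hx
    rcases le_or_gt y1 x with hx1 | hx1
    · rw [hGF x hx1, hFφ x hx, hag x ⟨hx1, hx.2⟩]
    · rcases eq_or_lt_of_le hx.1 with hx0 | hx0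
      · subst hx0; simp [hG, h'.at0]
      · simp [hG, not_le.2 hx0, hx1.le]
  have hevφ : ∀ x ∈ Ioo (0:ℝ) 1, G =ᶠ[𝓝 x] fun x => φ' t x - x := by
    intro x hx
    filter_upwards [Ioo_mem_nhds hx.1 hx.2] with z hz using hGφ z ⟨hz.1.le, hz.2.le⟩
  have hevF : ∀ x > y1, G =ᶠ[𝓝 x] fun x => F x - x := by
    intro x hx
    filter_upwards [Ioi_mem_nhds hx] with z hz using hGF z (le_of_lt hz)
  have hsm : ∀ x ∈ Ioc 0 y0, ContDiffAt ℝ ∞ (φ' t) x := fun x hx =>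
    h'.smoothAt ⟨hx.1, by linarith [hx.2]⟩ (hnz x hx) t
  obtain ⟨hg1, hg2⟩ := glue_zero (G := G) hy1 (fun x hx => by simp [hG, hx]) (fun x hx =>
      (((hsm x ⟨hx.1, by linarith [hx.2]⟩).sub contDiffAt_id).congr_of_eventuallyEq
        (hevφ x ⟨hx.1, by linarith [hx.2]⟩)).contDiffWithinAt) (fun i => by
      refine (h'.flat_flow h0 hs (by linarith) (by linarith) hnz t i).congr' ?_
      filter_upwards [Ioo_mem_nhdsGT (show (0:ℝ) < 1 by norm_num)] with x hx
      exact ((hevφ x hx).iteratedDeriv_eq i).symm)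
  have hGs : ContDiff ℝ ∞ G := by
    rw [contDiff_iff_contDiffAt]
    intro x
    rcases lt_or_ge x y1 with hx | hx
    · exact cd_at isOpen_Iio hg1 hx
    · rcases eq_or_lt_of_le hx with hx' | hx'
      · exact ((hsm x ⟨by linarith, by linarith⟩).sub contDiffAt_id).congr_of_eventuallyEq
          (hevφ x ⟨by linarith, by linarith⟩)
      · exact (hF.1.contDiffAt.sub contDiffAt_id).congr_of_eventuallyEq (hevF x hx')
  have hFG : (fun x => (x + G x) - x) = G := by funext x; ring
  have hiti : ∀ p ∈ Icc (0:ℝ) 1, (ITIat (fun x => x + G x) p ↔ p ∈ D) := by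
    intro p hp
    rcases eq_or_lt_of_le hp.1 with hp0 | hp0
    · subst hp0
      refine iff_of_true ⟨by simp [hG], fun n _ => ?_⟩ h0D
      rw [hFG]; exact hg2 n 0 le_rfl
    · rcases le_or_gt p y1 with hp1 | hp1
      · refine iff_of_false (fun hI => ?_) (fun hI => ?_)
        · have : p + G p = p := hI.1
          rw [hGφ p hp] at this
          exact h'.flow_ne hp (hnz p ⟨hp0, by linarith⟩) ht (by linarith)
        · rcases hD hI with h | h
          · linarith
          · rw [mem_singleton_iff] at h; linarith
      · rw [← hFI p hp]
        exact ITIat_congr ((hevF p hp1).mono fun x hx => by simp [hx])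
  refine ⟨fun x => x + G x, ⟨contDiff_id.add hGs, by simp [hG], ?_, ?_, ?_⟩, ?_, hiti, ?_⟩
  · have := hGF 1 (by linarith)
    simp [this, hF.2.2.1]
  · intro x hx
    rcases eq_or_lt_of_le hx.1 with hx0 | hx0
    · subst hx0
      have h1 := hg2 1 0 le_rfl
      rw [iteratedDeriv_one] at h1
      have : HasDerivAt (fun x => x + G x) (1 + deriv G 0) 0 :=
        (hasDerivAt_id 0).add (hGs.differentiable (by simp) 0).hasDerivAt
      rw [this.deriv, h1]; norm_num
    · rcases le_or_gt x y1 with hx1 | hx1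
      · have : (fun x => x + G x) =ᶠ[𝓝 x] φ' t :=
          (hevφ x ⟨hx0, by linarith⟩).mono fun z hz => by simp [hz]
        rw [this.deriv_eq]
        exact h'.deriv_pos ⟨hx0, by linarith⟩ (hnz x ⟨hx0, by linarith⟩) t
      · have : (fun x => x + G x) =ᶠ[𝓝 x] F := (hevF x hx1).mono fun z hz => by simp [hz]
        rw [this.deriv_eq]
        exact hF.2.2.2.1 x hx
  · intro x hx
    have : x + G x = φ' t x := by rw [hGφ x hx]; ring
    simpa [this] using h'.mem hx t
  · intro x hx
    simp [hGφ x hx]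
  · intro j hj x hx
    have he : (fun y => F y - (y + G y)) = fun y => (F y - y) - G y := by funext y; ring
    rw [he, iteratedDeriv_fun_sub (f := fun y => F y - y) (((hF.1.sub contDiff_id).contDiffAt).of_le (by exact_mod_cast le_top))
      (hGs.contDiffAt.of_le (by exact_mod_cast le_top))]
    rcases eq_or_lt_of_le hx.1 with hx0 | hx0
    · subst hx0
      rw [hg2 j 0 le_rfl, sub_zero]
      have := h1 j hj 0 ⟨le_rfl, by linarith⟩
      linarith
    · rcases le_or_gt x y1 with hx1 | hx1
      · rw [(hevφ x ⟨hx0, by linarith⟩).iteratedDeriv_eq j]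
        have a1 := h1 j hj x ⟨hx0.le, by linarith⟩
        have a2 := h2 j hj x ⟨hx0, hx1⟩
        refine (abs_sub _ _).trans ?_
        linarith
      · rw [(hevF x hx1).iteratedDeriv_eq j]
        simpa using hε.le

lemma iti_of_eq_id {f : ℝ → ℝ} {p : ℝ} (h : f =ᶠ[𝓝 p] fun x => x) : ITIat f p := by
  rw [ITIat_congr h]
  refine ⟨rfl, fun n _ => ?_⟩
  simp

lemma small_near {F : ℝ → ℝ} (hF : ContDiff ℝ ∞ F) (hI : ITIat F 0) (k : ℕ) {ε : ℝ} (hε : 0 < ε) :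
    ∃ r > 0, ∀ j ≤ k, ∀ x ∈ Icc 0 r, |iteratedDeriv j (fun x => F x - x) x| ≤ ε := by
  have hu : ContDiff ℝ ∞ (fun x => F x - x) := hF.sub contDiff_id
  have hev : ∀ᶠ x in 𝓝 (0:ℝ), ∀ j ∈ Finset.range (k+1), |iteratedDeriv j (fun x => F x - x) x| < ε := by
    rw [Filter.eventually_all_finset]
    intro j _
    have hc : ContinuousAt (iteratedDeriv j (fun x => F x - x)) 0 :=
      (cd_cont isOpen_univ hu.contDiffOn j).continuousAt univ_mem
    have := hc.tendsto
    rw [iti_iter hI j] at this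
    have := (Metric.tendsto_nhds.1 this) ε hε
    simpa [Real.dist_eq] using this
  obtain ⟨ρ, hρ, hb⟩ := Metric.eventually_nhds_iff.1 hev
  refine ⟨ρ / 2, by positivity, fun j hj x hx => (hb (y := x) ?_ j (by simpa using Nat.lt_succ_of_le hj)).le⟩
  rw [Real.dist_eq, sub_zero, abs_of_nonneg hx.1]; linarith [hx.2]

lemma Dat.nz {D : Set ℝ} {α : ℝ} {f g ξ : ℝ → ℝ} {φ : ℝ → ℝ → ℝ} {K : ℝ}
    (d : Dat D α f g ξ φ K) : ∀ r > 0, ∃ x ∈ Ioo 0 r, ξ x ≠ 0 := by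
  intro r hr
  by_contra! hc
  set p := min r 1 / 2 with hp
  have hm : 0 < min r 1 := by positivity
  have hpr : p < r := by have := min_le_left r 1; linarith
  have hp1 : p < 1 := by have := min_le_right r 1; linarith
  have hp0 : 0 < p := by positivity
  have : ITIat f p := by
    apply iti_of_eq_id
    filter_upwards [Ioo_mem_nhds hp0 hpr, Ioo_mem_nhds hp0 hp1] with x hx hx1
    rw [d.f1 x ⟨hx1.1.le, hx1.2.le⟩, d.fl.fixed ⟨hx1.1.le, hx1.2.le⟩ (hc x hx)]
  rw [d.fI p ⟨hp0.le, hp1.le⟩] at this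
  rcases d.hD this with h | h
  · linarith
  · rw [mem_singleton_iff] at h; linarith

lemma end_flat {D : Set ℝ} {α : ℝ} {f g ξ : ℝ → ℝ} {φ : ℝ → ℝ → ℝ} {K : ℝ}
    (d : Dat D α f g ξ φ K) (h0 : (0:ℝ) ∈ D) (k : ℕ) {ε : ℝ} (hε : 0 < ε) :
    ∃ f' g' ξ' φ' K', Dat D α f' g' ξ' φ' K' ∧
      (∀ j ≤ k, ∀ x ∈ Icc (0:ℝ) 1, |iteratedDeriv j (fun y => f y - f' y) x| ≤ ε) ∧
      (∀ j ≤ k, ∀ x ∈ Icc (0:ℝ) 1, |iteratedDeriv j (fun y => g y - g' y) x| ≤ ε) ∧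
      (∀ x ≥ 1/2, ξ' x = ξ x) ∧ ∃ ρ > 0, ContDiffOn ℝ ∞ ξ' (Ioo (-ρ) 1) := by
  set T := max 1 |α| with hT
  have hT1 : 1 ≤ T := le_max_left _ _
  have hTα : |α| ≤ T := le_max_right _ _
  have hT0 : 0 < T := by linarith
  obtain ⟨C, hC, η0, hη0, H⟩ := Fl.flowCk k T hT0.le
  have hfI := (d.fI 0 (by simp)).2 h0
  have hgI := (d.gI 0 (by simp)).2 h0
  obtain ⟨r1, hr1, Hr1⟩ := small_near d.fd.1 hfI k (half_pos hε)
  obtain ⟨r2, hr2, Hr2⟩ := small_near d.gd.1 hgI k (half_pos hε)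
  obtain ⟨η, hη, hη1, hη2⟩ : ∃ η, 0 < η ∧ η ≤ η0 ∧ C * η ≤ ε / 2 := by
    refine ⟨min η0 (ε / (2 * (C + 1))), by positivity, min_le_left _ _, ?_⟩
    calc C * min η0 (ε / (2 * (C + 1))) ≤ C * (ε / (2 * (C + 1))) := by gcongr; exact min_le_right _ _
      _ = (C / (C + 1)) * (ε / 2) := by field_simp
      _ ≤ 1 * (ε / 2) := by gcongr; rw [div_le_one (by positivity)]; linarith
      _ = ε / 2 := by ring
  obtain ⟨ξ', φ', K', δ, y1, y0, hδ, hδy, hy10, hyr, hy0, h', he, hz, hs, hnz, hb, hst, hs1⟩ :=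
    d.fl.modify d.fd hfI d.f1 d.nz k hη hT0.le (lt_min hr1 hr2)
  have hag : ∀ x ∈ Icc y1 1, ∀ t, |t| ≤ T → φ' t x = φ t x := fun x hx =>
    d.fl.agree h' hT0 he ⟨by linarith [hx.1], hx.2⟩ (hst x hx)
  have hsmall : ∀ t, |t| ≤ T → ∀ j ≤ k, ∀ x ∈ Ioc 0 y1, |iteratedDeriv j (fun x => φ' t x - x) x| ≤ ε / 2 := by
    intro t ht j hj x hx
    have hx1 : x ∈ Ioo (0:ℝ) 1 := ⟨hx.1, by linarith [hx.2]⟩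
    refine (H ξ' φ' K' h' x hx1 (hnz x ⟨hx.1, by linarith [hx.2]⟩) η hη hη1 (fun i hi s hs => ?_) j hj t ht).trans hη2
    refine hb i hi _ ⟨(h'.mem' hx1 s).1, ?_⟩
    have hy1m : y1 ∈ Icc (0:ℝ) 1 := ⟨by linarith, by linarith⟩
    have := h'.mono ⟨hx1.1.le, hx1.2.le⟩ hy1m hx.2 s
    rw [hag y1 ⟨le_rfl, by linarith⟩ s hs] at this
    linarith [hs1 s hs]
  obtain ⟨f', hf1, hf2, hf3, hf4⟩ := patch (φ := φ) h' h0 d.hD one_ne_zero (by linarith) hy10 hy0 hz hs hnz d.fd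
    d.f1 d.fI (fun x hx => hag x hx 1 (by simpa using hT1)) hε
    (fun j hj x hx => Hr1 j hj x ⟨hx.1, hx.2.trans (hyr.trans (min_le_left _ _))⟩) (hsmall 1 (by simpa using hT1))
  obtain ⟨g', hg1, hg2, hg3, hg4⟩ := patch (φ := φ) h' h0 d.hD d.hα (by linarith) hy10 hy0 hz hs hnz d.gd
    d.gα d.gI (fun x hx => hag x hx α hTα) hε
    (fun j hj x hx => Hr2 j hj x ⟨hx.1, hx.2.trans (hyr.trans (min_le_right _ _))⟩) (hsmall α hTα)
  exact ⟨f', g', ξ', φ', K', ⟨d.hD, d.hα, h', hf2, hg2, hf1, hg1, hf3, hg3⟩, hf4, hg4,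
    fun x hx => he x (by linarith), 1, one_pos, hs.mono fun x hx => hx.2⟩

end Aux
end

section
open Set Filter Topology
open scoped ContDiff
namespace Aux

lemma par_deriv {g : ℝ → ℝ} (hg : ContDiff ℝ ∞ g) (n : ℕ) (x : ℝ) :
    HasDerivAt (fun x => ∫ t in (0:ℝ)..1, t ^ n * g (t * x))
      (∫ t in (0:ℝ)..1, t ^ (n + 1) * deriv g (t * x)) x := by
  have hdg : ContDiff ℝ ∞ (deriv g) := (contDiff_infty_iff_deriv.1 hg).2
  have hgc := hg.continuous
  have hdc := hdg.continuous
  obtain ⟨M, hM1, hM⟩ := bound_on_compact hdg 0 (-(|x| + 1)) (|x| + 1)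
  refine (intervalIntegral.hasDerivAt_integral_of_dominated_loc_of_deriv_le (s := Metric.ball x 1)
    (F := fun x t => t ^ n * g (t * x)) (F' := fun x t => t ^ (n + 1) * deriv g (t * x))
    (bound := fun _ => M)
    (Metric.ball_mem_nhds x one_pos) (Eventually.of_forall fun y => ?_) ?_ ?_ ?_ ?_ ?_).2
  · exact (by fun_prop : Continuous fun t => t ^ n * g (t * y)).aestronglyMeasurable
  · exact (by fun_prop : Continuous fun t => t ^ n * g (t * x)).intervalIntegrable _ _
  · exact (by fun_prop : Continuous fun t => t ^ (n+1) * deriv g (t * x)).aestronglyMeasurable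
  · refine Eventually.of_forall fun t ht y hy => ?_
    rw [uIoc_of_le zero_le_one] at ht
    have h1 : |y| ≤ |x| + 1 := by
      rw [Metric.mem_ball, Real.dist_eq] at hy
      have := abs_sub_abs_le_abs_sub y x
      linarith
    have h2 : |t * y| ≤ |x| + 1 := by
      rw [abs_mul, abs_of_pos ht.1]
      nlinarith [ht.2, abs_nonneg y, ht.1]
    have h3 := hM 0 le_rfl (t * y) (abs_le.1 h2)
    rw [iteratedDeriv_zero] at h3
    rw [Real.norm_eq_abs, abs_mul, abs_of_nonneg (pow_nonneg ht.1.le _)]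
    calc t ^ (n+1) * |deriv g (t * y)| ≤ 1 * M := by
          gcongr
          exact pow_le_one₀ ht.1.le ht.2
      _ = M := one_mul M
  · exact _root_.intervalIntegrable_const
  · refine Eventually.of_forall fun t ht y hy => ?_
    have h1 : HasDerivAt g (deriv g (t * y)) (t * y) := (hg.differentiable (by simp) _).hasDerivAt
    have h2 : HasDerivAt (fun y => t * y) t y := by simpa using (hasDerivAt_id y).const_mul t
    have := (h1.comp y h2).const_mul (t ^ n)
    refine this.congr_deriv ?_
    ring

lemma par_iter {g : ℝ → ℝ} (hg : ContDiff ℝ ∞ g) (m : ℕ) :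
    iteratedDeriv m (fun x => ∫ t in (0:ℝ)..1, g (t * x)) =
      fun x => ∫ t in (0:ℝ)..1, t ^ m * iteratedDeriv m g (t * x) := by
  induction m with
  | zero => simp
  | succ m ih =>
    rw [iteratedDeriv_succ, ih]
    funext x
    have hm : ContDiff ℝ ∞ (iteratedDeriv m g) := by
      rw [← contDiffOn_univ]; exact cd_iter isOpen_univ hg.contDiffOn m
    rw [(par_deriv hm m x).deriv, iteratedDeriv_succ]

/-- Hadamard division. -/
lemma had {G : ℝ → ℝ} (hG : ContDiff ℝ ∞ G) (h0 : G 0 = 0) :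
    ∃ H : ℝ → ℝ, ContDiff ℝ ∞ H ∧ ∀ x, G x = x * H x := by
  have hdg : ContDiff ℝ ∞ (deriv G) := (contDiff_infty_iff_deriv.1 hG).2
  refine ⟨fun x => ∫ t in (0:ℝ)..1, deriv G (t * x), ?_, fun x => ?_⟩
  · refine contDiff_of_differentiable_iteratedDeriv (n := ⊤) fun m _ => ?_
    rw [par_iter hdg m]
    have hm : ContDiff ℝ ∞ (iteratedDeriv m (deriv G)) := by
      rw [← contDiffOn_univ]; exact cd_iter isOpen_univ hdg.contDiffOn m
    exact fun x => (par_deriv hm m x).differentiableAt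
  · have h1 : ∀ t ∈ uIcc (0:ℝ) 1, HasDerivAt (fun t => G (t * x)) (x * deriv G (t * x)) t := by
      intro t _
      have h1 : HasDerivAt G (deriv G (t * x)) (t * x) := (hG.differentiable (by simp) _).hasDerivAt
      have h2 : HasDerivAt (fun t => t * x) x t := by simpa using (hasDerivAt_id t).mul_const x
      refine (h1.comp t h2).congr_deriv (by ring)
    have hc := hdg.continuous
    have := intervalIntegral.integral_eq_sub_of_hasDerivAt h1
      ((by fun_prop : Continuous fun t => x * deriv G (t * x)).intervalIntegrable _ _)
    rw [intervalIntegral.integral_const_mul] at this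
    rw [this, one_mul, zero_mul, h0, sub_zero]

lemma div_of_O (n : ℕ) : ∀ {G : ℝ → ℝ}, ContDiff ℝ ∞ G → ∀ {C r : ℝ}, 0 < r →
    (∀ x ∈ Ioo 0 r, |G x| ≤ C * x ^ n) →
    ∃ H : ℝ → ℝ, ContDiff ℝ ∞ H ∧ ∀ x, G x = x ^ n * H x := by
  induction n with
  | zero => intro G hG C r hr h; exact ⟨G, hG, by simp⟩
  | succ n ih =>
    intro G hG C r hr h
    have h0 : G 0 = 0 := by
      have h1 : Tendsto (fun x => |G x|) (𝓝[>] 0) (𝓝 |G 0|) :=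
        ((hG.continuous.abs).tendsto 0).mono_left nhdsWithin_le_nhds
      have h2 : Tendsto (fun x : ℝ => C * x ^ (n+1)) (𝓝[>] 0) (𝓝 0) := by
        have : Tendsto (fun x : ℝ => C * x ^ (n+1)) (𝓝 0) (𝓝 (C * 0 ^ (n+1))) :=
          (by fun_prop : Continuous (fun x : ℝ => C * x ^ (n+1))).tendsto 0
        simp at this
        exact this.mono_left nhdsWithin_le_nhds
      have := le_of_tendsto_of_tendsto h1 h2 (by
        filter_upwards [Ioo_mem_nhdsGT hr] with x hx using h x hx)
      exact abs_eq_zero.1 (le_antisymm this (abs_nonneg _))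
    obtain ⟨H, hH, he⟩ := had hG h0
    obtain ⟨H', hH', he'⟩ := ih hH hr (C := C) (fun x hx => by
      have := h x hx
      rw [he, abs_mul, abs_of_pos hx.1, pow_succ] at this
      have hx0 := hx.1
      by_contra! hc
      nlinarith)
    refine ⟨H', hH', fun x => ?_⟩
    rw [he, he', pow_succ]; ring

lemma mul_id_iter {H : ℝ → ℝ} (hH : ContDiff ℝ ∞ H) (n : ℕ) :
    iteratedDeriv (n + 1) (fun x => x * H x) =
      fun x => x * iteratedDeriv (n + 1) H x + (n + 1) * iteratedDeriv n H x := by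
  have hd : ∀ m x, HasDerivAt (iteratedDeriv m H) (iteratedDeriv (m+1) H x) x := fun m x =>
    cd_hasDeriv isOpen_univ hH.contDiffOn m (mem_univ x)
  induction n with
  | zero =>
    funext x
    rw [zero_add, iteratedDeriv_one]
    have := ((hasDerivAt_id x).mul (hd 0 x)).deriv
    simp only [id, iteratedDeriv_zero] at this
    refine Eq.trans this ?_
    simp; ring
  | succ n ih =>
    funext x
    rw [iteratedDeriv_succ, ih]
    have := (((hasDerivAt_id x).mul (hd (n+1) x)).add ((hd n x).const_mul ((n:ℝ)+1))).deriv
    refine Eq.trans this ?_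
    simp; ring

lemma order_exists (N : ℕ) : ∀ {G : ℝ → ℝ}, ContDiff ℝ ∞ G → iteratedDeriv N G 0 ≠ 0 →
    ∃ (m : ℕ) (v : ℝ → ℝ), ContDiff ℝ ∞ v ∧ v 0 ≠ 0 ∧ ∀ x, G x = x ^ m * v x := by
  induction N with
  | zero =>
    intro G hG h
    exact ⟨0, G, hG, by simpa using h, by simp⟩
  | succ N ih =>
    intro G hG h
    by_cases h0 : G 0 = 0
    · obtain ⟨H, hH, he⟩ := had hG h0
      have he' : G = fun x => x * H x := funext he
      obtain ⟨m, v, hv, hv0, hm⟩ := ih hH (by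
        rw [he', mul_id_iter hH] at h
        intro hc
        simp [hc] at h)
      exact ⟨m + 1, v, hv, hv0, fun x => by rw [he, hm, pow_succ]; ring⟩
    · exact ⟨0, G, hG, h0, by simp⟩

/-- the cutoff used in the Borel construction. -/
lemma exists_cut : ∃ χ : ℝ → ℝ, ContDiff ℝ ∞ χ ∧ (∀ x, |x| ≤ 1 → χ x = 1) ∧
    (∀ x, 2 ≤ |x| → χ x = 0) := by
  let b : ContDiffBump (0:ℝ) := ⟨1, 2, one_pos, by norm_num⟩
  refine ⟨b, b.contDiff, fun x hx => b.one_of_mem_closedBall (by simpa [Real.dist_eq] using hx), fun x hx =>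
    b.zero_of_le_dist (by simpa [Real.dist_eq] using hx)⟩

lemma cut_bound {u : ℝ → ℝ} (hu : ContDiff ℝ ∞ u) (h0 : ∀ x, 2 ≤ |x| → u x = 0) (k : ℕ) :
    ∃ M ≥ 1, ∀ j ≤ k, ∀ x, |iteratedDeriv j u x| ≤ M := by
  obtain ⟨M, hM, hb⟩ := bound_on_compact hu k (-3) 3
  refine ⟨M, hM, fun j hj x => ?_⟩
  by_cases hx : x ∈ Icc (-3:ℝ) 3
  · exact hb j hj x hx
  · have hx' : 3 < |x| := by
      by_contra! hc; exact hx (abs_le.1 hc)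
    have : u =ᶠ[𝓝 x] fun _ => 0 := by
      filter_upwards [(isOpen_lt continuous_const continuous_abs).mem_nhds hx'] with z hz
      exact h0 z (by have : (3:ℝ) < |z| := hz; linarith)
    rw [this.iteratedDeriv_eq]
    simp; linarith

/-- Borel lemma in divisibility form. -/
lemma borel (a : ℕ → ℝ) : ∃ θ : ℝ → ℝ, ContDiff ℝ ∞ θ ∧ ∀ N : ℕ, ∃ H : ℝ → ℝ, ContDiff ℝ ∞ H ∧
    ∀ x, θ x = ∑ i ∈ Finset.range N, a i * x ^ i + x ^ N * H x := by
  obtain ⟨χ, hχ, hχ1, hχ0⟩ := exists_cut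
  have hψ : ∀ i : ℕ, ContDiff ℝ ∞ (fun y => y ^ i * χ y) := fun i => (contDiff_id.pow i).mul hχ
  have hψb : ∀ i j : ℕ, ∃ M ≥ 1, ∀ k ≤ j, ∀ x, |iteratedDeriv k (fun y => y ^ i * χ y) x| ≤ M := fun i j =>
    cut_bound (hψ i) (fun x hx => by simp [hχ0 x hx]) j
  choose M hM1 hM using hψb
  set Mx : ℕ → ℝ := fun j => ∑ i ∈ Finset.range (j+1), M i j with hMx
  have hMx1 : ∀ i j, i ≤ j → M i j ≤ Mx j := fun i j hij =>
    Finset.single_le_sum (f := fun i => M i j) (fun i _ => by linarith [hM1 i j])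
      (Finset.mem_range.2 (Nat.lt_succ_of_le hij))
  have hMx0 : ∀ j, 1 ≤ Mx j := fun j => (hM1 0 j).trans (hMx1 0 j (Nat.zero_le _))
  set r : ℕ → ℝ := fun j => (1/2) ^ j / ((|a j| + 1) * Mx j) with hr
  have hden : ∀ j, 1 ≤ (|a j| + 1) * Mx j := fun j =>
    one_le_mul_of_one_le_of_one_le (by linarith [abs_nonneg (a j)]) (hMx0 j)
  have hr0 : ∀ j, 0 < r j := fun j => div_pos (by positivity) (by linarith [hden j])
  have hr1 : ∀ j, r j ≤ 1 := fun j => by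
    rw [hr]; simp only
    rw [div_le_one (by linarith [hden j])]
    exact (pow_le_one₀ (by norm_num) (by norm_num)).trans (hden j)
  have hra : ∀ j, |a j| * Mx j * r j ≤ (1/2) ^ j := fun j => by
    have h1 : |a j| * Mx j ≤ (|a j| + 1) * Mx j := by nlinarith [hMx0 j]
    calc |a j| * Mx j * r j ≤ (|a j| + 1) * Mx j * r j := by have := hr0 j; gcongr
      _ = (1/2)^j := by rw [hr]; simp only; rw [mul_div_cancel₀]; linarith [hden j]
  clear_value r
  -- general term
  have hterm : ∀ (i j : ℕ) (x : ℝ), a j * x ^ i * χ (x / r j) =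
      (a j * r j ^ i) * ((fun y => y ^ i * χ y) ((r j)⁻¹ * x)) := by
    intro i j x
    have := (hr0 j).ne'
    simp only
    rw [← div_eq_inv_mul, div_pow, mul_assoc, mul_assoc, ← mul_assoc (r j ^ i),
      mul_div_cancel₀ _ (pow_ne_zero i this)]
  have hbd : ∀ (i j k : ℕ), i ≤ j → k < i → ∀ x,
      |iteratedDeriv k (fun x => a j * x ^ i * χ (x / r j)) x| ≤ (1/2) ^ j := by
    intro i j k hij hki x
    simp only [hterm i j]
    rw [iteratedDeriv_const_mul_field, iteratedDeriv_comp_const_mul ((hψ i).of_le (by exact_mod_cast le_top))]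
    have hb := hM i j k (by omega) ((r j)⁻¹ * x)
    have h0 := hr0 j
    rw [abs_mul, abs_mul, abs_mul, abs_of_pos (show 0 < r j ^ i by positivity), abs_of_pos (show 0 < (r j)⁻¹ ^ k by positivity)]
    have hrr : r j ^ i * (r j)⁻¹ ^ k ≤ r j := by
      obtain ⟨l, rfl⟩ : ∃ l, i = k + 1 + l := ⟨i - (k+1), by omega⟩
      have : r j ^ (k + 1 + l) * (r j)⁻¹ ^ k = r j * r j ^ l := by
        rw [inv_pow, pow_add, pow_succ]; field_simp
      rw [this]
      have := pow_le_one₀ (n := l) h0.le (hr1 j)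
      nlinarith
    calc |a j| * r j ^ i * ((r j)⁻¹ ^ k * |iteratedDeriv k (fun y => y ^ i * χ y) ((r j)⁻¹ * x)|)
        = |a j| * |iteratedDeriv k (fun y => y ^ i * χ y) ((r j)⁻¹ * x)| * (r j ^ i * (r j)⁻¹ ^ k) := by ring
      _ ≤ |a j| * Mx j * r j := by
          have hb' := hb.trans (hMx1 i j hij)
          have h5 : 0 ≤ |a j| * Mx j := mul_nonneg (abs_nonneg _) (by linarith [hMx0 j])
          have h6 : 0 ≤ r j ^ i * (r j)⁻¹ ^ k := by positivity
          exact mul_le_mul (mul_le_mul_of_nonneg_left hb' (abs_nonneg _)) hrr h6 h5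
      _ ≤ _ := hra j
  have hcd : ∀ i j, ContDiff ℝ ∞ (fun x => a j * x ^ i * χ (x / r j)) := fun i j =>
    (contDiff_const.mul (contDiff_id.pow i)).mul (hχ.comp (contDiff_id.div_const _))
  have hsum : ∀ N : ℕ, Summable (fun i : ℕ => ((1:ℝ)/2) ^ (i + N)) := fun N => by
    simp_rw [pow_add]
    exact (summable_geometric_of_lt_one (by norm_num) (by norm_num)).mul_right _
  have hT : ∀ N : ℕ, ContDiff ℝ ∞ (fun x => ∑' i : ℕ, a (i + N) * x ^ i * χ (x / r (i + N))) := by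
    intro N
    refine contDiff_tsum_of_eventually (N := ⊤) (v := fun _ i => (1/2) ^ (i + N)) (fun i => hcd i (i + N))
      (fun k _ => hsum N) (fun k _ => ?_)
    rw [Nat.cofinite_eq_atTop]
    filter_upwards [eventually_gt_atTop k] with i hi x
    rw [norm_iteratedFDeriv_eq_norm_iteratedDeriv, Real.norm_eq_abs]
    exact hbd i (i + N) k (by omega) hi x
  have hS : ∀ x, Summable (fun i : ℕ => a i * x ^ i * χ (x / r i)) := by
    intro x
    refine Summable.of_norm_bounded_eventually_nat (g := fun i => ((1:ℝ)/2) ^ i) (by simpa using hsum 0) ?_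
    filter_upwards [eventually_gt_atTop 0] with i hi
    simpa using hbd i i 0 le_rfl hi x
  refine ⟨fun x => ∑' i : ℕ, a i * x ^ i * χ (x / r i), by simpa using hT 0, fun N => ?_⟩
  have hpc : ContDiff ℝ ∞ (fun x => ∑ i ∈ Finset.range N, (a i * x ^ i * χ (x / r i) - a i * x ^ i)) :=
    ContDiff.sum fun i _ => (hcd i i).sub (contDiff_const.mul (contDiff_id.pow i))
  obtain ⟨ρ, hρ, hρi⟩ : ∃ ρ > 0, ∀ i ∈ Finset.range N, ρ ≤ r i := by
    rcases (Finset.range N).eq_empty_or_nonempty with h | h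
    · exact ⟨1, one_pos, by simp [h]⟩
    · obtain ⟨i0, _, hi0⟩ := Finset.exists_min_image _ r h
      exact ⟨r i0, hr0 i0, hi0⟩
  obtain ⟨H, hH, he⟩ := div_of_O N hpc (C := 0) hρ (fun x hx => by
    rw [Finset.sum_eq_zero]
    · simp
    · intro i hi
      rw [hχ1, mul_one, sub_self]
      rw [abs_of_pos (div_pos hx.1 (hr0 i)), div_le_one (hr0 i)]
      linarith [hρi i hi, hx.2])
  refine ⟨fun x => H x + ∑' i : ℕ, a (i + N) * x ^ i * χ (x / r (i + N)), hH.add (hT N), fun x => ?_⟩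
  simp only
  rw [← (hS x).sum_add_tsum_nat_add N, mul_add, ← he x, ← tsum_mul_left, Finset.sum_sub_distrib]
  have : ∀ i, a (i + N) * x ^ (i + N) * χ (x / r (i + N)) = x ^ N * (a (i + N) * x ^ i * χ (x / r (i + N))) := by
    intro i; ring
  simp only [this]
  ring

end Aux
end

section
open Set Filter Topology
open scoped ContDiff
namespace Aux

lemma formal {f v ℓ ℓ1 : ℝ → ℝ} {p : ℕ} (hf : ContDiff ℝ ∞ f) (hv : ContDiff ℝ ∞ v)
    (hfv : ∀ x, f x = x * (1 + x ^ p * v x)) (hv0 : v 0 ≠ 0) (hu0 : 0 < 1 + (0:ℝ) ^ p * v 0)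
    (hℓ1 : ContDiff ℝ ∞ ℓ1) (hℓ : ∀ x, ℓ x = x ^ (p + 1) * ℓ1 x) :
    ∃ θ : ℝ → ℝ, ContDiff ℝ ∞ θ ∧ ∀ N : ℕ, ∃ H : ℝ → ℝ, ContDiff ℝ ∞ H ∧
      ∀ x, ℓ x + θ x - θ (f x) = x ^ N * H x := by
  set u : ℝ → ℝ := fun x => 1 + x ^ p * v x with hu
  have hus : ContDiff ℝ ∞ u := contDiff_const.add ((contDiff_id.pow p).mul hv)
  set z : ℕ → ℝ → ℝ := fun n x => v x * ∑ j ∈ Finset.range n, u x ^ j with hz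
  have hzs : ∀ n, ContDiff ℝ ∞ (z n) := fun n =>
    hv.mul (ContDiff.sum fun j _ => hus.pow j)
  have hz0 : ∀ n, z (n + 1) 0 ≠ 0 := by
    intro n
    refine mul_ne_zero hv0 (ne_of_gt ?_)
    exact Finset.sum_pos (fun j _ => pow_pos hu0 j) (by simp)
  have hzu : ∀ n x, u x ^ n - 1 = x ^ p * z n x := by
    intro n x
    have := geom_sum_mul (u x) n
    rw [← this, hz]; simp only [hu]; ring
  have step : ∀ (i : ℕ) (H : {H : ℝ → ℝ // ContDiff ℝ ∞ H}), ∃ q : ℝ × {H : ℝ → ℝ // ContDiff ℝ ∞ H},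
      ∀ x, H.1 x - q.1 * z (i + 1) x = x * q.2.1 x := by
    intro i H
    obtain ⟨H', hH', he⟩ := had (G := fun x => H.1 x - H.1 0 / z (i + 1) 0 * z (i + 1) x)
      (H.2.sub (contDiff_const.mul (hzs _))) (by rw [div_mul_cancel₀ _ (hz0 i), sub_self])
    exact ⟨⟨H.1 0 / z (i + 1) 0, ⟨H', hH'⟩⟩, he⟩
  choose q hq using step
  set Hs : ℕ → {H : ℝ → ℝ // ContDiff ℝ ∞ H} := fun n => Nat.rec ⟨ℓ1, hℓ1⟩ (fun i H => (q i H).2) n with hHs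
  set b : ℕ → ℝ := fun i => (q i (Hs i)).1 with hb
  have hrec : ∀ i x, (Hs i).1 x - b i * z (i + 1) x = x * (Hs (i + 1)).1 x := fun i x => hq i (Hs i) x
  have hind : ∀ N x, ℓ x + ∑ i ∈ Finset.range N, b i * x ^ (i + 1) -
      ∑ i ∈ Finset.range N, b i * f x ^ (i + 1) = x ^ (p + 1 + N) * (Hs N).1 x := by
    intro N x
    induction N with
    | zero => simp [hℓ, hHs]
    | succ N ih =>
      rw [Finset.sum_range_succ, Finset.sum_range_succ]
      have h1 : f x ^ (N + 1) = x ^ (N + 1) * (1 + x ^ p * z (N + 1) x) := by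
        rw [hfv, mul_pow, ← hzu]; ring
      have h2 := hrec N x
      calc _ = (ℓ x + ∑ i ∈ Finset.range N, b i * x ^ (i + 1) -
            ∑ i ∈ Finset.range N, b i * f x ^ (i + 1)) + b N * (x ^ (N + 1) - f x ^ (N + 1)) := by ring
        _ = x ^ (p + 1 + N) * ((Hs N).1 x - b N * z (N + 1) x) := by rw [ih, h1]; ring
        _ = _ := by rw [h2]; ring
  obtain ⟨θ, hθ, hB⟩ := borel (fun i => if i = 0 then 0 else b (i - 1))
  refine ⟨θ, hθ, fun N => ?_⟩
  obtain ⟨G, hG, he⟩ := hB (N + 1)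
  refine ⟨fun x => x ^ (p + 1) * (Hs N).1 x + x * (G x - u x ^ (N + 1) * G (f x)),
    ((contDiff_id.pow _).mul (Hs N).2).add (contDiff_id.mul (hG.sub ((hus.pow _).mul (hG.comp hf)))), fun x => ?_⟩
  have h3 : ∀ y, θ y = ∑ i ∈ Finset.range N, b i * y ^ (i + 1) + y ^ (N + 1) * G y := by
    intro y
    rw [he y, Finset.sum_range_succ']
    simp
  have h4 : f x ^ (N + 1) = x ^ (N + 1) * u x ^ (N + 1) := by rw [hfv, mul_pow]
  rw [h3 x, h3 (f x), h4]
  have := hind N x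
  calc _ = (ℓ x + ∑ i ∈ Finset.range N, b i * x ^ (i + 1) -
            ∑ i ∈ Finset.range N, b i * f x ^ (i + 1)) + x ^ (N + 1) * (G x - u x ^ (N + 1) * G (f x)) := by ring
    _ = _ := by rw [this]; ring

lemma extend_loc {g : ℝ → ℝ} {r : ℝ} (hr : 0 < r) (hg : ContDiffOn ℝ ∞ g (Ioo (-r) r)) :
    ∃ G : ℝ → ℝ, ContDiff ℝ ∞ G ∧ ∀ x ∈ Ioo (-(r/4)) (r/4), G x = g x := by
  obtain ⟨χ, hχ, hχ1, hχ0⟩ := exists_cut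
  refine ⟨fun x => χ (x * (4 / r)) * g x, ?_, fun x hx => ?_⟩
  · rw [contDiff_iff_contDiffAt]
    intro x
    have hc : ContDiff ℝ ∞ (fun x => χ (x * (4 / r))) := hχ.comp (contDiff_id.mul contDiff_const)
    by_cases hx : x ∈ Ioo (-r) r
    · exact hc.contDiffAt.mul (cd_at isOpen_Ioo hg hx)
    · have hx' : r / 2 < |x| := by
        by_contra! hle
        rw [abs_le] at hle
        exact hx ⟨by linarith, by linarith⟩
      have : (fun x => χ (x * (4 / r)) * g x) =ᶠ[𝓝 x] fun _ => 0 := by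
        filter_upwards [(isOpen_lt continuous_const continuous_abs).mem_nhds hx'] with y hy
        have hy' : r / 2 < |y| := hy
        rw [hχ0, zero_mul]
        rw [abs_mul, abs_of_pos (by positivity : 0 < 4 / r), mul_div_assoc', le_div_iff₀ hr]
        linarith
      exact contDiffAt_const.congr_of_eventuallyEq this
  · simp only
    rw [hχ1, one_mul]
    rw [abs_mul, abs_of_pos (by positivity : 0 < 4 / r), mul_div_assoc', div_le_one hr]
    have := abs_lt.2 hx
    linarith

lemma ell_exists {f v : ℝ → ℝ} {p : ℕ} (hf : ContDiff ℝ ∞ f) (hv : ContDiff ℝ ∞ v)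
    (hfv : ∀ x, f x = x * (1 + x ^ p * v x)) (hu0 : 0 < 1 + (0:ℝ) ^ p * v 0) :
    ∃ ℓ ℓ1 : ℝ → ℝ, ContDiff ℝ ∞ ℓ ∧ ContDiff ℝ ∞ ℓ1 ∧ (∀ x, ℓ x = x ^ (p + 1) * ℓ1 x) ∧
      ∃ r > 0, ∀ x ∈ Ioo (-r) r, 0 < 1 + x ^ p * v x ∧ 0 < deriv f x ∧
        ℓ x = Real.log (deriv f x) - (p + 1) * Real.log (1 + x ^ p * v x) := by
  set u : ℝ → ℝ := fun x => 1 + x ^ p * v x with hu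
  have hus : ContDiff ℝ ∞ u := contDiff_const.add ((contDiff_id.pow p).mul hv)
  have hdf : ContDiff ℝ ∞ (deriv f) := (contDiff_infty_iff_deriv.1 hf).2
  have hdv : ContDiff ℝ ∞ (deriv v) := (contDiff_infty_iff_deriv.1 hv).2
  have hfe : f = fun x => x + x ^ (p + 1) * v x := by funext x; rw [hfv]; ring
  have hDf : ∀ x, deriv f x = 1 + ((p + 1) * x ^ p * v x + x ^ (p + 1) * deriv v x) := by
    intro x
    have h1 : HasDerivAt v (deriv v x) x := (hv.differentiable (by simp) x).hasDerivAt
    have h2 := (hasDerivAt_id x).add ((hasDerivAt_pow (p + 1) x).mul h1)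
    rw [hfe]
    refine Eq.trans h2.deriv ?_
    push_cast; simp
  obtain ⟨d1, hd1, hd⟩ := had (G := fun x => ((p:ℝ) + 1) - ∑ j ∈ Finset.range (p + 1), u x ^ j)
    (contDiff_const.sub (ContDiff.sum fun j _ => hus.pow j)) (by
      rcases p with _ | p
      · simp
      · simp [hu])
  set w : ℝ → ℝ := fun x => v x * d1 x + deriv v x with hw
  have hws : ContDiff ℝ ∞ w := (hv.mul hd1).add hdv
  have hkey : ∀ x, deriv f x - u x ^ (p + 1) = x ^ (p + 1) * w x := by
    intro x
    have h1 := geom_sum_mul (u x) (p + 1)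
    have h2 := hd x
    have h3 : u x - 1 = x ^ p * v x := by simp [hu]
    rw [h3] at h1
    rw [hDf, ← sub_eq_zero]
    have h4 : u x ^ (p + 1) = 1 + ((p + 1) - x * d1 x) * (x ^ p * v x) := by
      rw [← h2]; linarith
    rw [h4, hw]; ring
  have hu0' : 0 < u 0 := hu0
  have hdf0 : deriv f 0 = u 0 ^ (p + 1) := by have := hkey 0; simp at this; simpa using sub_eq_zero.1 this
  have hcq : ContinuousAt (fun x => deriv f x / u x ^ (p + 1)) 0 :=
    hdf.continuous.continuousAt.div (hus.continuous.pow _).continuousAt (pow_pos hu0' _).ne'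
  have e1 : ∀ᶠ x in 𝓝 (0:ℝ), u 0 / 2 < u x :=
    hus.continuous.continuousAt.eventually (lt_mem_nhds (by linarith))
  have e2 : ∀ᶠ x in 𝓝 (0:ℝ), 0 < deriv f x :=
    hdf.continuous.continuousAt.eventually (lt_mem_nhds (by rw [hdf0]; positivity))
  have e3 : ∀ᶠ x in 𝓝 (0:ℝ), 1/2 < deriv f x / u x ^ (p + 1) :=
    hcq.eventually (lt_mem_nhds (by show 1/2 < deriv f 0 / u 0 ^ (p+1); rw [hdf0, div_self (pow_pos hu0' _).ne']; norm_num))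
  have e4 : ∀ᶠ x in 𝓝 (0:ℝ), |w x| < |w 0| + 1 :=
    hws.continuous.abs.continuousAt.eventually (gt_mem_nhds (by linarith))
  obtain ⟨r, hr, hb⟩ := Metric.eventually_nhds_iff.1 (e1.and (e2.and (e3.and e4)))
  have hb' : ∀ x ∈ Ioo (-r) r, _ := fun x hx => hb (y := x) (by rw [Real.dist_eq, sub_zero]; exact abs_lt.2 hx)
  obtain ⟨ℓ, hℓ, hℓe⟩ := extend_loc (g := fun x => Real.log (deriv f x) - (p + 1) * Real.log (u x)) hr
    ((hdf.contDiffOn.log fun x hx => (hb' x hx).2.1.ne').sub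
      (contDiffOn_const.mul (hus.contDiffOn.log fun x hx => by have := (hb' x hx).1; linarith)))
  obtain ⟨ℓ1, hℓ1, he⟩ := div_of_O (p + 1) hℓ (r := r / 4) (C := (|w 0| + 1) / (u 0 / 2) ^ (p + 1) / (1/2)) (by positivity)
    (fun x hx => by
      rw [hℓe x ⟨by linarith [hx.1], hx.2⟩]
      obtain ⟨h1, h2, h3, h4⟩ := hb' x ⟨by linarith [hx.1], by linarith [hx.2]⟩
      have hup : 0 < u x := by linarith
      have h5 : Real.log (deriv f x) - (p + 1) * Real.log (u x) = Real.log (deriv f x / u x ^ (p + 1)) := by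
        rw [Real.log_div h2.ne' (by positivity), Real.log_pow]; push_cast; ring
      rw [h5]
      refine (log_abs_le (c := 1/2) (by norm_num) (by norm_num) h3.le).trans ?_
      have h6 : deriv f x / u x ^ (p + 1) - 1 = x ^ (p + 1) * w x / u x ^ (p + 1) := by
        rw [← hkey x, sub_div, div_self (by positivity)]
      have hx0 := hx.1
      rw [h6, abs_div, abs_mul, abs_of_pos (pow_pos hx0 _), abs_of_pos (pow_pos hup _)]
      have h7 : (u 0 / 2) ^ (p + 1) ≤ u x ^ (p + 1) := pow_le_pow_left₀ (by positivity) h1.le _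
      have h8 : x ^ (p + 1) * |w x| / u x ^ (p + 1) ≤ x ^ (p + 1) * (|w 0| + 1) / (u 0 / 2) ^ (p + 1) := by
        gcongr
      calc _ ≤ x ^ (p + 1) * (|w 0| + 1) / (u 0 / 2) ^ (p + 1) / (1/2) := by gcongr
        _ = _ := by ring)
  refine ⟨ℓ, ℓ1, hℓ, hℓ1, he, r / 4, by positivity, fun x hx => ?_⟩
  obtain ⟨h1, h2, h3, h4⟩ := hb' x ⟨by linarith [hx.1], by linarith [hx.2]⟩
  exact ⟨by have : u x = 1 + x ^ p * v x := rfl; linarith, h2, hℓe x hx⟩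

end Aux
end

section
open Set Filter Topology
open scoped ContDiff
namespace Aux

lemma flat_iter {E : ℝ → ℝ} (hE : ∀ N : ℕ, ∃ H : ℝ → ℝ, ContDiff ℝ ∞ H ∧ ∀ x, E x = x ^ N * H x)
    (j : ℕ) : ∀ N : ℕ, ∃ H : ℝ → ℝ, ContDiff ℝ ∞ H ∧ ∀ x, iteratedDeriv j E x = x ^ N * H x := by
  induction j with
  | zero => simpa using hE
  | succ j ih =>
    intro N
    obtain ⟨H, hH, he⟩ := ih (N + 1)
    have hH' : ContDiff ℝ ∞ (deriv H) := (contDiff_infty_iff_deriv.1 hH).2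
    refine ⟨fun x => (N + 1) * H x + x * deriv H x,
      (contDiff_const.mul hH).add (contDiff_id.mul hH'), fun x => ?_⟩
    rw [iteratedDeriv_succ, funext he]
    have h1 := (hasDerivAt_pow (N + 1) x).mul ((hH.differentiable (by simp) x).hasDerivAt)
    rw [show (fun x => x ^ (N + 1) * H x) = ((fun x => x ^ (N + 1)) * H) from rfl, h1.deriv]
    push_cast
    ring

lemma flat_bound {E : ℝ → ℝ} (hE : ∀ N : ℕ, ∃ H : ℝ → ℝ, ContDiff ℝ ∞ H ∧ ∀ x, E x = x ^ N * H x)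
    (n N : ℕ) : ∃ A ≥ 0, ∀ j ≤ n, ∀ x ∈ Icc (0:ℝ) 1, |iteratedDeriv j E x| ≤ A * x ^ N := by
  have h1 : ∀ j, ∃ A ≥ 0, ∀ x ∈ Icc (0:ℝ) 1, |iteratedDeriv j E x| ≤ A * x ^ N := by
    intro j
    obtain ⟨H, hH, he⟩ := flat_iter hE j N
    obtain ⟨M, hM, hb⟩ := bound_on_compact hH 0 0 1
    refine ⟨M, by linarith, fun x hx => ?_⟩
    have := hb 0 le_rfl x hx
    have hx0 := pow_nonneg hx.1 N
    rw [he, abs_mul, abs_of_nonneg hx0, mul_comm]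
    gcongr
    simpa using this
  choose A hA hb using h1
  refine ⟨∑ j ∈ Finset.range (n + 1), A j, Finset.sum_nonneg fun j _ => hA j, fun j hj x hx => ?_⟩
  refine (hb j x hx).trans ?_
  have := pow_nonneg hx.1 N
  gcongr
  exact Finset.single_le_sum (f := A) (fun j _ => hA j) (by simp; omega)

namespace Orb
variable {x V : ℝ → ℝ} {K L a : ℝ}

lemma chain (h : Orb x V K L a) {E W : ℝ → ℝ} {S : Set ℝ} (hS : IsOpen S)
    (hE : ContDiffOn ℝ ∞ E S) (hm : MapsTo x (Ioi a) S) (hW : ContDiffOn ℝ ∞ W (Ioi a))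
    {c : ℝ} (hc0 : 0 ≤ c) (hc1 : c ≤ 1) (hinc : ∀ t > a, W (t + 1) - W t = E (x (t + c)))
    {n : ℕ} {M A : ℝ} (hM1 : 1 ≤ M) (hM0 : ∀ t > a, Real.exp (V t) ≤ M)
    (hM : ∀ i, 1 ≤ i → i ≤ n → ∀ t > a, |iteratedDeriv i V t| ≤ M ^ i)
    (hA : ∀ j ≤ n, ∀ t > a, |iteratedDeriv (j + 1) E (x t)| ≤ A)
    (hl : Tendsto (iteratedDeriv 1 W) atTop (𝓝 0)) (i : ℕ) : i ≤ n →
    (∀ t > a, |iteratedDeriv (i + 1) W t| ≤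
      (∑ j ∈ Finset.range (n + 1), Cst j) * A * M ^ (i + 1) * Real.exp (3 * K) * (x t - L)) ∧
      Tendsto (iteratedDeriv (i + 1) W) atTop (𝓝 0) := by
  have hA0 : 0 ≤ A := (abs_nonneg _).trans (hA 0 (Nat.zero_le _) (a + 1) (by simp))
  have hs : ∀ j ≤ n, Cst j ≤ ∑ j ∈ Finset.range (n + 1), Cst j := fun j hj =>
    Finset.single_le_sum (f := Cst) (fun j _ => (Cst_pos j).le) (by simp; omega)
  have hs0 : 0 ≤ ∑ j ∈ Finset.range (n + 1), Cst j := Finset.sum_nonneg fun j _ => (Cst_pos j).le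
  have hK := h.Knn
  induction i with
  | zero =>
    intro _
    refine ⟨fun t ht => ?_, hl⟩
    have := h.step0 hS hE hm hW hc0 hc1 hinc hM0 (hA 0 (Nat.zero_le _)) hl ht
    rw [sub_zero] at this
    have hx : 0 ≤ x t - L := by linarith [h.L_le ht]
    refine this.trans ?_
    calc Cst 0 * A * Real.exp (2 * K) * (x t - L)
        ≤ (∑ j ∈ Finset.range (n + 1), Cst j) * A * Real.exp (3 * K) * (x t - L) := by
          gcongr
          · exact hs 0 (Nat.zero_le _)
          · norm_num
      _ ≤ (∑ j ∈ Finset.range (n + 1), Cst j) * A * Real.exp (3 * K) * (x t - L) * M :=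
          le_mul_of_one_le_right (by positivity) hM1
      _ = _ := by rw [zero_add, pow_one]; ring
  | succ i ih =>
    intro hi
    have := h.step1 (n := i + 1) hS hE hm hW hc0 hc1 hinc hM0
      (fun k h1 h2 => hM k h1 (h2.trans hi)) (fun j hj => hA j (hj.trans hi)) (ih (by omega)).2
    refine ⟨fun t ht => (this.1 t ht).trans ?_, this.2⟩
    have hx : 0 ≤ x t - L := by linarith [h.L_le ht]
    have : 0 ≤ M := by linarith
    gcongr
    · exact hs _ hi
    · omega

lemma space' (h : Orb x V K L a) {G : ℝ → ℝ} {S : Set ℝ} (hS : IsOpen S)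
    (hG : ContDiffOn ℝ ∞ G S) (hm : MapsTo x (Ioi a) S) {n : ℕ} {M A t : ℝ} (ht : a < t)
    (hM0 : 0 ≤ M) (hA0 : 0 ≤ A)
    (hM : ∀ i, 1 ≤ i → i ≤ n + 1 → |iteratedDeriv i V t| ≤ M ^ i)
    (hA : ∀ i, 1 ≤ i → i ≤ n + 1 → |iteratedDeriv i (fun t => G (x t)) t| ≤ A * M ^ i) :
    |iteratedDeriv (n + 1) G (x t)| ≤
      (2 ^ (n + 1) * (n + 1).factorial) ^ (n + 1) * A * (M * Real.exp (- V t)) ^ (n + 1) := by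
  have e : ∀ (u : ℝ → ℝ) (c : ℝ) (i : ℕ), iteratedDeriv (i + 1) (fun s => u s - c) = iteratedDeriv (i + 1) u := by
    intro u c i
    rw [iteratedDeriv_succ', iteratedDeriv_succ']
    congr 1
    funext s
    exact deriv_sub_const _
  have := h.space (G := fun s => G s - G (x t)) (n := n + 1) hS (hG.sub contDiffOn_const) hm ht hM0 hM
    (fun i hi => by
      rcases i with _ | i
      · simpa using hA0
      · rw [e]; exact hA _ (by omega) hi) (n + 1) 0 (by omega)
  rw [e] at this
  simpa using this

end Orb
end Aux
end

section
open Set Filter Topology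
open scoped ContDiff
namespace Aux
namespace Fl
variable {ξ : ℝ → ℝ} {φ : ℝ → ℝ → ℝ} {K : ℝ}

lemma slope0 (h : Fl ξ φ K) : ∃ b, Tendsto (fun z => ξ z / z) (𝓝[>] 0) (𝓝 b) := by
  have h1 : DifferentiableWithinAt ℝ ξ (Icc 0 1) 0 := (h.c1.differentiableOn (by simp)) 0 (by simp)
  refine ⟨derivWithin ξ (Icc 0 1) 0, ?_⟩
  have h2 := hasDerivWithinAt_iff_tendsto_slope.1 h1.hasDerivWithinAt
  have h3 : 𝓝[>] (0:ℝ) ≤ 𝓝[Icc 0 1 \ {0}] 0 := by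
    rw [← nhdsWithin_Ioo_eq_nhdsGT (zero_lt_one (α := ℝ))]
    exact nhdsWithin_mono _ fun z hz => ⟨⟨hz.1.le, hz.2.le⟩, hz.1.ne'⟩
  refine (h2.mono_left h3).congr fun z => ?_
  rw [slope_def_field, h.xi0]; simp

/-- the corrected logarithm of the field. -/
noncomputable def psi (ξ θ : ℝ → ℝ) (σ : ℝ) (m : ℕ) (z : ℝ) : ℝ :=
  Real.log (σ * ξ z) - m * Real.log z - θ z

lemma psi_smooth (h : Fl ξ φ K) {θ : ℝ → ℝ} (hθ : ContDiff ℝ ∞ θ) {σ : ℝ} {m : ℕ} {r : ℝ}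
    (hr1 : r ≤ 1) (hp : ∀ z ∈ Ioo 0 r, 0 < σ * ξ z) : ContDiffOn ℝ ∞ (psi ξ θ σ m) (Ioo 0 r) := by
  have hsub : Ioo 0 r ⊆ Ioo (0:ℝ) 1 := Ioo_subset_Ioo_right hr1
  refine ContDiffOn.sub (ContDiffOn.sub ?_ ?_) hθ.contDiffOn
  · exact (contDiffOn_const.mul (h.sm.mono hsub)).log fun z hz => (hp z hz).ne'
  · exact contDiffOn_const.mul (contDiffOn_id.log fun z hz => hz.1.ne')

lemma psi_inc (h : Fl ξ φ K) {f θ v ℓ : ℝ → ℝ} {σ : ℝ} {p : ℕ}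
    (hf1 : ∀ x ∈ Icc (0:ℝ) 1, f x = φ 1 x) {z : ℝ} (hz : z ∈ Ioo (0:ℝ) 1)
    (hd : DifferentiableAt ℝ f z)
    (hfv : ∀ x, f x = x * (1 + x ^ p * v x)) (hu : 0 < 1 + z ^ p * v z) (hdp : 0 < deriv f z)
    (hℓ : ℓ z = Real.log (deriv f z) - (p + 1) * Real.log (1 + z ^ p * v z)) (hp : 0 < σ * ξ z) :
    psi ξ θ σ (p + 1) (f z) - psi ξ θ σ (p + 1) z = ℓ z + θ z - θ (f z) := by
  unfold psi
  have h1 := h.conj hf1 (Ioo_subset_Icc_self hz) hd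
  have h2 : Real.log (σ * ξ (f z)) = Real.log (deriv f z) + Real.log (σ * ξ z) := by
    rw [h1, ← Real.log_mul hdp.ne' hp.ne']; ring_nf
  have h3 : Real.log (f z) = Real.log z + Real.log (1 + z ^ p * v z) := by
    rw [← Real.log_mul hz.1.ne' hu.ne', ← hfv]
  rw [h2, h3, hℓ]; push_cast; ring

lemma W_lim (h : Fl ξ φ K) {θ : ℝ → ℝ} (hθ : ContDiff ℝ ∞ θ) {σ y : ℝ} {m : ℕ}
    (hy : y ∈ Ioo (0:ℝ) 1) (hσ : σ = 1 ∨ σ = -1) (h0 : 0 < σ * ξ y) {κ : ℝ}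
    (ho : Orb (fun t => φ (-σ * t) y) (fun t => Real.log (σ * ξ (φ (-σ * t) y))) K 0 0)
    (hκ : Tendsto (iteratedDeriv 1 (fun t => Real.log (σ * ξ (φ (-σ * t) y)))) atTop (𝓝 κ))
    {E : ℝ → ℝ} (hE : Continuous E) (hE0 : E 0 = 0) {c : ℝ}
    (hinc : ∀ t > 0, psi ξ θ σ m (φ (-σ * (t + 1)) y) - psi ξ θ σ m (φ (-σ * t) y) = E (φ (-σ * (t + c)) y)) :
    Tendsto (iteratedDeriv 1 (fun t => psi ξ θ σ m (φ (-σ * t) y))) atTop (𝓝 0) := by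
  set x : ℝ → ℝ := fun t => φ (-σ * t) y with hx
  set V : ℝ → ℝ := fun t => Real.log (σ * ξ (x t)) with hV
  have hyI := Ioo_subset_Icc_self hy
  have hxp : ∀ t, x t ∈ Ioo (0:ℝ) 1 := fun t => h.mem' hy _
  have hVe : ∀ t, Real.exp (V t) = σ * ξ (x t) := fun t => Real.exp_log (h.pos hyI h0 _)
  have hdW : ∀ t > 0, HasDerivAt (fun t => psi ξ θ σ m (x t))
      (iteratedDeriv 1 V t - m * (-(σ * ξ (x t)) / x t) - deriv θ (x t) * (-(σ * ξ (x t)))) t := by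
    intro t ht
    have h1 : HasDerivAt V (iteratedDeriv 1 V t) t := by
      simpa using cd_hasDeriv isOpen_Ioi ho.hV 0 ht
    have h2 : HasDerivAt x (-(σ * ξ (x t))) t := by rw [← hVe]; exact ho.hx t ht
    have h3 := h2.log (hxp t).1.ne'
    have h4 := ((hθ.differentiable (by simp) (x t)).hasDerivAt).comp t h2
    exact (h1.sub (h3.const_mul (m:ℝ))).sub h4
  obtain ⟨b, hb⟩ := h.slope0
  have hxl : Tendsto x atTop (𝓝 0) := ho.lim
  have hxl' : Tendsto x atTop (𝓝[>] 0) :=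
    tendsto_nhdsWithin_iff.2 ⟨hxl, Eventually.of_forall fun t => (hxp t).1⟩
  have hb' : Tendsto (fun t => ξ (x t) / x t) atTop (𝓝 b) := hb.comp hxl'
  have hξ0 : Tendsto (fun t => ξ (x t)) atTop (𝓝 0) := by
    have := hb'.mul hxl
    rw [mul_zero] at this
    refine this.congr fun t => ?_
    rw [div_mul_cancel₀ _ (hxp t).1.ne']
  have hdθ : Continuous (deriv θ) := hθ.continuous_deriv (by simp)
  have hθ' : Tendsto (fun t => deriv θ (x t)) atTop (𝓝 (deriv θ 0)) := (hdθ.tendsto 0).comp hxl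
  have hlim : Tendsto (iteratedDeriv 1 (fun t => psi ξ θ σ m (x t))) atTop
      (𝓝 (κ - m * (-(σ * b)) - deriv θ 0 * (-(σ * 0)))) := by
    have := (hκ.sub (((hb'.const_mul σ).neg).const_mul (m:ℝ))).sub (hθ'.mul ((hξ0.const_mul σ).neg))
    refine this.congr' ?_
    filter_upwards [eventually_gt_atTop 0] with t ht
    rw [iteratedDeriv_one (f := fun t => psi ξ θ σ m (x t)), (hdW t ht).deriv]
    ring
  set κ' := κ - m * (-(σ * b)) - deriv θ 0 * (-(σ * 0)) with hκ'
  have hE' : Tendsto (fun t => E (x (t + c))) atTop (𝓝 0) := by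
    have := (hE.tendsto 0).comp (hxl.comp (tendsto_atTop_add_const_right _ c tendsto_id))
    rw [hE0] at this
    exact this
  have hmv : ∀ t > 0, ∃ s > t, deriv (fun t => psi ξ θ σ m (x t)) s = E (x (t + c)) := by
    intro t ht
    obtain ⟨s, hs, he⟩ := exists_deriv_eq_slope (fun t => psi ξ θ σ m (x t)) (show t < t + 1 by linarith)
      (fun s hs => (hdW s (by linarith [hs.1])).continuousAt.continuousWithinAt)
      (fun s hs => (hdW s (by linarith [hs.1])).differentiableAt.differentiableWithinAt)
    refine ⟨s, hs.1, he.trans ?_⟩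
    rw [add_sub_cancel_left, div_one]
    exact hinc t ht
  have hk0 : κ' = 0 := by
    have : ∀ t : ℝ, ∃ s > t, 0 < t → deriv (fun t => psi ξ θ σ m (x t)) s = E (x (t + c)) := by
      intro t
      by_cases ht : 0 < t
      · obtain ⟨s, hs, he⟩ := hmv t ht; exact ⟨s, hs, fun _ => he⟩
      · exact ⟨t + 1, by simp, fun h => absurd h ht⟩
    choose s hs he using this
    have hst : Tendsto s atTop atTop := tendsto_atTop_mono (fun t => (hs t).le) tendsto_id
    have h1 := hlim.comp hst
    refine tendsto_nhds_unique h1 (hE'.congr' ?_)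
    filter_upwards [eventually_gt_atTop 0] with t ht
    rw [← he t ht, Function.comp_apply, iteratedDeriv_one]
  rw [hk0] at hlim
  exact hlim

end Fl
end Aux
end

section
open Set Filter Topology
open scoped ContDiff
namespace Aux
namespace Fl
variable {ξ : ℝ → ℝ} {φ : ℝ → ℝ → ℝ} {K : ℝ}

lemma alg_aux {C3 S A Q X e M c P : ℝ} {N k : ℕ} (hX : X ^ N = P ^ k) (hc : c ≠ 0) (hP : P ≠ 0) :
    C3 * (S * (A * (Q * X) ^ N) * e * X) * (M * (1 / (c * P))) ^ k =
      C3 * (S * (A * Q ^ N) * e) * (M / c) ^ k * X := by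
  have h1 : M * (1 / (c * P)) = (M / c) / P := by field_simp
  have h2 : P ^ k ≠ 0 := pow_ne_zero _ hP
  rw [h1, div_pow (M / c) P k, mul_pow Q X N, hX]
  field_simp

lemma nonflat_est (h : Fl ξ φ K) {f v : ℝ → ℝ} {p : ℕ} (hfd : SmoothDiffeoI f)
    (hf1 : ∀ x ∈ Icc (0:ℝ) 1, f x = φ 1 x) (hv : ContDiff ℝ ∞ v)
    (hfv : ∀ x, f x = x * (1 + x ^ p * v x)) (hv0 : v 0 ≠ 0) (hu0 : 0 < 1 + (0:ℝ) ^ p * v 0) :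
    ∃ r > 0, r ≤ 1 ∧ ∃ σ : ℝ, (σ = 1 ∨ σ = -1) ∧ ∃ θ : ℝ → ℝ, ContDiff ℝ ∞ θ ∧
      (∀ z ∈ Ioo 0 r, 0 < σ * ξ z) ∧ ∀ n : ℕ, ∃ C : ℝ, ∃ r' > 0, r' ≤ r ∧
        ∀ z ∈ Ioo 0 r', |iteratedDeriv (n + 1) (psi ξ θ σ (p + 1)) z| ≤ C * z := by
  obtain ⟨hsm, -, -, hpos, -⟩ := hfd
  have hsm' : ContDiff ℝ ∞ f := hsm
  have hfdiff : Differentiable ℝ f := hsm'.differentiable (by simp)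
  obtain ⟨ℓ, ℓ1, hℓ, hℓ1, hℓe, r1, hr1, hr1e⟩ := ell_exists hsm' hv hfv hu0
  obtain ⟨θ, hθ, hflat⟩ := formal hsm' hv hfv hv0 hu0 hℓ1 hℓe
  set E0 : ℝ → ℝ := fun x => ℓ x + θ x - θ (f x) with hE0
  have hE0s : ContDiff ℝ ∞ E0 := (hℓ.add hθ).sub (hθ.comp hsm')
  have hE00 : E0 0 = 0 := by obtain ⟨H, -, he⟩ := hflat 1; show ℓ 0 + θ 0 - θ (f 0) = 0; rw [he]; simp
  have hv1 : ∀ᶠ x in 𝓝 (0:ℝ), |v 0| / 2 < |v x| :=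
    hv.continuous.abs.continuousAt.eventually (lt_mem_nhds (by have := abs_pos.2 hv0; linarith))
  obtain ⟨r2, hr2, hv2⟩ := Metric.eventually_nhds_iff.1 hv1
  set r0 := min r1 (min r2 1) with hr0
  have hr0p : 0 < r0 := by positivity
  have hr01 : r0 ≤ r1 := min_le_left _ _
  have hr02 : r0 ≤ r2 := (min_le_right _ _).trans (min_le_left _ _)
  have hr03 : r0 ≤ 1 := (min_le_right _ _).trans (min_le_right _ _)
  set c0 := |v 0| / 2 / Real.exp K with hc0
  have hvp := abs_pos.2 hv0
  have hc0p : 0 < c0 := by positivity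
  have hlow : ∀ z ∈ Ioo 0 r0, c0 * z ^ (p + 1) ≤ |ξ z| := by
    intro z hz
    have hz0 := hz.1
    have hzI : z ∈ Icc (0:ℝ) 1 := ⟨hz.1.le, by linarith [hz.2]⟩
    have h1 := h.disp_le hzI 1
    rw [← hf1 z hzI, hfv, show z * (1 + z ^ p * v z) - z = z ^ (p + 1) * v z by ring] at h1
    rw [abs_mul, abs_of_pos (by positivity : 0 < z ^ (p + 1))] at h1
    have h2 := hv2 (y := z) (by rw [Real.dist_eq, sub_zero, abs_of_pos hz.1]; linarith [hz.2])
    simp only [abs_one, mul_one] at h1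
    have h3 : z ^ (p + 1) * (|v 0| / 2) ≤ Real.exp K * |ξ z| := le_trans (by gcongr) h1
    rw [hc0, div_mul_eq_mul_div, div_le_iff₀ (by positivity)]
    linarith
  have hne : ∀ z ∈ Ioo 0 r0, ξ z ≠ 0 := by
    intro z hz
    have := hlow z hz
    have hz0 := hz.1
    have h2 : 0 < c0 * z ^ (p + 1) := by positivity
    exact abs_pos.1 (h2.trans_le this)
  set y := r0 / 2 with hyd
  have hyr : y ∈ Ioo 0 r0 := ⟨by positivity, by linarith⟩
  have hy : y ∈ Ioo (0:ℝ) 1 := ⟨hyr.1, by linarith [hyr.2]⟩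
  have hyI := Ioo_subset_Icc_self hy
  obtain ⟨σ, hσ, hσpos, hσabs⟩ := exists_sigma (hne y hyr)
  have hσ1 : |σ| = 1 := by rcases hσ with rfl | rfl <;> norm_num
  obtain ⟨L, hL, κ, ho⟩ := h.orb hy hσ hσpos
  obtain ⟨hxiL, hLy, hcov⟩ := h.orb_limit hy hσ hσpos hL (fun a => (ho a).1)
  have hL0 : L = 0 := by
    by_contra hc
    exact hne L ⟨lt_of_le_of_ne hL.1 (Ne.symm hc), hLy.trans hyr.2⟩ hxiL
  subst hL0
  have hp := h.pos hyI hσpos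
  have hpy : ∀ z ∈ Ioc 0 y, 0 < σ * ξ z := by
    intro z hz
    obtain ⟨t, -, rfl, -⟩ := hcov z hz
    exact hp _
  set x : ℝ → ℝ := fun t => φ (-σ * t) y with hx
  set V : ℝ → ℝ := fun t => Real.log (σ * ξ (x t)) with hV
  have hanti : ∀ s t, s ≤ t → x t ≤ x s := fun s t hst =>
    (ho (s - 1)).1.anti (by simp) (by simp only [mem_Ioi]; linarith) hst
  have hx0 : x 0 = y := by simp [hx, h.zero hyI]
  have hxr : ∀ t, 0 < t → x t ∈ Ioc 0 y := fun t ht =>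
    ⟨(h.mem' hy _).1, by have := hanti 0 t ht.le; rwa [hx0] at this⟩
  have hxlt : ∀ t, 0 < t → x t ∈ Ioo 0 y := by
    intro t ht
    refine ⟨(hxr t ht).1, lt_of_le_of_ne (hxr t ht).2 ?_⟩
    exact h.flow_ne hyI (hne y hyr) (by rcases hσ with rfl | rfl <;> simp [ht.ne'])
  have hσ01 : 0 ≤ (1 + σ) / 2 := by rcases hσ with rfl | rfl <;> norm_num
  have hσ02 : (1 + σ) / 2 ≤ 1 := by rcases hσ with rfl | rfl <;> norm_num
  have hstep : ∀ z ∈ Ioc 0 y, psi ξ θ σ (p + 1) (f z) - psi ξ θ σ (p + 1) z = E0 z := by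
    intro z hz
    obtain ⟨h1, h2, h3⟩ := hr1e z ⟨by linarith [hz.1], by linarith [hz.2, hyr.2]⟩
    exact h.psi_inc hf1 ⟨hz.1, by linarith [hz.2, hy.2]⟩ (hfdiff z) hfv h1 h2 h3 (hpy z hz)
  have hinc : ∀ t > 0, psi ξ θ σ (p + 1) (x (t + 1)) - psi ξ θ σ (p + 1) (x t) =
      -σ * E0 (x (t + (1 + σ) / 2)) := by
    intro t ht
    rw [← hstep _ (hxr _ (by linarith))]
    rw [hf1 _ (h.mem hyI _), hx]
    simp only
    rw [← h.add hyI]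
    rcases hσ with rfl | rfl
    · rw [show (1:ℝ) + -1 * (t + (1 + 1) / 2) = -1 * t by ring, show t + (1 + 1) / 2 = t + (1:ℝ) by ring]
      ring
    · rw [show (1:ℝ) + - -1 * (t + (1 + -1) / 2) = - -1 * (t + 1) by ring, show t + (1 + -1) / 2 = (t:ℝ) by ring]
      ring
  have hEs : ContDiff ℝ ∞ (fun z => -σ * E0 z) := contDiff_const.mul hE0s
  have hWl := h.W_lim hθ (m := p + 1) hy hσ hσpos (ho 0).1 (ho 0).2 hEs.continuous
    (by simp [hE00]) hinc
  have hpsi : ContDiffOn ℝ ∞ (psi ξ θ σ (p + 1)) (Ioo 0 y) :=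
    h.psi_smooth hθ hy.2.le fun z hz => hpy z ⟨hz.1, hz.2.le⟩
  have hdf : ContDiff ℝ ∞ (deriv f) := (contDiff_infty_iff_deriv.1 hsm').2
  have hSo : IsOpen {x | 0 < deriv f x} := isOpen_lt continuous_const hdf.continuous
  have hlog : ContDiffOn ℝ ∞ (fun x => Real.log (deriv f x)) {x | 0 < deriv f x} :=
    hdf.contDiffOn.log fun x hx => (ne_of_gt hx)
  refine ⟨y, hy.1, hy.2.le, σ, hσ, θ, hθ, fun z hz => hpy z ⟨hz.1, hz.2.le⟩, fun n => ?_⟩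
  obtain ⟨C2, hC2, H2⟩ := Orb.core K (n + 1)
  have hBj : ∀ j : ℕ, ∃ B, ∀ z ∈ Icc (0:ℝ) 1, |iteratedDeriv j (fun x => Real.log (deriv f x)) z| ≤ B := by
    intro j
    obtain ⟨B, hB⟩ := isCompact_Icc.exists_bound_of_continuousOn
      ((cd_cont hSo hlog j).mono (fun z hz => hpos z hz))
    exact ⟨B, hB⟩
  choose Bj hBj using hBj
  have hBj0 : ∀ j, 0 ≤ Bj j := fun j => (abs_nonneg _).trans (hBj j 0 (by simp))
  set B := 1 + K + ∑ j ∈ Finset.range (n + 2), Bj j with hB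
  have hBs : 0 ≤ ∑ j ∈ Finset.range (n + 2), Bj j := Finset.sum_nonneg fun j _ => hBj0 j
  have hK0 := h.K0
  have hB1 : 1 ≤ B := by linarith
  have hVB : ∀ t, Real.exp (V t) ≤ B := by
    intro t
    rw [Real.exp_log (hp _)]
    have h1 := h.xi_lip (h.mem hyI (-σ * t))
    have h2 := h.mem hyI (-σ * t)
    have h3 : σ * ξ (φ (-σ * t) y) ≤ |ξ (φ (-σ * t) y)| := by
      refine (le_abs_self _).trans ?_; rw [abs_mul, hσ1, one_mul]
    have h4 : K * φ (-σ * t) y ≤ K := mul_le_of_le_one_right hK0 h2.2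
    linarith
  have hcore := (H2 (ho 0).1 (Λ := fun x => -σ * Real.log (deriv f x)) (c := (1 + σ)/2)
    (B := B) hSo (contDiffOn_const.mul hlog) (fun t _ => hpos _ (h.mem hyI _)) hσ01 hσ02
    (fun t _ => h.cocycle hf1 hfdiff hpos hy hσ hσpos t)
    (fun t _ => hVB t)
    (fun t _ => by have := (h.mem hyI (-σ * t)).2; linarith)
    (fun j hj t ht => by
      rw [iteratedDeriv_const_mul_field, abs_mul, abs_neg, hσ1, one_mul]
      refine (hBj j _ (h.mem hyI _)).trans ?_
      have := Finset.single_le_sum (f := Bj) (fun j _ => hBj0 j)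
        (Finset.mem_range.2 (by omega : j < n + 2))
      linarith) (ho 0).2).1
  set M := C2 * B with hM
  have hM1 : 1 ≤ M := one_le_mul_of_one_le_of_one_le hC2 hB1
  have hBM : B ≤ M := le_mul_of_one_le_left (by linarith) hC2
  set N := (p + 1) * (n + 1) with hN
  obtain ⟨A0, hA0, hA0b⟩ := flat_bound hflat (n + 1) N
  set Q := 1 + Real.exp (K * 1) * K * 1 with hQ
  have hQ0 : 0 ≤ Q := by positivity
  set Sg := ∑ j ∈ Finset.range (n + 1), Orb.Cst j with hSg
  have hSg0 : 0 ≤ Sg := Finset.sum_nonneg fun j _ => (Orb.Cst_pos j).le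
  set C3 : ℝ := (2 ^ (n + 1) * (n + 1).factorial) ^ (n + 1) with hC3
  have hC30 : 0 ≤ C3 := by positivity
  refine ⟨C3 * (Sg * (A0 * Q ^ N) * Real.exp (3 * K)) * (M / c0) ^ (n + 1), x 1, (hxr 1 one_pos).1,
    (hxr 1 one_pos).2, fun z hz => ?_⟩
  obtain ⟨t, ht0, rfl, -⟩ := hcov z ⟨hz.1, hz.2.le.trans (hxr 1 one_pos).2⟩
  change x t ∈ Ioo 0 (x 1) at hz
  change |iteratedDeriv (n + 1) (psi ξ θ σ (p + 1)) (x t)| ≤ _ * x t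
  have ht : 1 < t := by
    by_contra! hc
    exact absurd hz.2 (not_lt.2 (hanti _ _ hc))
  have hxt := hz.1
  have hmaps : MapsTo x (Ioi (t - 1)) (Ioo 0 y) := fun s hs => hxlt s (by simp only [mem_Ioi] at hs; linarith)
  have hxs : ∀ s > t - 1, x s ≤ Q * x t := by
    intro s hs
    refine (hanti (t - 1) s hs.le).trans ?_
    have h1 := h.disp_lin (t := σ) (T := 1) (h.mem hyI (-σ * t)) hσ1.le
    rw [← h.add hyI, show σ + -σ * t = -σ * (t - 1) by ring] at h1
    exact h1
  have hW : ContDiffOn ℝ ∞ (fun s => psi ξ θ σ (p + 1) (x s)) (Ioi (t - 1)) :=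
    hpsi.comp (ho (t - 1)).1.smooth hmaps
  have hch := (ho (t - 1)).1.chain (E := fun z => -σ * E0 z) (W := fun s => psi ξ θ σ (p + 1) (x s))
    isOpen_univ hEs.contDiffOn (mapsTo_univ _ _) hW
    hσ01 hσ02 (fun s hs => hinc s (by linarith)) (n := n) (M := M) (A := A0 * (Q * x t) ^ N) hM1
    (fun s _ => (hVB s).trans hBM)
    (fun i h1 h2 s hs => hcore i h1 (by omega) s (by linarith))
    (fun j hj s hs => by
      rw [iteratedDeriv_const_mul_field, abs_mul, abs_neg, hσ1, one_mul]
      refine (hA0b (j + 1) (by omega) _ (h.mem hyI _)).trans ?_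
      have := (h.mem hyI (-σ * s)).1
      gcongr
      exact hxs s hs) hWl
  have hsp := (ho (t - 1)).1.space' (G := psi ξ θ σ (p + 1)) (n := n) (M := M) (t := t)
    (A := Sg * (A0 * (Q * x t) ^ N) * Real.exp (3 * K) * x t) isOpen_Ioo hpsi hmaps (by linarith)
    (by linarith) (by positivity) (fun i h1 h2 => hcore i h1 h2 t (by linarith))
    (fun i h1 h2 => by
      obtain ⟨i, rfl⟩ : ∃ k, i = k + 1 := ⟨i - 1, by omega⟩
      refine ((hch i (by omega)).1 t (by linarith)).trans (le_of_eq ?_)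
      rw [sub_zero]; ring)
  refine hsp.trans ?_
  have he : Real.exp (- V t) ≤ 1 / (c0 * (x t) ^ (p + 1)) := by
    rw [Real.exp_neg, Real.exp_log (hp _), ← one_div]
    have hxr0 : x t ∈ Ioo 0 r0 := ⟨hxt, by linarith [(hxr t (by linarith)).2, hyr.2]⟩
    have h1 := hlow _ hxr0
    have h2 : σ * ξ (x t) = |ξ (x t)| := by
      rw [← abs_of_pos (hp (-σ * t)), abs_mul, hσ1, one_mul]
    apply one_div_le_one_div_of_le (by positivity)
    exact h1.trans h2.ge
  calc C3 * (Sg * (A0 * (Q * x t) ^ N) * Real.exp (3 * K) * x t) * (M * Real.exp (- V t)) ^ (n + 1)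
      ≤ C3 * (Sg * (A0 * (Q * x t) ^ N) * Real.exp (3 * K) * x t) *
          (M * (1 / (c0 * (x t) ^ (p + 1)))) ^ (n + 1) := by gcongr
    _ = _ := by
      have : (x t) ^ N = ((x t) ^ (p + 1)) ^ (n + 1) := by rw [hN, pow_mul]
      exact alg_aux this hc0p.ne' (by positivity)

end Fl
end Aux
end

section
open Set Filter Topology
open scoped ContDiff
namespace Aux

lemma antider {G : ℝ → ℝ} (hG : ContDiff ℝ ∞ G) : ∃ Ω : ℝ → ℝ, ContDiff ℝ ∞ Ω ∧
    ∀ x, HasDerivAt Ω (G x) x := by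
  have hd : ∀ x, HasDerivAt (fun x => ∫ t in (0:ℝ)..x, G t) (G x) x := fun x =>
    intervalIntegral.integral_hasDerivAt_right (hG.continuous.intervalIntegrable _ _)
      (hG.continuous.stronglyMeasurableAtFilter _ _) hG.continuous.continuousAt
  refine ⟨_, contDiff_infty_iff_deriv.2 ⟨fun x => (hd x).differentiableAt, ?_⟩, hd⟩
  rwa [funext fun x => (hd x).deriv]

lemma end_nonflat {D : Set ℝ} {α : ℝ} {f g ξ : ℝ → ℝ} {φ : ℝ → ℝ → ℝ} {K : ℝ}
    (d : Dat D α f g ξ φ K) (h0 : (0:ℝ) ∉ D) :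
    ∃ ξ1 : ℝ → ℝ, (∀ x ≥ 0, ξ1 x = ξ x) ∧ ∃ ρ > 0, ContDiffOn ℝ ∞ ξ1 (Ioo (-ρ) 1) := by
  have h := d.fl
  have hfs : ContDiff ℝ ∞ f := d.fd.1
  have hf0 : f 0 = 0 := d.fd.2.1
  have hn : ¬ ITIat f 0 := by rw [d.fI 0 (by simp)]; exact h0
  unfold ITIat at hn
  push Not at hn
  obtain ⟨n, -, hn⟩ := hn hf0
  obtain ⟨m, v, hv, hv0, hm⟩ := order_exists n (hfs.sub contDiff_id) hn
  have hm' : ∀ x, f x - x = x ^ m * v x := hm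
  rcases m with _ | p
  · have := hm' 0; simp [hf0] at this; exact absurd this.symm hv0
  have hfv : ∀ x, f x = x * (1 + x ^ p * v x) := fun x => by linear_combination hm' x
  have hu0 : 0 < 1 + (0:ℝ) ^ p * v 0 := by
    have hus : ContDiff ℝ ∞ (fun x => 1 + x ^ p * v x) := contDiff_const.add ((contDiff_id.pow p).mul hv)
    have h1 := (hasDerivAt_id (0:ℝ)).mul ((hus.differentiable (by simp) 0).hasDerivAt)
    have h2 : f = id * (fun x => 1 + x ^ p * v x) := funext hfv
    have h3 := d.fd.2.2.2.1 0 (by simp)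
    rw [h2, h1.deriv] at h3
    simpa using h3
  obtain ⟨r, hr, hr1, σ, hσ, θ, hθ, hpos, hest⟩ := h.nonflat_est d.fd d.f1 hv hfv hv0 hu0
  set ψ := Fl.psi ξ θ σ (p + 1) with hψ
  have hψs : ContDiffOn ℝ ∞ ψ (Ioo 0 r) := h.psi_smooth hθ hr1 hpos
  set G1 : ℝ → ℝ := fun x => if x ≤ 0 then 0 else deriv ψ x with hG1
  have hG1e : EqOn G1 (deriv ψ) (Ioi 0) := fun x hx => by
    simp only [hG1]; rw [if_neg (not_le.2 hx)]
  have hit : ∀ i, EqOn (iteratedDeriv i G1) (iteratedDeriv (i + 1) ψ) (Ioi 0) := by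
    intro i x hx
    rw [iteratedDeriv_succ']
    exact (hG1e.eventuallyEq_of_mem (isOpen_Ioi.mem_nhds hx)).iteratedDeriv_eq i
  have hgl := (glue_zero (G := G1) hr (fun x hx => by simp only [hG1]; rw [if_pos hx])
    ((hψs.deriv_of_isOpen isOpen_Ioo (by simp)).congr fun x hx => hG1e hx.1)
    (fun i => by
      obtain ⟨C, r', hr', -, hb⟩ := hest i
      have hz : Tendsto (fun z : ℝ => C * z) (𝓝[>] 0) (𝓝 0) := by
        have : Tendsto (fun z : ℝ => C * z) (𝓝 0) (𝓝 (C * 0)) := (continuous_const.mul continuous_id).tendsto 0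
        rw [mul_zero] at this
        exact this.mono_left nhdsWithin_le_nhds
      refine squeeze_zero_norm' ?_ hz
      filter_upwards [Ioo_mem_nhdsGT hr'] with z hz
      rw [hit i hz.1]
      exact hb z hz)).1
  obtain ⟨G2, hG2, hG2e⟩ := extend_loc (g := G1) hr (hgl.mono fun x hx => hx.2)
  obtain ⟨Ω, hΩ, hΩd⟩ := antider hG2
  obtain ⟨ρ, hρ, hρr, hρe⟩ : ∃ ρ > 0, ρ ≤ r ∧ ∀ x ∈ Ioo 0 ρ, G2 x = G1 x :=
    ⟨r / 4, by positivity, by linarith, fun x hx => hG2e x ⟨by linarith [hx.1], hx.2⟩⟩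
  set z0 := ρ / 2 with hz0
  have hz0m : z0 ∈ Ioo 0 ρ := ⟨by positivity, by linarith⟩
  have hconst : ∀ z ∈ Ioo 0 ρ, ψ z - Ω z = ψ z0 - Ω z0 := by
    intro z hz
    refine (convex_Ioo 0 ρ).is_const_of_fderivWithin_eq_zero (𝕜 := ℝ) (f := fun z => ψ z - Ω z) ?_ ?_ hz hz0m
    · intro w hw
      exact (((cd_at isOpen_Ioo hψs ⟨hw.1, hw.2.trans_le hρr⟩).differentiableAt (by simp)).sub
        (hΩd w).differentiableAt).differentiableWithinAt
    · intro w hw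
      have h1 := ((cd_at isOpen_Ioo hψs ⟨hw.1, hw.2.trans_le hρr⟩).differentiableAt (by simp)).hasDerivAt
      have h2 := h1.sub (hΩd w)
      rw [hρe w hw, hG1e hw.1, sub_self] at h2
      have h3 := h2.hasFDerivAt.hasFDerivWithinAt (s := Ioo 0 ρ)
      have h4 := h3.fderivWithin (isOpen_Ioo.uniqueDiffWithinAt hw)
      refine h4.trans ?_
      ext; simp
  set c := ψ z0 - Ω z0 with hc
  set Z : ℝ → ℝ := fun z => σ * (z ^ (p + 1) * Real.exp (θ z + Ω z + c)) with hZ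
  have hZs : ContDiff ℝ ∞ Z :=
    contDiff_const.mul ((contDiff_id.pow _).mul ((hθ.add hΩ).add contDiff_const).exp)
  have hσ2 : σ * σ = 1 := by rcases hσ with rfl | rfl <;> norm_num
  have hZξ : ∀ z ∈ Ico 0 ρ, ξ z = Z z := by
    intro z hz
    rcases hz.1.eq_or_lt with h1 | h1
    · rw [← h1, h.xi0]; simp [hZ]
    · have h2 := hconst z ⟨h1, hz.2⟩
      have h3 := hpos z ⟨h1, hz.2.trans_le hρr⟩
      have h4 : Real.log (σ * ξ z) = Real.log (z ^ (p + 1)) + (θ z + Ω z + c) := by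
        rw [Real.log_pow, ← h2, hψ]
        unfold Fl.psi
        ring
      have h5 : σ * ξ z = z ^ (p + 1) * Real.exp (θ z + Ω z + c) := by
        rw [← Real.exp_log h3, h4, Real.exp_add, Real.exp_log (by positivity)]
      simp only [hZ]
      rw [← h5, ← mul_assoc, hσ2, one_mul]
  refine ⟨fun x => if x < 0 then Z x else ξ x, fun x hx => if_neg (not_lt.2 hx), ρ, hρ, fun x hx => ?_⟩
  apply ContDiffAt.contDiffWithinAt
  by_cases hx0 : x < ρ
  · refine hZs.contDiffAt.congr_of_eventuallyEq ?_
    filter_upwards [isOpen_Iio.mem_nhds hx0] with w hw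
    by_cases hw0 : w < 0
    · rw [if_pos hw0]
    · rw [if_neg hw0, hZξ w ⟨not_lt.1 hw0, hw⟩]
  · have hxp : 0 < x := by linarith [not_lt.1 hx0]
    refine (cd_at isOpen_Ioo h.sm ⟨hxp, hx.2⟩).congr_of_eventuallyEq ?_
    filter_upwards [isOpen_Ioi.mem_nhds hxp] with w hw
    exact if_neg (not_lt.2 (le_of_lt hw))

lemma end_any {D : Set ℝ} {α : ℝ} {f g ξ : ℝ → ℝ} {φ : ℝ → ℝ → ℝ} {K : ℝ}
    (d : Dat D α f g ξ φ K) (k : ℕ) {ε : ℝ} (hε : 0 < ε) :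
    ∃ (f' g' ξ' : ℝ → ℝ) (φ' : ℝ → ℝ → ℝ) (K' : ℝ), Dat D α f' g' ξ' φ' K' ∧
      (∀ j ≤ k, ∀ x ∈ Icc (0:ℝ) 1, |iteratedDeriv j (fun y => f y - f' y) x| ≤ ε) ∧
      (∀ j ≤ k, ∀ x ∈ Icc (0:ℝ) 1, |iteratedDeriv j (fun y => g y - g' y) x| ≤ ε) ∧
      (∀ x ≥ 1/2, ξ' x = ξ x) ∧ ∃ ρ > 0, ContDiffOn ℝ ∞ ξ' (Ioo (-ρ) 1) := by
  by_cases h0 : (0:ℝ) ∈ D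
  · exact end_flat d h0 k hε
  · obtain ⟨ξ1, he, ρ, hρ, hs⟩ := end_nonflat d h0
    have heI : EqOn ξ1 ξ (Icc 0 1) := fun x hx => he x hx.1
    refine ⟨f, g, ξ1, φ, K, ⟨d.hD, d.hα, ⟨d.fl.c1.congr heI, d.fl.sm.congr fun x hx => he x hx.1.le,
      ⟨d.fl.fl.1, fun x hx t => ⟨(d.fl.fl.2 x hx t).1, ?_⟩⟩, d.fl.K0, ?_⟩, d.f1, d.gα, d.fd, d.gd, d.fI, d.gI⟩,
      ?_, ?_, fun x hx => he x (by linarith), ρ, hρ, hs⟩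
    · rw [heI (d.fl.fl.2 x hx t).1]; exact (d.fl.fl.2 x hx t).2
    · intro x hx y hy
      rw [heI hx, heI hy]; exact d.fl.lip hx hy
    · intro j _ x _; simp [hε.le]
    · intro j _ x _; simp [hε.le]

end Aux
end

section
open Set Filter Topology
open scoped ContDiff
namespace Aux

/-- Conjugation of a map by the reflection of the unit interval. -/
def rf (f : ℝ → ℝ) : ℝ → ℝ := fun x => 1 - f (1 - x)

lemma it_rf (u : ℝ → ℝ) (n : ℕ) (p : ℝ) :
    |iteratedDeriv n (fun x => -(u (1 - x))) p| = |iteratedDeriv n u (1 - p)| := by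
  have h := iteratedDeriv_comp_const_sub n u 1
  have h2 : iteratedDeriv n (fun x => -(u (1 - x))) p = - iteratedDeriv n (fun x => u (1 - x)) p :=
    iteratedDeriv_neg n (fun x => u (1 - x)) p
  rw [h2, h, abs_neg]
  simp [abs_mul]

lemma rf_mem {x : ℝ} (hx : x ∈ Icc (0:ℝ) 1) : 1 - x ∈ Icc (0:ℝ) 1 :=
  ⟨by linarith [hx.2], by linarith [hx.1]⟩

lemma rf_iti (f : ℝ → ℝ) (p : ℝ) : ITIat (rf f) p ↔ ITIat f (1 - p) := by
  have e : (fun x => rf f x - x) = fun x => -((fun y => f y - y) (1 - x)) := by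
    funext x; simp only [rf]; ring
  unfold ITIat
  rw [e]
  have h1 : rf f p = p ↔ f (1 - p) = 1 - p := by
    simp only [rf]; constructor <;> intro h <;> linarith
  rw [h1]
  refine and_congr_right fun _ => forall_congr' fun n => imp_congr_right fun _ => ?_
  exact abs_eq_zero.symm.trans
    ((Eq.congr_left (it_rf (fun y => f y - y) n p)).trans abs_eq_zero)

lemma rf_diffeo {f : ℝ → ℝ} (h : SmoothDiffeoI f) : SmoothDiffeoI (rf f) := by
  obtain ⟨h1, h2, h3, h4, h5⟩ := h
  refine ⟨?_, by simp [rf, h3], by simp [rf, h2], fun x hx => ?_, fun x hx => rf_mem (h5 (rf_mem hx))⟩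
  · exact contDiff_const.sub (h1.comp (contDiff_const.sub contDiff_id))
  · have : deriv (rf f) x = deriv f (1 - x) := by
      unfold rf
      rw [deriv_const_sub, deriv_comp_const_sub, neg_neg]
    rw [this]; exact h4 _ (rf_mem hx)

lemma Dat.rf {D : Set ℝ} {α : ℝ} {f g ξ : ℝ → ℝ} {φ : ℝ → ℝ → ℝ} {K : ℝ}
    (d : Dat D α f g ξ φ K) : Dat {x | 1 - x ∈ D} α (rf f) (rf g) (fun x => -ξ (1 - x))
      (fun t => Aux.rf (φ t)) K where
  hD := by
    intro x hx
    have := d.hD hx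
    simp only [mem_insert_iff, mem_singleton_iff] at this ⊢
    rcases this with h | h
    · right; linarith
    · left; linarith
  hα := d.hα
  fl := by
    have hc : ∀ n s, ContDiffOn ℝ n (fun x : ℝ => 1 - x) s := fun n s =>
      contDiffOn_const.sub contDiffOn_id
    refine ⟨(d.fl.c1.comp (hc _ _) fun x hx => rf_mem hx).neg,
      (d.fl.sm.comp (hc _ _) fun x hx => ?_).neg, ⟨fun x hx => ?_, fun x hx t => ⟨?_, ?_⟩⟩, d.fl.K0, ?_⟩
    · exact ⟨by linarith [hx.2], by linarith [hx.1]⟩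
    · simp [Aux.rf, d.fl.zero (rf_mem hx)]
    · exact rf_mem (d.fl.mem (rf_mem hx) t)
    · have := (d.fl.der (rf_mem hx) t).const_sub 1
      simpa [Aux.rf] using this
    · intro x hx y hy
      have := d.fl.lip (rf_mem hx) (rf_mem hy)
      simpa [edist_neg_neg, edist_sub_left] using this
  f1 := fun x hx => by simp [Aux.rf, d.f1 _ (rf_mem hx)]
  gα := fun x hx => by simp [Aux.rf, d.gα _ (rf_mem hx)]
  fd := rf_diffeo d.fd
  gd := rf_diffeo d.gd
  fI := fun p hp => (rf_iti f p).trans (d.fI _ (rf_mem hp))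
  gI := fun p hp => (rf_iti g p).trans (d.gI _ (rf_mem hp))

lemma rf_rf (f : ℝ → ℝ) : rf (rf f) = f := by
  funext x; simp [rf]

lemma rf_est (f f' : ℝ → ℝ) (j : ℕ) (x : ℝ) :
    |iteratedDeriv j (fun y => rf f y - f' y) x| = |iteratedDeriv j (fun y => f y - rf f' y) (1 - x)| := by
  rw [← it_rf]
  congr 2
  funext y; simp only [rf, sub_sub_cancel]; ring

lemma tri {f f1 f2 : ℝ → ℝ} (h : ContDiff ℝ ∞ f) (h1 : ContDiff ℝ ∞ f1) (h2 : ContDiff ℝ ∞ f2)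
    {j : ℕ} {x ε : ℝ} (a : |iteratedDeriv j (fun y => f y - f1 y) x| ≤ ε / 2)
    (b : |iteratedDeriv j (fun y => f1 y - f2 y) x| ≤ ε / 2) :
    |iteratedDeriv j (fun y => f y - f2 y) x| ≤ ε := by
  have e : (fun y => f y - f2 y) = (fun y => f y - f1 y) + (fun y => f1 y - f2 y) := by
    funext y; simp
  have hj : ((j : ℕ∞) : WithTop ℕ∞) ≤ ∞ := by exact_mod_cast le_top
  rw [e, iteratedDeriv_add ((h.sub h1).of_le hj).contDiffAt ((h1.sub h2).of_le hj).contDiffAt]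
  exact (abs_add_le _ _).trans (by linarith)

lemma flat_div (N : ℕ) : ∀ {G : ℝ → ℝ}, ContDiff ℝ ∞ G → (∀ n, iteratedDeriv n G 0 = 0) →
    ∃ H : ℝ → ℝ, ContDiff ℝ ∞ H ∧ ∀ x, G x = x ^ N * H x := by
  induction N with
  | zero => intro G hG _; exact ⟨G, hG, by simp⟩
  | succ N ih =>
    intro G hG h
    obtain ⟨H, hH, e⟩ := had hG (by simpa using h 0)
    have eG : G = fun x => x * H x := funext e
    obtain ⟨H2, hH2, e2⟩ := ih hH (fun n => by
      have := h (n + 1)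
      rw [eG, mul_id_iter hH] at this
      simp only [zero_mul, zero_add, mul_eq_zero] at this
      rcases this with h | h
      · exfalso; have : (0:ℝ) < n + 1 := by positivity
        linarith
      · exact h)
    exact ⟨H2, hH2, fun x => by rw [e, e2]; ring⟩

lemma nowhere_flat {D : Set ℝ} {α : ℝ} {f g ξ : ℝ → ℝ} {φ : ℝ → ℝ → ℝ} {K : ℝ}
    (d : Dat D α f g ξ φ K) (hξ : ContDiff ℝ ∞ ξ) {p : ℝ} (hp : p ∈ Ioo (0:ℝ) 1) :
    ∃ n, iteratedDeriv n ξ p ≠ 0 := by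
  by_contra! hc
  have hpI : p ∈ Icc (0:ℝ) 1 := Ioo_subset_Icc_self hp
  have hG : ContDiff ℝ ∞ (fun x => ξ (p + x)) := hξ.comp (contDiff_const.add contDiff_id)
  have hG0 : ∀ n, iteratedDeriv n (fun x => ξ (p + x)) 0 = 0 := fun n => by
    rw [iteratedDeriv_comp_const_add]; simpa using hc n
  have hu : ContDiff ℝ ∞ (fun y => f y - y) := d.fd.1.sub contDiff_id
  have hF : ContDiff ℝ ∞ (fun x => f (p + x) - (p + x)) :=
    hu.comp (contDiff_const.add contDiff_id)
  have hflat : ∀ N : ℕ, ∃ H : ℝ → ℝ, ContDiff ℝ ∞ H ∧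
      ∀ x, (fun x => f (p + x) - (p + x)) x = x ^ N * H x := by
    intro N
    obtain ⟨H, hH, e⟩ := flat_div N hG hG0
    obtain ⟨M, hM1, hM⟩ := bound_on_compact hH 0 0 1
    refine div_of_O N hF (C := Real.exp K * M) (r := 1 - p) (by linarith [hp.2]) fun x hx => ?_
    have hx0 := hx.1
    have hm : p + x ∈ Icc (0:ℝ) 1 := ⟨by linarith [hp.1, hx.1], by linarith [hx.2]⟩
    have h1 := d.fl.disp_le hm 1
    rw [← d.f1 _ hm] at h1
    simp only [abs_one, mul_one] at h1
    have h2 : |H x| ≤ M := by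
      simpa using hM 0 le_rfl x ⟨hx.1.le, by linarith [hx.2, hp.1]⟩
    have h3 : ξ (p + x) = x ^ N * H x := e x
    rw [h3, abs_mul, abs_of_nonneg (pow_nonneg hx0.le N)] at h1
    refine h1.trans ?_
    have : x ^ N * |H x| ≤ x ^ N * M := mul_le_mul_of_nonneg_left h2 (pow_nonneg hx0.le N)
    calc Real.exp K * (x ^ N * |H x|) ≤ Real.exp K * (x ^ N * M) :=
          mul_le_mul_of_nonneg_left this (Real.exp_pos _).le
      _ = _ := by ring
  have hz : ∀ j, iteratedDeriv j (fun y => f y - y) p = 0 := fun j => by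
    obtain ⟨H, -, e⟩ := flat_iter hflat j 1
    have h0 := e 0
    have h1 := congrFun (iteratedDeriv_comp_const_add j (fun y => f y - y) p) 0
    simp only [add_zero] at h1
    rw [← h1]; simpa using h0
  have hI : ITIat f p := ⟨by have := hz 0; simp at this; linarith, fun n _ => hz n⟩
  have := d.hD ((d.fI p hpI).1 hI)
  simp only [mem_insert_iff, mem_singleton_iff] at this
  rcases this with h | h
  · linarith [hp.1]
  · linarith [hp.2]

lemma cutoff {ξ : ℝ → ℝ} {δ : ℝ} (hδ : 0 < δ) (h : ContDiffOn ℝ ∞ ξ (Ioo (-(3*δ)) (1 + 3*δ))) :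
    ∃ ζ : ℝ → ℝ, ContDiff ℝ ∞ ζ ∧ EqOn ζ ξ (Icc 0 1) := by
  let T := Real.smoothTransition
  have hT : ContDiff ℝ ∞ T := Real.smoothTransition.contDiff
  have hc : ContDiff ℝ ∞ (fun x => T ((x + 2*δ)/δ) * T ((1 + 2*δ - x)/δ)) :=
    (hT.comp ((contDiff_id.add contDiff_const).div_const _)).mul
      (hT.comp ((contDiff_const.sub contDiff_id).div_const _))
  refine ⟨fun x => T ((x + 2*δ)/δ) * T ((1 + 2*δ - x)/δ) * ξ x, ?_, fun x hx => ?_⟩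
  · rw [contDiff_iff_contDiffAt]
    intro x
    by_cases h1 : x < -(2*δ)
    · refine (contDiffAt_const (c := (0:ℝ))).congr_of_eventuallyEq ?_
      filter_upwards [isOpen_Iio.mem_nhds h1] with w hw
      have hw' : w < -(2*δ) := hw
      have : T ((w + 2*δ)/δ) = 0 := Real.smoothTransition.zero_of_nonpos
        (div_nonpos_of_nonpos_of_nonneg (by linarith) hδ.le)
      simp [this]
    by_cases h2 : 1 + 2*δ < x
    · refine (contDiffAt_const (c := (0:ℝ))).congr_of_eventuallyEq ?_
      filter_upwards [isOpen_Ioi.mem_nhds h2] with w hw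
      have hw' : 1 + 2*δ < w := hw
      have : T ((1 + 2*δ - w)/δ) = 0 := Real.smoothTransition.zero_of_nonpos
        (div_nonpos_of_nonpos_of_nonneg (by linarith) hδ.le)
      simp [this]
    · exact hc.contDiffAt.mul (h.contDiffAt (isOpen_Ioo.mem_nhds ⟨by linarith, by linarith⟩))
  · have a : T ((x + 2*δ)/δ) = 1 := Real.smoothTransition.one_of_one_le
      ((one_le_div hδ).2 (by linarith [hx.1]))
    have b : T ((1 + 2*δ - x)/δ) = 1 := Real.smoothTransition.one_of_one_le
      ((one_le_div hδ).2 (by linarith [hx.2]))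
    simp [a, b]

lemma Dat.congr {D : Set ℝ} {α : ℝ} {f g ξ ζ : ℝ → ℝ} {φ : ℝ → ℝ → ℝ} {K : ℝ}
    (d : Dat D α f g ξ φ K) (he : EqOn ζ ξ (Icc 0 1)) : Dat D α f g ζ φ K := by
  refine ⟨d.hD, d.hα, ⟨d.fl.c1.congr he, d.fl.sm.congr fun x hx => he (Ioo_subset_Icc_self hx),
      ⟨d.fl.fl.1, fun x hx t => ⟨(d.fl.fl.2 x hx t).1, ?_⟩⟩, d.fl.K0, ?_⟩, d.f1, d.gα, d.fd, d.gd, d.fI, d.gI⟩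
  · rw [he (d.fl.fl.2 x hx t).1]; exact (d.fl.fl.2 x hx t).2
  · intro x hx y hy
    rw [he hx, he hy]; exact d.fl.lip hx hy

lemma both_ends {D : Set ℝ} {α : ℝ} {f g ξ : ℝ → ℝ} {φ : ℝ → ℝ → ℝ} {K : ℝ}
    (d : Dat D α f g ξ φ K) (k : ℕ) {ε : ℝ} (hε : 0 < ε) :
    ∃ (f' g' ξ' : ℝ → ℝ) (φ' : ℝ → ℝ → ℝ) (K' : ℝ), Dat D α f' g' ξ' φ' K' ∧
      (∀ j ≤ k, ∀ x ∈ Icc (0:ℝ) 1, |iteratedDeriv j (fun y => f y - f' y) x| ≤ ε) ∧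
      (∀ j ≤ k, ∀ x ∈ Icc (0:ℝ) 1, |iteratedDeriv j (fun y => g y - g' y) x| ≤ ε) ∧
      ContDiff ℝ ∞ ξ' := by
  obtain ⟨f1, g1, ξ1, φ1, K1, d1, ef1, eg1, -, ρ1, hρ1, s1⟩ := end_any d k (half_pos hε)
  obtain ⟨f2, g2, ξ2, φ2, K2, d2, ef2, eg2, hh, ρ2, hρ2, s2⟩ := end_any d1.rf k (half_pos hε)
  have d3 := d2.rf
  have eD : {x : ℝ | 1 - x ∈ {x : ℝ | 1 - x ∈ D}} = D := by ext x; simp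
  rw [eD] at d3
  have hm := min_le_left ρ1 ρ2
  have hm2 := min_le_right ρ1 ρ2
  have hm0 : 0 < min ρ1 ρ2 := lt_min hρ1 hρ2
  have hsm : ContDiffOn ℝ ∞ (fun x => -ξ2 (1 - x))
      (Ioo (-(3 * (min ρ1 ρ2 / 3))) (1 + 3 * (min ρ1 ρ2 / 3))) := by
    intro x hx
    have hx1 := hx.1
    have hx2 := hx.2
    refine ContDiffAt.contDiffWithinAt ?_
    by_cases hxc : 0 < x
    · have hA : ContDiffAt ℝ ∞ ξ2 (1 - x) :=
        s2.contDiffAt (isOpen_Ioo.mem_nhds ⟨by linarith, by linarith⟩)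
      exact (ContDiffAt.comp x hA (contDiffAt_const.sub contDiffAt_id)).neg
    · have hA : ContDiffAt ℝ ∞ ξ1 x :=
        s1.contDiffAt (isOpen_Ioo.mem_nhds ⟨by linarith, by linarith⟩)
      refine hA.congr_of_eventuallyEq ?_
      filter_upwards [isOpen_Iio.mem_nhds (show x < 1/2 by linarith)] with w hw
      have hw' : w < 1/2 := hw
      rw [hh (1 - w) (by linarith)]
      simp
  obtain ⟨ζ, hζ, hζe⟩ := cutoff (by positivity : 0 < min ρ1 ρ2 / 3) hsm
  refine ⟨_, _, ζ, _, _, d3.congr hζe, fun j hj x hx => ?_, fun j hj x hx => ?_, hζ⟩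
  · refine tri d.fd.1 d1.fd.1 d3.fd.1 (ef1 j hj x hx) ?_
    have := ef2 j hj (1 - x) (rf_mem hx)
    rw [rf_est] at this
    simpa using this
  · refine tri d.gd.1 d1.gd.1 d3.gd.1 (eg1 j hj x hx) ?_
    have := eg2 j hj (1 - x) (rf_mem hx)
    rw [rf_est] at this
    simpa using this

end Aux
end

/-- Let `∂` be a nonempty subset of `{0,1}` and `(f,g) ≠ (id,id)` a commuting pair in
`Diff*_∂[0,1]`, equal to the time-1 and time-`α` maps (`α` irrational) of the flow of a
vector field `ξ`, `C¹` on `[0,1]` and `C^∞` on `(0,1)`. Then `(f,g)` is `C^k`-approximated,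
for every `k` and every `ε > 0`, by pairs `(f̃,g̃)` in `Diff*_∂[0,1]` which are the time-1
and time-`α` maps of the flow of a `C^∞` vector field on `[0,1]`, nowhere infinitely flat
on `(0,1)`. -/
theorem approx_by_clean_irrational (D : Set ℝ) (hD : D ⊆ ({0, 1} : Set ℝ))
    (hDne : D.Nonempty) (f g ξ : ℝ → ℝ) (φ : ℝ → ℝ → ℝ) (α : ℝ)
    (hf : DiffStar D f) (hg : DiffStar D g)
    (hcomm : ∀ x ∈ Icc (0 : ℝ) 1, f (g x) = g (f x))
    (hnontriv : ¬ ((∀ x ∈ Icc (0 : ℝ) 1, f x = x) ∧ ∀ x ∈ Icc (0 : ℝ) 1, g x = x))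
    (hξ1 : ContDiffOn ℝ 1 ξ (Icc (0 : ℝ) 1))
    (hxiSmooth : ContDiffOn ℝ (⊤ : ℕ∞) ξ (Ioo (0 : ℝ) 1))
    (hflow : IsFlowOn ξ φ 0 1)
    (hf1 : ∀ x ∈ Icc (0 : ℝ) 1, f x = φ 1 x)
    (hgα : ∀ x ∈ Icc (0 : ℝ) 1, g x = φ α x)
    (hα : Irrational α)
    (ε : ℝ) (hε : 0 < ε) (k : ℕ) :
    ∃ ftil gtil ξtil : ℝ → ℝ, ∃ φtil : ℝ → ℝ → ℝ,
      DiffStar D ftil ∧ DiffStar D gtil ∧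
      (∀ i ≤ k, ∀ x ∈ Icc (0 : ℝ) 1, |iteratedDeriv i (fun y => f y - ftil y) x| ≤ ε) ∧
      (∀ i ≤ k, ∀ x ∈ Icc (0 : ℝ) 1, |iteratedDeriv i (fun y => g y - gtil y) x| ≤ ε) ∧
      ContDiff ℝ (⊤ : ℕ∞) ξtil ∧ IsFlowOn ξtil φtil 0 1 ∧
      (∀ x ∈ Icc (0 : ℝ) 1, ftil x = φtil 1 x) ∧
      (∀ x ∈ Icc (0 : ℝ) 1, gtil x = φtil α x) ∧
      ∀ p ∈ Ioo (0 : ℝ) 1, ∃ n : ℕ, iteratedDeriv n ξtil p ≠ 0 := by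
  obtain ⟨K, hF⟩ := Aux.Fl.of hξ1 hxiSmooth hflow
  have hα0 : α ≠ 0 := hα.ne_zero
  have key : ∀ t : ℝ, t ≠ 0 → (∀ x ∈ Icc (0 : ℝ) 1, φ t x = x) →
      ∀ s : ℝ, ∀ x ∈ Icc (0 : ℝ) 1, φ s x = x := by
    intro t ht h s x hx
    refine hF.fixed hx ?_ s
    by_contra h0
    exact hF.flow_ne hx h0 ht (h x hx)
  have nf : ¬ ∀ x ∈ Icc (0 : ℝ) 1, f x = x := fun h =>
    hnontriv ⟨h, fun x hx => by
      rw [hgα x hx]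
      exact key 1 one_ne_zero (fun y hy => by rw [← hf1 y hy]; exact h y hy) α x hx⟩
  have ng : ¬ ∀ x ∈ Icc (0 : ℝ) 1, g x = x := fun h =>
    hnontriv ⟨fun x hx => by
      rw [hf1 x hx]
      exact key α hα0 (fun y hy => by rw [← hgα y hy]; exact h y hy) 1 x hx, h⟩
  have d : Aux.Dat D α f g ξ φ K := ⟨hD, hα0, hF, hf1, hgα, hf.1, hg.1,
    hf.2.resolve_left nf, hg.2.resolve_left ng⟩
  obtain ⟨f', g', ξ', φ', K', d', ef, eg, hs⟩ := Aux.both_ends d k hε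
  exact ⟨f', g', ξ', φ', ⟨d'.fd, Or.inr d'.fI⟩, ⟨d'.gd, Or.inr d'.gI⟩, ef, eg, hs, d'.fl.fl,
    d'.f1, d'.gα, fun p hp => Aux.nowhere_flat d' hs hp⟩
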